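/- Let u be a smooth solution to the special Lagrangian equation ∑_{i=1}^n arctan λᵢ(x) = c on ℝⁿ satisfying 3 + (1−ε)λᵢ(x)² + 2λᵢ(x)λⱼ(x) ≥ 0 for all indices i, j, all x, and some fixed ε > 0. Then the function b = V^{ε/n} satisfies Δ_g b ≥ 2 |∇_g b|²_g / b at every point of ℝⁿ. -/

import Mathlib

noncomputable section

/-- The Hessian matrix `D²u(x)`, with entries `∂ᵢ∂ⱼ u (x)`. -/
def Hess {n : ℕ} (u : EuclideanSpace ℝ (Fin n) → ℝ) (x : EuclideanSpace ℝ (Fin n)) :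
    Matrix (Fin n) (Fin n) ℝ :=
  Matrix.of fun i j =>
    iteratedFDeriv ℝ 2 u x ![EuclideanSpace.single i 1, EuclideanSpace.single j 1]

/-- The induced metric `g = I + D²u · D²u` on the gradient graph `(x, ∇u(x))`. -/
def gMat {n : ℕ} (u : EuclideanSpace ℝ (Fin n) → ℝ) (x : EuclideanSpace ℝ (Fin n)) :
    Matrix (Fin n) (Fin n) ℝ :=
  1 + Hess u x * Hess u x

/-- The Laplace–Beltrami operator `Δ_g v = ∑ g^{ij} ∂ᵢ∂ⱼ v` of the induced metric. -/
def lapg {n : ℕ} (u v : EuclideanSpace ℝ (Fin n) → ℝ) (x : EuclideanSpace ℝ (Fin n)) : ℝ :=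
  ∑ i, ∑ j, (gMat u x)⁻¹ i j *
    iteratedFDeriv ℝ 2 v x ![EuclideanSpace.single i 1, EuclideanSpace.single j 1]

/-- The squared metric gradient norm `|∇_g v|²_g = ∑ g^{ij} ∂ᵢv ∂ⱼv`. -/
def gradSq {n : ℕ} (u v : EuclideanSpace ℝ (Fin n) → ℝ) (x : EuclideanSpace ℝ (Fin n)) : ℝ :=
  ∑ i, ∑ j, (gMat u x)⁻¹ i j * fderiv ℝ v x (EuclideanSpace.single i 1) *
    fderiv ℝ v x (EuclideanSpace.single j 1)

/-- The volume element `V = √(det g)`. -/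
def Vol {n : ℕ} (u : EuclideanSpace ℝ (Fin n) → ℝ) (x : EuclideanSpace ℝ (Fin n)) : ℝ :=
  Real.sqrt ((gMat u x).det)

end

section Part1
open scoped ContDiff
open MeasureTheory

namespace SL

abbrev Eu (n : ℕ) := EuclideanSpace ℝ (Fin n)

/-- partial derivative -/
noncomputable def pd {n : ℕ} (i : Fin n) (f : Eu n → ℝ) (x : Eu n) : ℝ :=
  fderiv ℝ f x (EuclideanSpace.single i 1)

variable {n : ℕ}

lemma pd_add {f g : Eu n → ℝ} {x : Eu n} (i : Fin n) (hf : DifferentiableAt ℝ f x)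
    (hg : DifferentiableAt ℝ g x) : pd i (fun y => f y + g y) x = pd i f x + pd i g x := by
  unfold pd; rw [fderiv_fun_add hf hg]; rfl

lemma pd_sub {f g : Eu n → ℝ} {x : Eu n} (i : Fin n) (hf : DifferentiableAt ℝ f x)
    (hg : DifferentiableAt ℝ g x) : pd i (fun y => f y - g y) x = pd i f x - pd i g x := by
  unfold pd; rw [fderiv_fun_sub hf hg]; rfl

lemma pd_mul {f g : Eu n → ℝ} {x : Eu n} (i : Fin n) (hf : DifferentiableAt ℝ f x)
    (hg : DifferentiableAt ℝ g x) :
    pd i (fun y => f y * g y) x = pd i f x * g x + f x * pd i g x := by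
  unfold pd; rw [fderiv_fun_mul hf hg]; simp; ring

lemma pd_const (i : Fin n) (c : ℝ) (x : Eu n) : pd i (fun _ => c) x = 0 := by
  unfold pd; simp

lemma pd_const_mul {f : Eu n → ℝ} {x : Eu n} (i : Fin n) (c : ℝ) (hf : DifferentiableAt ℝ f x) :
    pd i (fun y => c * f y) x = c * pd i f x := by
  rw [pd_mul i (differentiableAt_const c) hf, pd_const]; ring

lemma pd_sum {ι : Type*} {s : Finset ι} {f : ι → Eu n → ℝ} {x : Eu n} (i : Fin n)
    (hf : ∀ k ∈ s, DifferentiableAt ℝ (f k) x) :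
    pd i (fun y => ∑ k ∈ s, f k y) x = ∑ k ∈ s, pd i (f k) x := by
  unfold pd; rw [fderiv_fun_sum hf]; simp

lemma pd_comp {g : ℝ → ℝ} {g' : ℝ} {f : Eu n → ℝ} {x : Eu n} (i : Fin n)
    (hg : HasDerivAt g g' (f x)) (hf : DifferentiableAt ℝ f x) :
    pd i (fun y => g (f y)) x = g' * pd i f x := by
  unfold pd
  have h := (hg.comp_hasFDerivAt x hf.hasFDerivAt).fderiv
  unfold Function.comp at h
  rw [h]; simp

lemma pd_affine {f : Eu n → ℝ} (hf : Differentiable ℝ f) (i : Fin n) (x y : Eu n) (t : ℝ) :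
    pd i (fun y => f (x + t • y)) y = t * pd i f (x + t • y) := by
  unfold pd
  have h : HasFDerivAt (fun y : Eu n => x + t • y) (t • ContinuousLinearMap.id ℝ (Eu n)) y :=
    ((hasFDerivAt_id y).const_smul t).const_add x
  have := ((hf (x + t • y)).hasFDerivAt.comp y h).fderiv
  unfold Function.comp at this
  rw [this]; simp

lemma pd_coord (i j : Fin n) (x : Eu n) : pd i (fun x : Eu n => x j) x = if i = j then 1 else 0 := by
  unfold pd
  have : HasFDerivAt (fun x : Eu n => x j) (EuclideanSpace.proj j : Eu n →L[ℝ] ℝ) x :=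
    (EuclideanSpace.proj j : Eu n →L[ℝ] ℝ).hasFDerivAt
  rw [this.fderiv]
  simp [eq_comm]

lemma contDiff_coord (j : Fin n) {m : WithTop ℕ∞} : ContDiff ℝ m (fun x : Eu n => x j) :=
  (EuclideanSpace.proj j : Eu n →L[ℝ] ℝ).contDiff

lemma fderiv_eq_sum (f : Eu n → ℝ) (x w : Eu n) : fderiv ℝ f x w = ∑ i, w i * pd i f x := by
  unfold pd
  have : w = ∑ i, w i • EuclideanSpace.single i (1 : ℝ) := by
    ext j; simp [Finset.sum_apply, Pi.single_apply]
  conv_lhs => rw [this]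
  simp

lemma pd_smooth {f : Eu n → ℝ} (i : Fin n) (hf : ContDiff ℝ ∞ f) : ContDiff ℝ ∞ (pd i f) := by
  unfold pd
  exact (hf.fderiv_right (m := ∞) (by simp)).clm_apply contDiff_const

lemma pd_contDiff {f : Eu n → ℝ} (i : Fin n) {k : ℕ} (hf : ContDiff ℝ (k+1 : ℕ) f) :
    ContDiff ℝ k (pd i f) := by
  unfold pd
  exact (hf.fderiv_right (m := k) (by simp)).clm_apply contDiff_const

lemma pd_cont {f : Eu n → ℝ} (i : Fin n) (hf : ContDiff ℝ 1 f) : Continuous (pd i f) := by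
  have := pd_contDiff (k := 0) i (by simpa using hf)
  exact this.continuous

lemma pd_comm {f : Eu n → ℝ} (hf : ContDiff ℝ ∞ f) (i j : Fin n) (x : Eu n) :
    pd i (pd j f) x = pd j (pd i f) x := by
  have hs : IsSymmSndFDerivAt ℝ f x :=
    hf.contDiffAt.isSymmSndFDerivAt (by simp only [minSmoothness_of_isRCLikeNormedField]; exact WithTop.coe_le_coe.2 le_top)
  have hd : DifferentiableAt ℝ (fderiv ℝ f) x :=
    ((hf.fderiv_right (m := ∞) (by simp)).differentiable (by simp)) x
  have key : ∀ a b : Fin n, pd a (pd b f) x =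
      fderiv ℝ (fderiv ℝ f) x (EuclideanSpace.single a 1) (EuclideanSpace.single b 1) := by
    intro a b
    unfold pd
    rw [fderiv_clm_apply hd (differentiableAt_const _)]
    simp
  rw [key, key]; exact hs _ _

lemma hess_eq {f : Eu n → ℝ} (hf : ContDiff ℝ 2 f) (i j : Fin n) (x : Eu n) :
    iteratedFDeriv ℝ 2 f x ![EuclideanSpace.single i 1, EuclideanSpace.single j 1]
      = pd i (pd j f) x := by
  have hd : DifferentiableAt ℝ (fderiv ℝ f) x :=
    ((hf.fderiv_right (m := 1) (by norm_num)).differentiable (by simp)) x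
  rw [iteratedFDeriv_two_apply]
  unfold pd
  rw [fderiv_clm_apply hd (differentiableAt_const _)]
  simp

lemma integral_pd {F : Eu n → ℝ} (i : Fin n) (hF : ContDiff ℝ 1 F) (hc : HasCompactSupport F) :
    ∫ x, pd i F x = 0 := by
  have hc' : HasCompactSupport (pd i F) := by
    have := hc.fderiv_apply (𝕜 := ℝ) (EuclideanSpace.single i (1:ℝ))
    exact this
  have h := integral_mul_fderiv_eq_neg_fderiv_mul_of_integrable (μ := (volume : Measure (Eu n)))
    (f := fun _ : Eu n => (1:ℝ)) (g := F) (v := EuclideanSpace.single i (1:ℝ)) (𝕜 := ℝ)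
    (by simp) (by simp only [one_mul]; exact (pd_cont i hF).integrable_of_hasCompactSupport hc')
    (by simp only [one_mul]; exact hF.continuous.integrable_of_hasCompactSupport hc)
    (by intro x _; fun_prop) (by intro x _; exact (hF.differentiable (by simp)) x)
  simpa [pd] using h

end SL
end Part1

section Part2
open scoped ContDiff
open MeasureTheory

namespace SL
variable {n : ℕ}

lemma pd_hcs {F : Eu n → ℝ} (i : Fin n) (hc : HasCompactSupport F) : HasCompactSupport (pd i F) := by
  have := hc.fderiv_apply (𝕜 := ℝ) (EuclideanSpace.single i (1:ℝ))
  exact this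

lemma hcs_mul_left {f g : Eu n → ℝ} (hc : HasCompactSupport g) :
    HasCompactSupport (fun x => f x * g x) := HasCompactSupport.mul_left hc

lemma hcs_mul_right {f g : Eu n → ℝ} (hc : HasCompactSupport f) :
    HasCompactSupport (fun x => f x * g x) := HasCompactSupport.mul_right hc

lemma hcs_sum {ι : Type*} {s : Finset ι} {f : ι → Eu n → ℝ} (hc : ∀ i ∈ s, HasCompactSupport (f i)) :
    HasCompactSupport (fun x => ∑ i ∈ s, f i x) := by
  classical
  induction s using Finset.induction_on with
  | empty => simp only [Finset.sum_empty]; exact HasCompactSupport.zero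
  | insert a t ha ih =>
    simp only [Finset.sum_insert ha]
    exact HasCompactSupport.add (hc a (by simp)) (ih fun i hi => hc i (by simp [hi]))

lemma ibp {f g : Eu n → ℝ} (i : Fin n) (hf : ContDiff ℝ 1 f) (hg : ContDiff ℝ 1 g)
    (hc : HasCompactSupport g) : ∫ x, f x * pd i g x = - ∫ x, pd i f x * g x := by
  have h := integral_pd i (hf.mul hg) (hcs_mul_left (f := f) hc)
  have e : pd i (fun x => f x * g x) = fun x => pd i f x * g x + f x * pd i g x := by
    ext x; exact pd_mul i (hf.differentiable (by simp) x) (hg.differentiable (by simp) x)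
  rw [e, integral_add] at h
  · linarith
  · exact ((pd_cont i hf).mul hg.continuous).integrable_of_hasCompactSupport (hcs_mul_left hc)
  · exact (hf.continuous.mul (pd_cont i hg)).integrable_of_hasCompactSupport
      (hcs_mul_left (pd_hcs i hc))

lemma ibp_div {P : Fin n → Eu n → ℝ} {ζ : Eu n → ℝ} (hP : ∀ i, ContDiff ℝ 1 (P i))
    (hd : ∀ x, ∑ i, pd i (P i) x = 0) (hζ : ContDiff ℝ 1 ζ) (hc : HasCompactSupport ζ) :
    ∫ x, ∑ i, P i x * pd i ζ x = 0 := by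
  rw [integral_finsetSum]
  · simp_rw [ibp _ (hP _) hζ hc]
    rw [Finset.sum_neg_distrib, ← integral_finsetSum]
    · simp_rw [← Finset.sum_mul, hd]; simp
    · intro i _
      exact ((pd_cont i (hP i)).mul hζ.continuous).integrable_of_hasCompactSupport (hcs_mul_left hc)
  · intro i _
    exact ((hP i).continuous.mul (pd_cont i hζ)).integrable_of_hasCompactSupport
      (hcs_mul_left (pd_hcs i hc))

lemma green {a : Fin n → Fin n → Eu n → ℝ} {f ζ : Eu n → ℝ} (ha : ∀ i j, ContDiff ℝ 1 (a i j))
    (hs : ∀ i j x, a i j x = a j i x) (hd : ∀ j x, ∑ i, pd i (a i j) x = 0)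
    (hf : ContDiff ℝ 2 f) (hζ : ContDiff ℝ 2 ζ) (hc : HasCompactSupport ζ) :
    ∫ x, ζ x * ∑ i, ∑ j, a i j x * pd i (pd j f) x =
      ∫ x, f x * ∑ i, ∑ j, a i j x * pd i (pd j ζ) x := by
  have hf1 : ∀ j, ContDiff ℝ 1 (pd j f) := fun j => pd_contDiff j (by exact_mod_cast hf)
  have hζ1 : ∀ j, ContDiff ℝ 1 (pd j ζ) := fun j => pd_contDiff j (by exact_mod_cast hζ)
  have hf' : ContDiff ℝ 1 f := hf.of_le (by norm_num)
  have hζ' : ContDiff ℝ 1 ζ := hζ.of_le (by norm_num)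
  let W : Fin n → Eu n → ℝ := fun i x => ζ x * (∑ j, a i j x * pd j f x) - f x * ∑ j, a i j x * pd j ζ x
  have hA : ∀ i, ContDiff ℝ 1 (fun x => ∑ j, a i j x * pd j f x) := fun i =>
    ContDiff.sum fun j _ => (ha i j).mul (hf1 j)
  have hB : ∀ i, ContDiff ℝ 1 (fun x => ∑ j, a i j x * pd j ζ x) := fun i =>
    ContDiff.sum fun j _ => (ha i j).mul (hζ1 j)
  have hW : ∀ i, ContDiff ℝ 1 (W i) := fun i => (hζ'.mul (hA i)).sub (hf'.mul (hB i))
  have hWc : ∀ i, HasCompactSupport (W i) := by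
    intro i
    apply HasCompactSupport.sub
    · exact hcs_mul_right hc
    · apply hcs_mul_left
      exact hcs_sum fun j _ => hcs_mul_left (pd_hcs j hc)
  have dd : ∀ {g : Eu n → ℝ}, ContDiff ℝ 1 g → ∀ x, DifferentiableAt ℝ g x := fun hg x =>
    hg.differentiable (by simp) x
  have key : ∀ x, ∑ i, pd i (W i) x = ζ x * (∑ i, ∑ j, a i j x * pd i (pd j f) x) -
      f x * ∑ i, ∑ j, a i j x * pd i (pd j ζ) x := by
    intro x
    have h1 : ∀ i, pd i (W i) x =
        (pd i ζ x * (∑ j, a i j x * pd j f x) +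
          ζ x * ∑ j, (pd i (a i j) x * pd j f x + a i j x * pd i (pd j f) x)) -
        (pd i f x * (∑ j, a i j x * pd j ζ x) +
          f x * ∑ j, (pd i (a i j) x * pd j ζ x + a i j x * pd i (pd j ζ) x)) := by
      intro i
      show pd i (fun x => ζ x * (∑ j, a i j x * pd j f x) - f x * ∑ j, a i j x * pd j ζ x) x = _
      rw [pd_sub i (dd (hζ'.mul (hA i)) x) (dd (hf'.mul (hB i)) x), pd_mul i (dd hζ' x) (dd (hA i) x),
        pd_mul i (dd hf' x) (dd (hB i) x), pd_sum i (fun j _ => dd ((ha i j).mul (hf1 j)) x),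
        pd_sum i (fun j _ => dd ((ha i j).mul (hζ1 j)) x)]
      congr 3
      · apply Finset.sum_congr rfl; intro j _; exact pd_mul i (dd (ha i j) x) (dd (hf1 j) x)
      · apply Finset.sum_congr rfl; intro j _; exact pd_mul i (dd (ha i j) x) (dd (hζ1 j) x)
    have z1 : ∑ i, ∑ j, pd i (a i j) x * pd j f x = 0 := by
      rw [Finset.sum_comm]; simp_rw [← Finset.sum_mul, hd]; simp
    have z2 : ∑ i, ∑ j, pd i (a i j) x * pd j ζ x = 0 := by
      rw [Finset.sum_comm]; simp_rw [← Finset.sum_mul, hd]; simp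
    have z3 : ∑ i, pd i ζ x * (∑ j, a i j x * pd j f x) = ∑ i, pd i f x * (∑ j, a i j x * pd j ζ x) := by
      simp_rw [Finset.mul_sum]
      rw [Finset.sum_comm]
      apply Finset.sum_congr rfl; intro i _; apply Finset.sum_congr rfl; intro j _
      rw [hs j i]; ring
    simp_rw [h1, Finset.sum_sub_distrib, Finset.sum_add_distrib, mul_add, Finset.sum_add_distrib,
      ← Finset.mul_sum, z1, z2, z3]
    ring
  have h0 : ∫ x, ∑ i, pd i (W i) x = 0 := by
    rw [integral_finsetSum]
    · simp_rw [integral_pd _ (hW _) (hWc _)]; simp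
    · intro i _
      exact (pd_cont i (hW i)).integrable_of_hasCompactSupport (pd_hcs i (hWc i))
  simp_rw [key] at h0
  rw [integral_sub] at h0
  · linarith
  · refine (Continuous.mul hζ.continuous ?_).integrable_of_hasCompactSupport (hcs_mul_right hc)
    exact continuous_finsetSum _ fun i _ => continuous_finsetSum _ fun j _ =>
      (ha i j).continuous.mul (pd_cont i (hf1 j))
  · refine (Continuous.mul hf.continuous ?_).integrable_of_hasCompactSupport (hcs_mul_left ?_)
    · exact continuous_finsetSum _ fun i _ => continuous_finsetSum _ fun j _ =>
        (ha i j).continuous.mul (pd_cont i (hζ1 j))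
    · exact hcs_sum fun i _ => hcs_sum fun j _ => hcs_mul_left (pd_hcs i (pd_hcs j hc))

/-- truncated power -/
noncomputable def pp (k : ℕ) (t : ℝ) : ℝ := (max t 0) ^ k

lemma pp_cont (k : ℕ) : Continuous (pp k) := by unfold pp; fun_prop

lemma pp_nonneg (k : ℕ) (t : ℝ) : 0 ≤ pp k t := by unfold pp; positivity

lemma pp_of_nonpos {k : ℕ} {t : ℝ} (ht : t ≤ 0) : pp (k+1) t = 0 := by
  unfold pp; rw [max_eq_right ht]; simp

lemma pp_of_nonneg {k : ℕ} {t : ℝ} (ht : 0 ≤ t) : pp k t = t ^ k := by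
  unfold pp; rw [max_eq_left ht]

lemma pp_succ (k : ℕ) (t : ℝ) : pp (k+2) t = t * pp (k+1) t := by
  rcases le_total t 0 with h | h
  · rw [pp_of_nonpos h, pp_of_nonpos h]; simp
  · rw [pp_of_nonneg h, pp_of_nonneg h]; ring

lemma pp_le_one {k : ℕ} {t : ℝ} (ht : t ≤ 1) : pp k t ≤ 1 := by
  unfold pp; exact pow_le_one₀ (by positivity) (max_le ht (by norm_num))

lemma pp_mono (k : ℕ) {s t : ℝ} (h : s ≤ t) : pp k s ≤ pp k t := by
  unfold pp; gcongr

lemma pp_hasDerivAt (k : ℕ) (t : ℝ) : HasDerivAt (pp (k+2)) ((k+2 : ℝ) * pp (k+1) t) t := by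
  rcases lt_trichotomy t 0 with h | h | h
  · have : pp (k+2) =ᶠ[nhds t] fun _ => 0 := by
      filter_upwards [Iio_mem_nhds h] with s hs using pp_of_nonpos (le_of_lt hs)
    rw [pp_of_nonpos h.le, mul_zero]
    exact (hasDerivAt_const t (0:ℝ)).congr_of_eventuallyEq this
  · subst h
    rw [pp_of_nonpos le_rfl, mul_zero, hasDerivAt_iff_tendsto_slope]
    have h1 : Filter.Tendsto (pp (k+1)) (nhdsWithin 0 {0}ᶜ) (nhds 0) := by
      have := (pp_cont (k+1)).tendsto 0
      rw [pp_of_nonpos le_rfl] at this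
      exact this.mono_left nhdsWithin_le_nhds
    refine h1.congr' ?_
    filter_upwards [self_mem_nhdsWithin] with s hs
    have hs : s ≠ 0 := hs
    simp only [slope, vsub_eq_sub, smul_eq_mul, sub_zero]
    rw [pp_succ, pp_of_nonpos (k := k+1) le_rfl]; field_simp; ring
  · have : pp (k+2) =ᶠ[nhds t] fun s => s ^ (k+2) := by
      filter_upwards [Ioi_mem_nhds h] with s hs using pp_of_nonneg (le_of_lt hs)
    rw [pp_of_nonneg h.le]
    have := (hasDerivAt_pow (k+2) t).congr_of_eventuallyEq this
    simpa using this

lemma pp_contDiff (k : ℕ) : ContDiff ℝ k (pp (k+1)) := by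
  induction k with
  | zero => exact contDiff_zero.2 (pp_cont 1)
  | succ k ih =>
    push_cast
    rw [contDiff_succ_iff_deriv]
    refine ⟨fun t => (pp_hasDerivAt k t).differentiableAt, by simp, ?_⟩
    have : deriv (pp (k+1+1)) = fun t => (k+2 : ℝ) * pp (k+1) t := by
      ext t; exact (pp_hasDerivAt k t).deriv
    rw [this]
    exact contDiff_const.mul ih

end SL
end Part2

section Part3
open scoped ContDiff
open MeasureTheory Metric

namespace SL
variable {n : ℕ}

lemma abs_coord_le (y : Eu n) (i : Fin n) : |y i| ≤ ‖y‖ := by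
  simpa using PiLp.norm_apply_le (p := 2) y i

lemma nsq (y : Eu n) : ∑ i, y i ^ 2 = ‖y‖ ^ 2 := by
  rw [EuclideanSpace.norm_sq_eq]; simp

/-- quadratic form -/
def Qf (K : Fin n → Fin n → ℝ) (y : Eu n) : ℝ := ∑ i, ∑ j, K i j * y i * y j

lemma Qf_contDiff (K : Fin n → Fin n → ℝ) {m : WithTop ℕ∞} : ContDiff ℝ m (Qf K) := by
  unfold Qf
  exact ContDiff.sum fun i _ => ContDiff.sum fun j _ =>
    (contDiff_const.mul (contDiff_coord i)).mul (contDiff_coord j)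

lemma cd {f : Eu n → ℝ} {m : WithTop ℕ∞} (hf : ContDiff ℝ m f) (hm : m ≠ 0 := by simp) (x : Eu n) :
    DifferentiableAt ℝ f x := hf.differentiable hm x

lemma pd_Qf {K : Fin n → Fin n → ℝ} (hK : ∀ i j, K i j = K j i) (l : Fin n) (y : Eu n) :
    pd l (Qf K) y = 2 * ∑ j, K l j * y j := by
  have e : ∀ i j : Fin n, pd l (fun y : Eu n => K i j * y i * y j) y =
      K i j * ((if l = i then 1 else 0) * y j + y i * (if l = j then 1 else 0)) := by
    intro i j
    have : (fun y : Eu n => K i j * y i * y j) = fun y => K i j * (y i * y j) := by ext; ring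
    rw [this, pd_const_mul l _ (cd ((contDiff_coord i (m := 1)).mul (contDiff_coord j)) (by simp) y),
      pd_mul l (cd (contDiff_coord i (m := 1)) (by simp) y) (cd (contDiff_coord j (m := 1)) (by simp) y),
      pd_coord, pd_coord]
  unfold Qf
  rw [pd_sum l]
  · have : ∀ i, pd l (fun y : Eu n => ∑ j, K i j * y i * y j) y =
      ∑ j, K i j * ((if l = i then 1 else 0) * y j + y i * (if l = j then 1 else 0)) := by
      intro i
      rw [pd_sum l]
      · exact Finset.sum_congr rfl fun j _ => e i j
      · intro j _
        exact cd ((contDiff_const.mul (contDiff_coord i (m := 1))).mul (contDiff_coord j)) (by simp) y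
    simp_rw [this, mul_add, Finset.sum_add_distrib]
    simp only [ite_mul, one_mul, zero_mul, mul_ite, mul_one, mul_zero]
    rw [two_mul]
    congr 1
    · rw [Finset.sum_comm]; simp
    · simp [hK]
  · intro i _
    exact cd (ContDiff.sum fun j _ => (contDiff_const.mul (contDiff_coord i (m := 1))).mul
      (contDiff_coord j)) (by simp) y

/-- bump built from a quadratic form -/
noncomputable def bump (k : ℕ) (K : Fin n → Fin n → ℝ) (y : Eu n) : ℝ := pp k (1 - Qf K y)

lemma bump_contDiff (k : ℕ) (K : Fin n → Fin n → ℝ) : ContDiff ℝ k (bump (k+1) K) :=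
  (pp_contDiff k).comp (contDiff_const.sub (Qf_contDiff K))

lemma bump_cont (k : ℕ) (K : Fin n → Fin n → ℝ) : Continuous (bump k K) :=
  (pp_cont k).comp (continuous_const.sub (Qf_contDiff K (m := 0)).continuous)

lemma bump_nonneg (k : ℕ) (K : Fin n → Fin n → ℝ) (y) : 0 ≤ bump k K y := pp_nonneg _ _

lemma bump_le_one {k : ℕ} {K : Fin n → Fin n → ℝ} {y} (h : 0 ≤ Qf K y) : bump k K y ≤ 1 :=
  pp_le_one (by linarith)

lemma bump_zero {k : ℕ} {K : Fin n → Fin n → ℝ} {y} (h : 1 ≤ Qf K y) : bump (k+1) K y = 0 :=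
  pp_of_nonpos (by linarith)

lemma bump_hcs (k : ℕ) {K : Fin n → Fin n → ℝ} (h : ∀ y, ‖y‖^2 ≤ Qf K y) :
    HasCompactSupport (bump (k+1) K) := by
  apply HasCompactSupport.intro (isCompact_closedBall (0 : Eu n) 1)
  intro y hy
  apply bump_zero
  have : 1 < ‖y‖ := by simpa using hy
  nlinarith [h y]

lemma pd_bump {K : Fin n → Fin n → ℝ} (hK : ∀ i j, K i j = K j i) (k : ℕ) (l : Fin n) (y : Eu n) :
    pd l (bump (k+2) K) y = -(k+2) * 2 * (bump (k+1) K y * ∑ j, K l j * y j) := by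
  have hd : DifferentiableAt ℝ (fun y => 1 - Qf K y) y :=
    cd (contDiff_const.sub (Qf_contDiff K (m := 1))) (by simp) y
  have := pd_comp (g := pp (k+2)) (f := fun y => 1 - Qf K y) l (pp_hasDerivAt k _) hd
  have h2 : bump (k+2) K = fun y => pp (k+2) (1 - Qf K y) := rfl
  rw [h2, this, pd_sub l (differentiableAt_const _) (cd (Qf_contDiff K (m := 1)) (by simp) y), pd_const,
    pd_Qf hK]
  unfold bump; ring

lemma pd_lin (K : Fin n → Fin n → ℝ) (l m : Fin n) (y : Eu n) :
    pd m (fun y : Eu n => ∑ j, K l j * y j) y = K l m := by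
  rw [pd_sum m]
  · have : ∀ j, pd m (fun y : Eu n => K l j * y j) y = K l j * (if m = j then 1 else 0) := by
      intro j; rw [pd_const_mul m _ (cd (contDiff_coord j (m := 1)) (by simp) y), pd_coord]
    simp_rw [this]; simp
  · intro j _; exact cd (contDiff_const.mul (contDiff_coord j (m := 1))) (by simp) y

lemma pd_pd_bump {K : Fin n → Fin n → ℝ} (hK : ∀ i j, K i j = K j i) (k : ℕ) (m l : Fin n) (y : Eu n) :
    pd m (pd l (bump (k+3) K)) y = -(k+3) * 2 * (-(k+2) * 2 * (bump (k+1) K y * ∑ j, K m j * y j) *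
      (∑ j, K l j * y j) + bump (k+2) K y * K l m) := by
  have e : pd l (bump (k+3) K) = fun y => (-(k+3) * 2) * (bump (k+2) K y * ∑ j, K l j * y j) := by
    ext y; rw [pd_bump hK (k+1) l y]; push_cast; ring
  have h1 : DifferentiableAt ℝ (bump (k+2) K) y :=
    cd (bump_contDiff (k+1) K) (by simp) y
  have h2 : DifferentiableAt ℝ (fun y : Eu n => ∑ j, K l j * y j) y :=
    cd (ContDiff.sum fun j _ => contDiff_const.mul (contDiff_coord j (m := 1))) (by simp) y
  rw [e, pd_const_mul m _ (h1.fun_mul h2), pd_mul m h1 h2, pd_bump hK, pd_lin]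

lemma lin_bd {K : Fin n → Fin n → ℝ} {B : ℝ} (hB : ∀ i j, |K i j| ≤ B) (l : Fin n) {y : Eu n} (hy : ‖y‖ ≤ 1) :
    |∑ j, K l j * y j| ≤ n * B := by
  calc |∑ j, K l j * y j| ≤ ∑ j, |K l j * y j| := Finset.abs_sum_le_sum_abs _ _
    _ ≤ ∑ j : Fin n, B := by
        apply Finset.sum_le_sum; intro j _
        rw [abs_mul]
        have := abs_coord_le y j
        have h0 := abs_nonneg (K l j)
        calc |K l j| * |y j| ≤ |K l j| * 1 := by gcongr; linarith
          _ ≤ B := by linarith [hB l j]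
    _ = n * B := by simp

lemma bump_pd_bd {K : Fin n → Fin n → ℝ} {B : ℝ} (hK : ∀ i j, K i j = K j i) (hB : ∀ i j, |K i j| ≤ B)
    (hl : ∀ y, ‖y‖^2 ≤ Qf K y) (k : ℕ) (l : Fin n) (y : Eu n) :
    |pd l (bump (k+2) K) y| ≤ (k+2) * 2 * (n * B) := by
  have hB0 : 0 ≤ B := le_trans (abs_nonneg _) (hB l l)
  rw [pd_bump hK]
  by_cases hy : ‖y‖ ≤ 1
  · rw [abs_mul, abs_mul (bump (k+1) K y)]
    have h1 : |bump (k+1) K y| ≤ 1 := by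
      rw [abs_of_nonneg (bump_nonneg _ _ _)]; exact bump_le_one (le_trans (by positivity) (hl y))
    have h2 := lin_bd hB l hy
    have h3 : |-((k:ℝ)+2) * 2| = (k+2)*2 := by rw [neg_mul, abs_neg, abs_of_nonneg (by positivity)]
    rw [h3]
    calc ((k:ℝ)+2)*2 * (|bump (k+1) K y| * |∑ j, K l j * y j|) ≤ (k+2)*2*(1 * (n*B)) := by gcongr
      _ = _ := by ring
  · rw [bump_zero (by nlinarith [hl y])]; simp; positivity

lemma bump_pd2_bd {K : Fin n → Fin n → ℝ} {B : ℝ} (hK : ∀ i j, K i j = K j i) (hB : ∀ i j, |K i j| ≤ B)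
    (hl : ∀ y, ‖y‖^2 ≤ Qf K y) (k : ℕ) (m l : Fin n) (y : Eu n) :
    |pd m (pd l (bump (k+3) K)) y| ≤ (k+3) * 2 * ((k+2) * 2 * (n * B) * (n * B) + B) := by
  have hB0 : 0 ≤ B := le_trans (abs_nonneg _) (hB l l)
  rw [pd_pd_bump hK]
  by_cases hy : ‖y‖ ≤ 1
  · have h1 : ∀ k, |bump k K y| ≤ 1 := by
      intro k
      rw [abs_of_nonneg (bump_nonneg _ _ _)]; exact bump_le_one (le_trans (by positivity) (hl y))
    have h2 := lin_bd hB l hy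
    have h2' := lin_bd hB m hy
    have h3 : |-((k:ℝ)+3) * 2| = (k+3)*2 := by rw [neg_mul, abs_neg, abs_of_nonneg (by positivity)]
    have h4 : |-((k:ℝ)+2) * 2| = (k+2)*2 := by rw [neg_mul, abs_neg, abs_of_nonneg (by positivity)]
    rw [abs_mul, h3]
    gcongr
    refine (abs_add_le _ _).trans ?_
    rw [abs_mul, abs_mul (-((k:ℝ)+2) * 2), abs_mul (bump (k+1) K y), abs_mul (bump (k+2) K y), h4]
    calc _ ≤ ((k:ℝ)+2)*2 * (1 * (n*B)) * (n*B) + 1 * B := by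
          gcongr
          · exact h1 _
          · exact h1 _
          · exact hB _ _
      _ = _ := by ring
  · rw [bump_zero (by nlinarith [hl y]), bump_zero (by nlinarith [hl y])]; simp; positivity

end SL
end Part3

section Part4
open scoped ContDiff
open MeasureTheory Metric

namespace SL
variable {n : ℕ}

lemma swap_cpt {X Y : Type*} [TopologicalSpace X] [TopologicalSpace Y] [MeasurableSpace X] [MeasurableSpace Y]
    [OpensMeasurableSpace X] [OpensMeasurableSpace Y] [SecondCountableTopology X] [SecondCountableTopology Y]
    [T2Space X] [T2Space Y]
    {μ : Measure X} {ν : Measure Y} [SFinite μ] [SFinite ν] [IsFiniteMeasureOnCompacts μ]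
    [IsFiniteMeasureOnCompacts ν] {S : Set X} {T : Set Y} (hS : IsCompact S) (hT : IsCompact T)
    {f : X → Y → ℝ} (hf : Continuous (Function.uncurry f)) :
    ∫ x in S, ∫ y in T, f x y ∂ν ∂μ = ∫ y in T, ∫ x in S, f x y ∂μ ∂ν := by
  apply integral_integral_swap
  rw [Measure.prod_restrict]
  have : (μ.prod ν) (S ×ˢ T) < ⊤ := by
    rw [Measure.prod_prod]; exact ENNReal.mul_lt_top hS.measure_lt_top hT.measure_lt_top
  obtain ⟨C, hC⟩ := (hS.prod hT).exists_bound_of_continuousOn hf.continuousOn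
  refine IntegrableOn.of_bound this hf.aestronglyMeasurable C ?_
  exact ae_restrict_of_forall_mem (hS.measurableSet.prod hT.measurableSet) hC

lemma norm_fderiv_le {f : Eu n → ℝ} {x : Eu n} {D : ℝ} (hD : ∀ i, |pd i f x| ≤ D) (hD0 : 0 ≤ D) :
    ‖fderiv ℝ f x‖ ≤ n * D := by
  apply ContinuousLinearMap.opNorm_le_bound _ (by positivity)
  intro w
  rw [fderiv_eq_sum, Real.norm_eq_abs]
  calc |∑ i, w i * pd i f x| ≤ ∑ i, |w i * pd i f x| := Finset.abs_sum_le_sum_abs _ _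
    _ ≤ ∑ i : Fin n, ‖w‖ * D := by
      apply Finset.sum_le_sum; intro i _; rw [abs_mul]
      exact mul_le_mul (abs_coord_le w i) (hD i) (abs_nonneg _) (norm_nonneg _)
    _ = n * D * ‖w‖ := by simp; ring

lemma mvt {f : Eu n → ℝ} (hf : Differentiable ℝ f) {r D : ℝ} (hD0 : 0 ≤ D)
    (hD : ∀ x, ‖x‖ ≤ r → ∀ i, |pd i f x| ≤ D) {x y : Eu n} (hx : ‖x‖ ≤ r) (hy : ‖y‖ ≤ r) :
    |f x - f y| ≤ n * D * ‖x - y‖ := by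
  have := (convex_closedBall (0 : Eu n) r).norm_image_sub_le_of_norm_fderiv_le (𝕜 := ℝ) (f := f)
    (C := n * D) (fun z _ => hf z) (fun z hz => norm_fderiv_le (hD z (by simpa using hz)) hD0)
    (x := y) (y := x) (by simpa using hy) (by simpa using hx)
  simpa using this

lemma mvt' {f : Eu n → ℝ} (hf : Differentiable ℝ f) {D : ℝ} (hD0 : 0 ≤ D)
    (hD : ∀ x, ∀ i, |pd i f x| ≤ D) (x y : Eu n) : |f x - f y| ≤ n * D * ‖x - y‖ :=
  mvt hf (r := max ‖x‖ ‖y‖) hD0 (fun x _ => hD x) (le_max_left _ _) (le_max_right _ _)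

lemma pd_aff (k : Fin n) (b : ℝ) (A : Fin n → ℝ) (x : Eu n) :
    pd k (fun x : Eu n => b + ∑ i, A i * x i) x = A k := by
  rw [pd_add k (differentiableAt_const _) (cd (ContDiff.sum fun j _ => contDiff_const.mul
    (contDiff_coord j (m := 1))) (by simp) x), pd_const, pd_lin (fun _ => A) k, zero_add]

lemma aff_contDiff (b : ℝ) (A : Fin n → ℝ) {m : WithTop ℕ∞} :
    ContDiff ℝ m (fun x : Eu n => b + ∑ i, A i * x i) :=
  contDiff_const.add (ContDiff.sum fun j _ => contDiff_const.mul (contDiff_coord j))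

lemma taylor {w : Eu n → ℝ} (hw : ContDiff ℝ 2 w) {r D : ℝ} (hD0 : 0 ≤ D)
    (hD : ∀ x, ‖x‖ ≤ r → ∀ i j, |pd i (pd j w) x| ≤ D) {x : Eu n} (hx : ‖x‖ ≤ r) :
    |w x - (w 0 + ∑ i, pd i w 0 * x i)| ≤ n * (n * D) * ‖x‖ ^ 2 := by
  have hr : 0 ≤ r := (norm_nonneg x).trans hx
  have hd : ∀ j, Differentiable ℝ (pd j w) := fun j =>
    (pd_contDiff j (k := 1) (by exact_mod_cast hw)).differentiable (by simp)
  have hdw : Differentiable ℝ w := hw.differentiable (by simp)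
  have ha := aff_contDiff (n := n) (m := 1) (w 0) (fun i => pd i w 0)
  have h1 : ∀ y : Eu n, ‖y‖ ≤ ‖x‖ → ∀ j,
      |pd j (fun x => w x - (w 0 + ∑ i, pd i w 0 * x i)) y| ≤ n * D * ‖x‖ := by
    intro y hy j
    rw [pd_sub j (hdw y) (cd ha (by simp) y), pd_aff]
    have := mvt (hd j) hD0 (fun x hx i => hD x hx i j) (hy.trans hx) (y := 0) (by simpa using hr)
    rw [sub_zero] at this
    refine this.trans ?_
    gcongr
  have := mvt (hdw.sub (ha.differentiable (by simp))) (r := ‖x‖) (D := n * D * ‖x‖) (by positivity) h1 le_rfl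
    (y := 0) (by simp)
  simp only [Pi.sub_apply, PiLp.zero_apply, mul_zero, Finset.sum_const_zero, add_zero, sub_self, sub_zero] at this
  refine this.trans (le_of_eq ?_); ring

/-- convolution -/
noncomputable def conv (ρ z : Eu n → ℝ) (x : Eu n) : ℝ := ∫ y, z y * ρ (x - y)

lemma conv_comm (ρ z : Eu n → ℝ) (x : Eu n) : conv ρ z x = ∫ y, z (x - y) * ρ y := by
  unfold conv
  rw [← integral_sub_left_eq_self (fun y => z y * ρ (x - y)) volume x]
  simp

open scoped Convolution in
lemma conv_eq (ρ z : Eu n → ℝ) : conv ρ z = (z ⋆[ContinuousLinearMap.lsmul ℝ ℝ, volume] ρ) := by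
  ext x; unfold conv convolution; simp

lemma conv_contDiff {ρ z : Eu n → ℝ} {k : ℕ∞} (hρ : ContDiff ℝ k ρ) (hc : HasCompactSupport ρ)
    (hz : Continuous z) : ContDiff ℝ k (conv ρ z) := by
  rw [conv_eq]
  exact hc.contDiff_convolution_right _ hz.locallyIntegrable hρ

lemma pd_conv {ρ z : Eu n → ℝ} (i : Fin n) (hρ : ContDiff ℝ 1 ρ) (hc : HasCompactSupport ρ)
    (hz : Continuous z) (x : Eu n) : pd i (conv ρ z) x = conv (pd i ρ) z x := by
  have h := hc.hasFDerivAt_convolution_right (ContinuousLinearMap.lsmul ℝ ℝ) (μ := volume)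
    hz.locallyIntegrable hρ x
  rw [conv_eq, conv_eq]
  unfold pd
  rw [h.fderiv]
  rw [convolution_precompR_apply _ hz.locallyIntegrable (hc.fderiv ℝ) (hρ.continuous_fderiv (by simp))]

lemma pd_refl {ρ : Eu n → ℝ} (i : Fin n) (hρ : Differentiable ℝ ρ) (x y : Eu n) :
    pd i (fun y => ρ (x - y)) y = - pd i ρ (x - y) := by
  have := pd_affine hρ i x y (-1)
  simpa [← sub_eq_add_neg] using this

lemma hcs_refl {ρ : Eu n → ℝ} (hc : HasCompactSupport ρ) (x : Eu n) : HasCompactSupport (fun y => ρ (x - y)) :=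
  hc.comp_homeomorph (Homeomorph.subLeft x)

lemma conv_ibp {ρ z : Eu n → ℝ} (i : Fin n) (hρ : ContDiff ℝ 1 ρ) (hc : HasCompactSupport ρ)
    (hz : ContDiff ℝ 1 z) (x : Eu n) : conv (pd i ρ) z x = conv ρ (pd i z) x := by
  unfold conv
  have h := ibp (g := fun y => ρ (x - y)) i hz (hρ.comp (contDiff_const.sub contDiff_id)) (hcs_refl hc x)
  simp_rw [pd_refl i (hρ.differentiable (by simp))] at h
  simp only [mul_neg, integral_neg, neg_inj] at h
  exact h

/-- ball volume -/
noncomputable def bv (n : ℕ) (r : ℝ) : ℝ := (volume : Measure (Eu n)).real (closedBall 0 r)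

lemma bv_nonneg (r : ℝ) : 0 ≤ bv n r := measureReal_nonneg

lemma intOn {f : Eu n → ℝ} (hf : Continuous f) (x : Eu n) (r : ℝ) : IntegrableOn f (closedBall x r) :=
  hf.continuousOn.integrableOn_compact (isCompact_closedBall _ _)

lemma setInt_of_supp {f : Eu n → ℝ} {r : ℝ} (h : ∀ y, r < ‖y‖ → f y = 0) :
    ∫ y, f y = ∫ y in closedBall 0 r, f y := by
  rw [setIntegral_eq_integral_of_forall_compl_eq_zero]
  intro y hy; exact h y (by simpa using hy)

lemma ker_diff {z ρ : Eu n → ℝ} (hz : ContDiff ℝ 1 z) (hρ : Continuous ρ)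
    (hs : ∀ y, 1/4 < ‖y‖ → ρ y = 0) (x : Eu n) :
    conv ρ z x - (∫ y, ρ y) * z x =
      ∫ t in Set.Icc (0:ℝ) 1, ∫ y, (- ∑ i, y i * pd i z (x - t • y)) * ρ y := by
  have hzd : Differentiable ℝ z := hz.differentiable (by simp)
  have hcont : Continuous (Function.uncurry fun (t : ℝ) (y : Eu n) =>
      (- ∑ i, y i * pd i z (x - t • y)) * ρ y) := by
    have : ∀ i, Continuous (pd i z) := fun i => pd_cont i hz
    unfold Function.uncurry
    fun_prop
  have ftc : ∀ y : Eu n, ∫ t in Set.Icc (0:ℝ) 1, (- ∑ i, y i * pd i z (x - t • y)) * ρ y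
      = (z (x - y) - z x) * ρ y := by
    intro y
    rw [integral_mul_const, integral_Icc_eq_integral_Ioc, ← intervalIntegral.integral_of_le (by norm_num)]
    congr 1
    have hd : ∀ t : ℝ, HasDerivAt (fun t : ℝ => z (x - t • y)) (- ∑ i, y i * pd i z (x - t • y)) t := by
      intro t
      have h1 : HasDerivAt (fun t : ℝ => x - t • y) (-y) t := by
        simpa using ((hasDerivAt_id t).smul_const y).const_sub x
      have h2 := (hzd (x - t • y)).hasFDerivAt.comp_hasDerivAt t h1
      rw [map_neg, fderiv_eq_sum] at h2
      exact h2
    rw [intervalIntegral.integral_eq_sub_of_hasDerivAt (fun t _ => hd t)]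
    · simp
    · apply Continuous.intervalIntegrable
      have : ∀ i, Continuous (pd i z) := fun i => pd_cont i hz
      fun_prop
  have e1 : ∀ t : ℝ, ∫ y, (- ∑ i, y i * pd i z (x - t • y)) * ρ y =
      ∫ y in closedBall 0 (1/4), (- ∑ i, y i * pd i z (x - t • y)) * ρ y := by
    intro t; apply setInt_of_supp; intro y hy; rw [hs y hy, mul_zero]
  simp_rw [e1]
  rw [swap_cpt isCompact_Icc (isCompact_closedBall _ _) hcont]
  simp_rw [ftc]
  rw [conv_comm, setInt_of_supp (r := 1/4) (fun y hy => by rw [hs y hy, mul_zero]),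
    setInt_of_supp (f := ρ) hs, ← integral_mul_const, ← integral_sub]
  · congr 1; ext y; ring
  · exact intOn ((hz.continuous.comp (by fun_prop)).mul hρ) _ _
  · exact intOn (hρ.mul continuous_const) _ _

lemma setInt_shift_le {p : Eu n → ℝ} (hp : Continuous p) (hp0 : ∀ x, 0 ≤ p x) {r s : ℝ} (y : Eu n)
    (h : r + ‖y‖ ≤ s) : ∫ x in closedBall 0 r, p (x - y) ≤ ∫ x in closedBall 0 s, p x := by
  have : ∫ x in closedBall 0 r, p (x - y) = ∫ x in closedBall (-y) r, p x := by
    rw [← integral_indicator isClosed_closedBall.measurableSet,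
      ← integral_indicator isClosed_closedBall.measurableSet,
      ← integral_sub_right_eq_self (Set.indicator (closedBall (-y) r) p) y]
    congr 1; ext x
    by_cases hx : ‖x‖ ≤ r
    · rw [Set.indicator_of_mem (by simpa using hx), Set.indicator_of_mem (by simpa [dist_eq_norm] using hx)]
    · rw [Set.indicator_of_notMem (by simpa using hx), Set.indicator_of_notMem (by simpa [dist_eq_norm] using hx)]
  rw [this]
  apply setIntegral_mono_set (intOn hp _ _)
  · exact Filter.Eventually.of_forall fun x => hp0 x
  · apply LE.le.eventuallyLE
    apply closedBall_subset_closedBall'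
    simpa using h

lemma ker_L1 {z ρ p : Eu n → ℝ} (hz : ContDiff ℝ 1 z) (hρ : Continuous ρ)
    (hs : ∀ y, 1/4 < ‖y‖ → ρ y = 0) (hp : Continuous p) (hp0 : ∀ x, 0 ≤ p x) {D : ℝ} (hD : 0 ≤ D)
    (hb : ∀ x : Eu n, ∀ t ∈ Set.Icc (0:ℝ) 1, |∫ y, (- ∑ i, y i * pd i z (x - t • y)) * ρ y| ≤
      D * ∫ y in closedBall 0 (1/4), p (x - t • y)) (hcc : Continuous (conv ρ z)) :
    ∫ x in closedBall 0 (1/4), |conv ρ z x - (∫ y, ρ y) * z x| ≤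
      D * (bv n (1/4) * ∫ x in closedBall 0 (1/2), p x) := by
  have c3 : Continuous (Function.uncurry fun (q : Eu n × ℝ) (y : Eu n) => p (q.1 - q.2 • y)) := by
    unfold Function.uncurry; fun_prop
  have c2 : Continuous (Function.uncurry fun (x : Eu n) (t : ℝ) => ∫ y in closedBall (0 : Eu n) (1/4), p (x - t • y)) := by
    exact continuous_parametric_integral_of_continuous c3 (isCompact_closedBall _ _)
  have c1 : Continuous (fun (x : Eu n) => ∫ t in Set.Icc (0:ℝ) 1, ∫ y in closedBall (0 : Eu n) (1/4), p (x - t • y)) :=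
    continuous_parametric_integral_of_continuous c2 isCompact_Icc
  have s1 : ∀ x, |conv ρ z x - (∫ y, ρ y) * z x| ≤
      D * ∫ t in Set.Icc (0:ℝ) 1, ∫ y in closedBall (0 : Eu n) (1/4), p (x - t • y) := by
    intro x
    rw [ker_diff hz hρ hs, ← integral_const_mul]
    rw [← Real.norm_eq_abs]
    refine norm_integral_le_of_norm_le (g := fun t : ℝ => D * ∫ y in closedBall (0 : Eu n) (1/4), p (x - t • y)) ?_ ?_
    · have : Continuous (fun t : ℝ => D * ∫ y in closedBall (0 : Eu n) (1/4), p (x - t • y)) :=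
        continuous_const.mul (c2.comp (by fun_prop : Continuous fun t : ℝ => (x, t)))
      exact this.continuousOn.integrableOn_compact isCompact_Icc
    · exact ae_restrict_of_forall_mem measurableSet_Icc fun t ht => hb x t ht
  calc ∫ x in closedBall 0 (1/4), |conv ρ z x - (∫ y, ρ y) * z x|
      ≤ ∫ x in closedBall 0 (1/4), D * ∫ t in Set.Icc (0:ℝ) 1, ∫ y in closedBall (0 : Eu n) (1/4), p (x - t • y) := by
        apply setIntegral_mono
        · exact intOn ((hcc.sub (continuous_const.mul hz.continuous)).abs) _ _
        · exact intOn (continuous_const.mul c1) _ _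
        · exact s1
    _ = D * ∫ t in Set.Icc (0:ℝ) 1, ∫ x in closedBall (0 : Eu n) (1/4), ∫ y in closedBall (0 : Eu n) (1/4), p (x - t • y) := by
        rw [integral_const_mul, swap_cpt (isCompact_closedBall _ _) isCompact_Icc c2]
    _ ≤ D * ∫ t in Set.Icc (0:ℝ) 1, bv n (1/4) * ∫ x in closedBall 0 (1/2), p x := by
        refine mul_le_mul_of_nonneg_left ?_ hD
        refine setIntegral_mono_on ?_ ?_ measurableSet_Icc ?_
        · refine (continuous_parametric_integral_of_continuous ?_ (isCompact_closedBall _ _)).continuousOn.integrableOn_compact isCompact_Icc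
          exact c2.comp continuous_swap
        · exact continuous_const.continuousOn.integrableOn_compact isCompact_Icc
        · intro t ht
          have ct : Continuous (Function.uncurry fun (x y : Eu n) => p (x - t • y)) := by
            unfold Function.uncurry; fun_prop
          rw [swap_cpt (isCompact_closedBall _ _) (isCompact_closedBall _ _) ct]
          have : bv n (1/4) * ∫ x in closedBall 0 (1/2), p x =
              ∫ y in closedBall (0 : Eu n) (1/4), ∫ x in closedBall 0 (1/2), p x := by
            rw [setIntegral_const]; rfl
          rw [this]
          refine setIntegral_mono_on ?_ ?_ isClosed_closedBall.measurableSet ?_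
          · refine (continuous_parametric_integral_of_continuous ?_ (isCompact_closedBall _ _)).continuousOn.integrableOn_compact (isCompact_closedBall _ _)
            exact ct.comp continuous_swap
          · exact intOn continuous_const _ _
          · intro y hy
            apply setInt_shift_le hp hp0
            have hy : ‖y‖ ≤ 1/4 := by simpa using hy
            rw [norm_smul, Real.norm_eq_abs, abs_of_nonneg ht.1]
            nlinarith [ht.2, norm_nonneg y, ht.1]
    _ = _ := by simp

end SL
end Part4

section Part5
open scoped ContDiff
open MeasureTheory Metric

namespace SL
variable {n : ℕ}

/-- affine function -/
noncomputable def aff (b : ℝ) (A : Fin n → ℝ) (x : Eu n) : ℝ := b + ∑ i, A i * x i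

lemma aff_cd (b : ℝ) (A : Fin n → ℝ) {m : WithTop ℕ∞} : ContDiff ℝ m (aff b A) := aff_contDiff b A

lemma pd_aff' (k : Fin n) (b : ℝ) (A : Fin n → ℝ) (x : Eu n) : pd k (aff b A) x = A k := pd_aff k b A x

structure KerD (n : ℕ) (M σ : ℝ) (a0 K : Fin n → Fin n → ℝ) : Prop where
  symm : ∀ i j, K i j = K j i
  inv : ∀ i j, ∑ l, a0 i l * K l j = if i = j then σ else 0
  lo : ∀ y : Eu n, 16 * ‖y‖ ^ 2 ≤ Qf K y
  bd : ∀ i j, |K i j| ≤ M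
  bd0 : ∀ i j, |a0 i j| ≤ M

structure Adm (n : ℕ) (Λ M m C σ : ℝ) (v : Fin n → Eu n → ℝ) (a : Fin n → Fin n → Eu n → ℝ) : Prop where
  hv : ∀ k, ContDiff ℝ ∞ (v k)
  ha : ∀ i j, ContDiff ℝ ∞ (a i j)
  symm : ∀ i j x, a i j x = a j i x
  div : ∀ j x, ∑ i, pd i (a i j) x = 0
  eqn : ∀ k x, ∑ i, ∑ j, a i j x * pd i (pd j (v k)) x = 0
  ell : ∀ x (ξ : Fin n → ℝ), m * ∑ i, ξ i ^ 2 ≤ ∑ i, ∑ j, a i j x * (ξ i * ξ j)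
  bdd : ∀ i j x, |a i j x| ≤ M
  lip : ∀ k j x, |pd j (v k) x| ≤ Λ
  ker : ∀ A : Fin n → Fin n → ℝ, (∀ k l, |A k l| ≤ Λ) → ∃ a0 K, KerD n M σ a0 K ∧
    ∀ i j x, |a i j x - a0 i j| ≤ C * ∑ k, ∑ l, |pd l (v k) x - A k l|

lemma one_le_inf : (1 : WithTop ℕ∞) ≤ ∞ := by exact_mod_cast (le_top : (1 : ℕ∞) ≤ ⊤)
lemma two_le_inf : (2 : WithTop ℕ∞) ≤ ∞ := by exact WithTop.coe_le_coe.2 (le_top : (2 : ℕ∞) ≤ ⊤)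

/-- identity -/
def Kid (n : ℕ) : Fin n → Fin n → ℝ := fun i j => if i = j then 1 else 0

lemma Qf_Kid (y : Eu n) : Qf (Kid n) y = ‖y‖ ^ 2 := by
  rw [← nsq]; unfold Qf Kid; simp [sq]

lemma sum2_abs_le {f : Fin n → Fin n → ℝ} {B : ℝ} (h : ∀ i j, |f i j| ≤ B) : |∑ i, ∑ j, f i j| ≤ n * (n * B) := by
  calc |∑ i, ∑ j, f i j| ≤ ∑ i, |∑ j, f i j| := Finset.abs_sum_le_sum_abs _ _
    _ ≤ ∑ i, ∑ j, |f i j| := Finset.sum_le_sum fun i _ => Finset.abs_sum_le_sum_abs _ _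
    _ ≤ ∑ i : Fin n, ∑ j : Fin n, B := Finset.sum_le_sum fun i _ => Finset.sum_le_sum fun j _ => h i j
    _ = _ := by simp

lemma cacc {Λ M m C σ : ℝ} {v : Fin n → Eu n → ℝ} {a : Fin n → Fin n → Eu n → ℝ} (h : Adm n Λ M m C σ v a)
    (hm : 0 ≤ m) {z : Eu n → ℝ} (hz : ContDiff ℝ ∞ z)
    (he : ∀ x, ∑ i, ∑ j, a i j x * pd i (pd j z) x = 0) :
    m * ∫ x in closedBall 0 (1/2), ∑ i, pd i z x ^ 2 ≤
      (2 * (n * (n * (M * (8 * (6 * n * n + 1)))))) * ∫ x in closedBall 0 1, z x ^ 2 := by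
  have hKs : ∀ i j, Kid n i j = Kid n j i := by intro i j; unfold Kid; simp [eq_comm]
  have hKb : ∀ i j, |Kid n i j| ≤ 1 := by intro i j; unfold Kid; split_ifs <;> simp
  have hKl : ∀ y, ‖y‖^2 ≤ Qf (Kid n) y := fun y => (Qf_Kid y).ge
  have hζ2 : ContDiff ℝ 2 (bump 4 (Kid n)) := (bump_contDiff 3 (Kid n)).of_le (by norm_num)
  have hζc : HasCompactSupport (bump 4 (Kid n)) := bump_hcs 3 hKl
  have hz1 : ∀ i, ContDiff ℝ ∞ (pd i z) := fun i => pd_smooth i hz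
  have dz : ∀ x, DifferentiableAt ℝ z x := fun x => cd hz (by simp) x
  have dz1 : ∀ i x, DifferentiableAt ℝ (pd i z) x := fun i x => cd (hz1 i) (by simp) x
  have e1 : ∀ j, pd j (fun x => z x * z x) = fun x => 2 * (z x * pd j z x) := by
    intro j; ext x; rw [pd_mul j (dz x) (dz x)]; ring
  have e2 : ∀ i j x, pd i (pd j (fun x => z x * z x)) x = 2 * (pd i z x * pd j z x + z x * pd i (pd j z) x) := by
    intro i j x; rw [e1, pd_const_mul i _ ((dz x).fun_mul (dz1 j x)), pd_mul i (dz x) (dz1 j x)]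
  have e3 : ∀ x, ∑ i, ∑ j, a i j x * pd i (pd j (fun x => z x * z x)) x =
      2 * ∑ i, ∑ j, a i j x * (pd i z x * pd j z x) := by
    intro x
    have : ∀ i j, a i j x * pd i (pd j (fun x => z x * z x)) x =
      2 * (a i j x * (pd i z x * pd j z x)) + 2 * z x * (a i j x * pd i (pd j z) x) := by
      intro i j; rw [e2]; ring
    simp_rw [this, Finset.sum_add_distrib, ← Finset.mul_sum, he]; ring
  have g := green (f := fun x => z x * z x) (ζ := bump 4 (Kid n))
    (fun i j => (h.ha i j).of_le one_le_inf) h.symm h.div ((hz.mul hz).of_le two_le_inf) hζ2 hζc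
  simp_rw [e3] at g
  have cq : Continuous (fun x => ∑ i, ∑ j, a i j x * (pd i z x * pd j z x)) := by
    have := fun i j => (h.ha i j).continuous
    have := fun i => (hz1 i).continuous
    fun_prop
  have cD : Continuous (fun x => ∑ i, pd i z x ^ 2) := by
    have := fun i => (hz1 i).continuous
    fun_prop
  have q0 : ∀ x, m * ∑ i, pd i z x ^ 2 ≤ ∑ i, ∑ j, a i j x * (pd i z x * pd j z x) := fun x => h.ell x _
  have hsupp : ∀ y : Eu n, 1 < ‖y‖ → ∀ i j, pd i (pd j (bump 4 (Kid n))) y = 0 := by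
    intro y hy i j
    have : 1 ≤ Qf (Kid n) y := by rw [Qf_Kid]; nlinarith
    rw [pd_pd_bump hKs 1, bump_zero this, bump_zero this]; ring
  have R : ∫ x, z x * z x * ∑ i, ∑ j, a i j x * pd i (pd j (bump 4 (Kid n))) x ≤
      (n * (n * (M * (8 * (6 * n * n + 1))))) * ∫ x in closedBall 0 1, z x ^ 2 := by
    rw [setInt_of_supp (r := 1), ← integral_const_mul]
    · apply setIntegral_mono
      · refine intOn ((hz.continuous.mul hz.continuous).mul ?_) _ _
        have := fun i j => (h.ha i j).continuous
        have := fun i j => pd_cont i (pd_contDiff j (k := 1) (by exact_mod_cast hζ2))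
        fun_prop
      · exact intOn (continuous_const.mul (hz.continuous.pow 2)) _ _
      · intro x
        have b : |∑ i, ∑ j, a i j x * pd i (pd j (bump 4 (Kid n))) x| ≤ (n * (n * (M * (8 * (6 * n * n + 1))))) := by
          apply sum2_abs_le; intro i j
          rw [abs_mul]
          have h1 := h.bdd i j x
          have h2 := bump_pd2_bd hKs hKb hKl 1 i j x
          have h3 : |pd i (pd j (bump 4 (Kid n))) x| ≤ 8 * (6 * n * n + 1) := by
            refine h2.trans (le_of_eq ?_); push_cast; ring
          exact mul_le_mul h1 h3 (abs_nonneg _) ((abs_nonneg _).trans h1)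
        have := (abs_le.1 b).2
        simp only
        nlinarith [sq_nonneg (z x)]
    · intro y hy
      simp [hsupp y hy]
  have Lb : (1/4) * (2 * (m * ∫ x in closedBall 0 (1/2), ∑ i, pd i z x ^ 2)) ≤
      ∫ x, bump 4 (Kid n) x * (2 * ∑ i, ∑ j, a i j x * (pd i z x * pd j z x)) := by
    · have nn : ∀ x, 0 ≤ ∑ i, ∑ j, a i j x * (pd i z x * pd j z x) := fun x => le_trans (by positivity) (q0 x)
      calc _ = ∫ x in closedBall 0 (1/2), (1/4) * (2 * (m * ∑ i, pd i z x ^ 2)) := by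
            simp_rw [integral_const_mul]
        _ ≤ ∫ x in closedBall 0 (1/2), bump 4 (Kid n) x * (2 * ∑ i, ∑ j, a i j x * (pd i z x * pd j z x)) := by
            refine setIntegral_mono_on (intOn (by fun_prop) _ _)
              (intOn ((bump_cont _ _).mul (continuous_const.mul cq)) _ _) isClosed_closedBall.measurableSet ?_
            intro x hx
            have hx : ‖x‖ ≤ 1/2 := by simpa using hx
            have hb : 1/4 ≤ bump 4 (Kid n) x := by
              unfold bump
              rw [Qf_Kid]
              calc (1/4 : ℝ) ≤ (3/4)^4 := by norm_num
                _ = pp 4 (3/4) := (pp_of_nonneg (by norm_num)).symm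
                _ ≤ _ := pp_mono _ (by nlinarith [norm_nonneg x])
            have := q0 x
            have := nn x
            apply mul_le_mul hb (by linarith) (by positivity) (bump_nonneg _ _ _)
        _ ≤ _ := by
            apply setIntegral_le_integral
            · exact ((bump_cont _ _).mul (continuous_const.mul cq)).integrable_of_hasCompactSupport (hcs_mul_right hζc)
            · exact Filter.Eventually.of_forall fun x => mul_nonneg (bump_nonneg _ _ _) (by linarith [nn x])
  linarith

end SL
end Part5

section Part6
open scoped ContDiff
open MeasureTheory Metric

namespace SL
variable {n : ℕ}

lemma closing {z W : Eu n → ℝ} (hz : Continuous z) (hW : ContDiff ℝ 2 W) {c X S D θ : ℝ} (hc : 0 < c)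
    (hS0 : 0 ≤ S) (hD0 : 0 ≤ D) (hθ : θ ≤ 1/4)
    (hX : ∫ x in closedBall 0 (1/4), |W x - c * z x| ≤ X)
    (hS : ∀ x, ‖x‖ ≤ 1/4 → |W x - c * z x| ≤ S)
    (hD : ∀ x, ‖x‖ ≤ 1/4 → ∀ i j, |pd i (pd j W) x| ≤ D) :
    ∫ x in closedBall 0 θ, (z x - aff (W 0 / c) (fun i => pd i W 0 / c) x) ^ 2 ≤
      (1 / c^2) * (2 * (S * X) + 2 * ((n * (n * D) * θ ^ 2) ^ 2 * bv n θ)) := by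
  have cE : Continuous (fun x => |W x - c * z x|) := (hW.continuous.sub (continuous_const.mul hz)).abs
  have pt : ∀ x ∈ closedBall (0 : Eu n) θ, (z x - aff (W 0 / c) (fun i => pd i W 0 / c) x) ^ 2 ≤
      (1/c^2) * (2 * (S * |W x - c * z x|) + 2 * (n * (n * D) * θ ^ 2) ^ 2) := by
    intro x hx
    have hx : ‖x‖ ≤ θ := by simpa using hx
    have t := taylor hW hD0 hD (hx.trans hθ)
    set T := W 0 + ∑ i, pd i W 0 * x i with hT
    have hTe : aff (W 0 / c) (fun i => pd i W 0 / c) x = T / c := by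
      unfold aff; rw [hT, add_div, Finset.sum_div]; congr 1
      apply Finset.sum_congr rfl; intro i _; ring
    rw [hTe]
    have e : (z x - T / c)^2 = (1/c^2) * ((W x - T) - (W x - c * z x))^2 := by field_simp; ring
    rw [e]
    refine mul_le_mul_of_nonneg_left ?_ (by positivity)
    have h1 := hS x (hx.trans hθ)
    have h2 : (W x - c * z x)^2 ≤ S * |W x - c * z x| := by
      rw [← sq_abs]; nlinarith [abs_nonneg (W x - c * z x)]
    have h3 : (W x - T)^2 ≤ (n * (n * D) * θ ^ 2) ^ 2 := by
      rw [← sq_abs]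
      have h5 : |W x - T| ≤ n * (n * D) * θ ^ 2 := t.trans (by gcongr)
      gcongr
    nlinarith [sq_nonneg ((W x - T) + (W x - c * z x))]
  calc _ ≤ ∫ x in closedBall (0 : Eu n) θ, (1/c^2) * (2 * (S * |W x - c * z x|) + 2 * (n * (n * D) * θ ^ 2) ^ 2) := by
        refine setIntegral_mono_on (intOn ?_ _ _) (intOn ?_ _ _) isClosed_closedBall.measurableSet pt
        · exact (hz.sub (aff_cd (m := 0) _ _).continuous).pow 2
        · fun_prop
    _ = (1/c^2) * (2 * (S * ∫ x in closedBall (0 : Eu n) θ, |W x - c * z x|) + 2 * ((n * (n * D) * θ ^ 2) ^ 2 * bv n θ)) := by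
        rw [integral_const_mul, integral_add (intOn (by fun_prop) _ _) (intOn (by fun_prop) _ _), integral_const_mul,
          integral_const_mul, setIntegral_const]
        simp only [bv, smul_eq_mul]; ring
    _ ≤ _ := by
        have : ∫ x in closedBall (0 : Eu n) θ, |W x - c * z x| ≤ X := by
          refine le_trans ?_ hX
          apply setIntegral_mono_set (intOn cE _ _)
          · exact Filter.Eventually.of_forall fun x => abs_nonneg _
          · exact LE.le.eventuallyLE (closedBall_subset_closedBall hθ)
        gcongr

lemma conv_abs_le {f z : Eu n → ℝ} (hf : Continuous f) (hz : Continuous z) {B : ℝ}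
    (hs : ∀ y, 1/4 < ‖y‖ → f y = 0) (hB : ∀ y, |f y| ≤ B) {x : Eu n} (hx : ‖x‖ ≤ 1/4) :
    |conv f z x| ≤ B * ∫ y in closedBall 0 (1/2), |z y| := by
  unfold conv
  rw [setInt_of_supp (r := 1/2), ← integral_const_mul, ← Real.norm_eq_abs]
  · refine norm_integral_le_of_norm_le (g := fun y => B * |z y|) (intOn (by fun_prop) _ _) ?_
    refine Filter.Eventually.of_forall fun y => ?_
    rw [Real.norm_eq_abs, abs_mul, mul_comm]
    exact mul_le_mul_of_nonneg_right (hB _) (abs_nonneg _)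
  · intro y hy
    rw [hs, mul_zero]
    have := norm_sub_norm_le y x
    rw [norm_sub_rev] at this
    linarith

lemma conv_sub_le {ρ z : Eu n → ℝ} (hρ : Continuous ρ) (hz : Continuous z) (h0 : ∀ y, 0 ≤ ρ y)
    (hs : ∀ y, 1/4 < ‖y‖ → ρ y = 0) {x : Eu n} {q S : ℝ} (hS : ∀ y, ‖y‖ ≤ 1/4 → |z (x - y) - q| ≤ S) :
    |conv ρ z x - (∫ y, ρ y) * q| ≤ (∫ y, ρ y) * S := by
  rw [conv_comm, setInt_of_supp (r := 1/4) (fun y hy => by rw [hs y hy, mul_zero]),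
    setInt_of_supp (f := ρ) hs, ← integral_mul_const, ← integral_mul_const, ← integral_sub, ← Real.norm_eq_abs]
  · refine norm_integral_le_of_norm_le (intOn (by fun_prop) _ _) ?_
    refine ae_restrict_of_forall_mem isClosed_closedBall.measurableSet fun y hy => ?_
    have : z (x - y) * ρ y - ρ y * q = ρ y * (z (x - y) - q) := by ring
    rw [this, Real.norm_eq_abs, abs_mul, abs_of_nonneg (h0 y)]
    exact mul_le_mul_of_nonneg_left (hS y (by simpa using hy)) (h0 y)
  · exact intOn (by fun_prop) _ _
  · exact intOn (by fun_prop) _ _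

section
variable {M σ : ℝ} {a0 K : Fin n → Fin n → ℝ}

lemma KerD.lo1 (h : KerD n M σ a0 K) (y : Eu n) : ‖y‖^2 ≤ Qf K y := by
  have := h.lo y; nlinarith [sq_nonneg ‖y‖]

lemma KerD.supp (h : KerD n M σ a0 K) (k : ℕ) (y : Eu n) (hy : 1/4 < ‖y‖) : bump (k+1) K y = 0 := by
  apply bump_zero
  have := h.lo y; nlinarith

lemma KerD.mass_le (h : KerD n M σ a0 K) : ∫ y, bump 3 K y ≤ bv n (1/4) := by
  rw [setInt_of_supp (fun y hy => h.supp 2 y hy)]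
  calc _ ≤ ∫ y in closedBall (0 : Eu n) (1/4), (1:ℝ) := by
        refine setIntegral_mono (intOn (bump_cont _ _) _ _) (intOn continuous_const _ _) ?_
        intro y; exact bump_le_one (le_trans (by positivity) (h.lo1 y))
    _ = _ := by rw [setIntegral_const]; simp [bv]

lemma bv_pos {r : ℝ} (hr : 0 < r) : 0 < bv n r := by
  unfold bv Measure.real
  apply ENNReal.toReal_pos
  · exact (measure_closedBall_pos _ _ hr).ne'
  · exact (isCompact_closedBall _ _).measure_lt_top.ne

lemma mass_ge (n : ℕ) (M σ : ℝ) (hM : 0 ≤ M) : ∃ c0 > 0, ∀ a0 K, KerD n M σ a0 K → c0 ≤ ∫ y, bump 3 K y := by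
  obtain ⟨r, hr, hr1⟩ : ∃ r : ℝ, 0 < r ∧ n * (n * (M * r)) ≤ 1/2 ∧ r ≤ 1 := by
    refine ⟨1 / (2 * (n * (n * M)) + 1), by positivity, ?_, ?_⟩
    · rw [mul_one_div, ← mul_div_assoc, ← mul_div_assoc, div_le_iff₀ (by positivity)]; linarith
    · rw [div_le_one (by positivity)]; have : 0 ≤ 2 * (n * (n * M)) := by positivity
      linarith
  refine ⟨1/8 * bv n r, by have := bv_pos (n := n) hr; positivity, ?_⟩
  intro a0 K h
  calc 1/8 * bv n r = ∫ y in closedBall (0 : Eu n) r, (1/8 : ℝ) := by rw [setIntegral_const]; simp [bv]; ring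
    _ ≤ ∫ y in closedBall (0 : Eu n) r, bump 3 K y := by
      refine setIntegral_mono_on (intOn continuous_const _ _) (intOn (bump_cont _ _) _ _) isClosed_closedBall.measurableSet ?_
      intro y hy
      have hy : ‖y‖ ≤ r := by simpa using hy
      have hQ : Qf K y ≤ 1/2 := by
        refine (le_abs_self _).trans ((sum2_abs_le (B := M * r) ?_).trans hr1.1)
        intro i j
        rw [abs_mul, abs_mul]
        have h1 := h.bd i j
        have h2 := (abs_coord_le y i).trans hy
        have h3 := ((abs_coord_le y j).trans hy).trans hr1.2
        calc |K i j| * |y i| * |y j| ≤ M * r * 1 := by gcongr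
          _ = _ := by ring
      unfold bump
      calc (1/8 : ℝ) = pp 3 (1/2) := by rw [pp_of_nonneg (by norm_num)]; norm_num
        _ ≤ _ := pp_mono _ (by linarith)
    _ ≤ _ := by
      apply setIntegral_le_integral
      · exact (bump_cont _ _).integrable_of_hasCompactSupport (bump_hcs 2 h.lo1)
      · exact Filter.Eventually.of_forall fun x => bump_nonneg _ _ _

/-- the auxiliary potential -/
noncomputable def pot (σ : ℝ) (K : Fin n → Fin n → ℝ) (y : Eu n) : ℝ := (1/(8*σ)) * bump 4 K y

lemma KerD.pd_pot (h : KerD n M σ a0 K) (hσ : 0 < σ) (j : Fin n) (y : Eu n) :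
    pd j (pot σ K) y = -(1/σ) * (bump 3 K y * ∑ l, K j l * y l) := by
  have e : pot σ K = fun y => (1/(8*σ)) * bump 4 K y := rfl
  rw [e, pd_const_mul j _ (cd (bump_contDiff 3 K) (by simp) y), pd_bump h.symm 2]
  push_cast; field_simp; ring

lemma KerD.ident (h : KerD n M σ a0 K) (hσ : 0 < σ) (i : Fin n) (y : Eu n) :
    - (y i * bump 3 K y) = ∑ j, a0 i j * pd j (pot σ K) y := by
  simp_rw [h.pd_pot hσ]
  have : ∀ j, a0 i j * (-(1/σ) * (bump 3 K y * ∑ l, K j l * y l)) =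
      -(1/σ) * bump 3 K y * ∑ l, a0 i j * K j l * y l := by
    intro j; rw [Finset.mul_sum, Finset.mul_sum, Finset.mul_sum, Finset.mul_sum]
    apply Finset.sum_congr rfl; intro l _; ring
  simp_rw [this, ← Finset.mul_sum]
  rw [Finset.sum_comm]
  simp_rw [← Finset.sum_mul, h.inv]
  simp; field_simp

lemma KerD.pot_cd (h : KerD n M σ a0 K) : ContDiff ℝ 2 (pot σ K) :=
  contDiff_const.mul ((bump_contDiff 3 K).of_le (by norm_num))

lemma KerD.pot_hcs (h : KerD n M σ a0 K) : HasCompactSupport (pot σ K) :=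
  hcs_mul_left (bump_hcs 3 h.lo1)

lemma KerD.pd_pot_supp (h : KerD n M σ a0 K) (hσ : 0 < σ) (j : Fin n) (y : Eu n) (hy : 1/4 < ‖y‖) :
    pd j (pot σ K) y = 0 := by rw [h.pd_pot hσ, h.supp 2 y hy]; simp

lemma KerD.pd_pot_bd (h : KerD n M σ a0 K) (hσ : 0 < σ) (j : Fin n) (y : Eu n) :
    |pd j (pot σ K) y| ≤ n * M / σ := by
  have e : pot σ K = fun y => (1/(8*σ)) * bump 4 K y := rfl
  rw [e, pd_const_mul j _ (cd (bump_contDiff 3 K) (by simp) y), abs_mul, abs_of_pos (by positivity)]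
  have := bump_pd_bd h.symm h.bd h.lo1 2 j y
  calc _ ≤ 1/(8*σ) * (((2:ℕ):ℝ)+2) * 2 * (n*M) := by rw [mul_assoc, mul_assoc]; gcongr; linarith
    _ = _ := by push_cast; field_simp; ring

lemma KerD.pot_bd (h : KerD n M σ a0 K) (hσ : 0 < σ) (y : Eu n) : |pot σ K y| ≤ 1 / (8*σ) := by
  unfold pot
  rw [abs_of_nonneg (mul_nonneg (by positivity) (bump_nonneg _ _ _))]
  have := bump_le_one (k := 4) (K := K) (y := y) (le_trans (by positivity) (h.lo1 y))
  have h2 : 0 < 1/(8*σ) := by positivity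
  nlinarith

/-- integrand rewriting -/
lemma KerD.inner_eq (h : KerD n M σ a0 K) (hσ : 0 < σ) (ξ : Fin n → ℝ) (y : Eu n) :
    (- ∑ i, y i * ξ i) * bump 3 K y = ∑ j, ∑ i, a0 i j * ξ i * pd j (pot σ K) y := by
  rw [Finset.sum_comm]
  have : ∀ i, ∑ j, a0 i j * ξ i * pd j (pot σ K) y = ξ i * (-(y i * bump 3 K y)) := by
    intro i; rw [h.ident hσ, Finset.mul_sum]; apply Finset.sum_congr rfl; intro j _; ring
  simp_rw [this]
  rw [neg_mul, Finset.sum_mul, ← Finset.sum_neg_distrib]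
  apply Finset.sum_congr rfl; intro i _; ring

end

end SL
end Part6

section Part7
open scoped ContDiff
open MeasureTheory Metric

namespace SL
variable {n : ℕ}
variable {Λ M m C σ : ℝ} {v : Fin n → Eu n → ℝ} {a : Fin n → Fin n → Eu n → ℝ}
variable {a0 K : Fin n → Fin n → ℝ}

lemma shp_cd (x : Eu n) (t : ℝ) {k : WithTop ℕ∞} : ContDiff ℝ k (fun y : Eu n => x + t • y) := by fun_prop
lemma shm_cd (x : Eu n) (t : ℝ) {k : WithTop ℕ∞} : ContDiff ℝ k (fun y : Eu n => x - t • y) := by fun_prop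

lemma sum2_sq_le (q : Fin n → Fin n → ℝ) : (∑ k, ∑ l, |q k l|) ^ 2 ≤ n * n * ∑ k, ∑ l, q k l ^ 2 := by
  calc (∑ k, ∑ l, |q k l|) ^ 2 ≤ n * ∑ k, (∑ l, |q k l|) ^ 2 := by
        simpa using sq_sum_le_card_mul_sum_sq (s := Finset.univ) (f := fun k => ∑ l, |q k l|)
    _ ≤ n * ∑ k, (n * ∑ l, q k l ^ 2) := by
        gcongr with k
        simpa using sq_sum_le_card_mul_sum_sq (s := Finset.univ) (f := fun l => |q k l|)
    _ = _ := by rw [← Finset.mul_sum]; ring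

lemma le_sum2 (q : Fin n → Fin n → ℝ) (hq : ∀ i j, 0 ≤ q i j) (k l : Fin n) : q k l ≤ ∑ k, ∑ l, q k l :=
  (Finset.single_le_sum (f := fun l => q k l) (fun j _ => hq k j) (Finset.mem_univ l)).trans
    (Finset.single_le_sum (f := fun k => ∑ l, q k l) (fun i _ => Finset.sum_nonneg fun j _ => hq i j) (Finset.mem_univ k))

/-- flux identity -/
lemma flux_zero (h : Adm n Λ M m C σ v a) {z η : Eu n → ℝ} (hz : ContDiff ℝ ∞ z)
    (he : ∀ x, ∑ i, ∑ j, a i j x * pd i (pd j z) x = 0) (hη : ContDiff ℝ 1 η) (hc : HasCompactSupport η)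
    (x : Eu n) (t : ℝ) :
    ∫ y, ∑ j, (∑ i, a i j (x - t • y) * pd i z (x - t • y)) * pd j η y = 0 := by
  have hP : ∀ j, ContDiff ℝ ∞ (fun w => ∑ i, a i j w * pd i z w) := fun j =>
    ContDiff.sum fun i _ => (h.ha i j).mul (pd_smooth i hz)
  have ex : ∀ y : Eu n, x - t • y = x + (-t) • y := by intro y; rw [neg_smul, sub_eq_add_neg]
  simp_rw [ex]
  refine ibp_div (P := fun j y => ∑ i, a i j (x + (-t) • y) * pd i z (x + (-t) • y)) ?_ ?_ hη hc
  · intro j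
    exact ((hP j).of_le one_le_inf).comp (shp_cd x (-t))
  · intro y
    have e : ∀ j, pd j (fun y => ∑ i, a i j (x + (-t) • y) * pd i z (x + (-t) • y)) y =
        (-t) * ∑ i, (pd j (a j i) (x + (-t) • y) * pd i z (x + (-t) • y) +
          a j i (x + (-t) • y) * pd j (pd i z) (x + (-t) • y)) := by
      intro j
      rw [pd_affine (f := fun w => ∑ i, a i j w * pd i z w) ((hP j).differentiable (by simp)),
        pd_sum j (fun i _ => cd ((h.ha i j).mul (pd_smooth i hz)) (by simp) _)]
      congr 1
      refine Finset.sum_congr rfl fun i _ => ?_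
      rw [pd_mul j (cd (h.ha i j) (by simp) _) (cd (pd_smooth i hz) (by simp) _)]
      have : a i j = a j i := funext fun x => h.symm i j x
      rw [this]
    simp_rw [e, ← Finset.mul_sum, Finset.sum_add_distrib]
    rw [he, add_zero, Finset.sum_comm]
    simp_rw [← Finset.sum_mul, h.div]
    simp

lemma inner_flux (h : Adm n Λ M m C σ v a) (hk : KerD n M σ a0 K) (hσ : 0 < σ) (hC : 0 ≤ C)
    {b : Fin n → ℝ} {A : Fin n → Fin n → ℝ} {z : Fin n → Eu n → ℝ} (hz : ∀ k, z k = fun x => v k x - aff (b k) (A k) x)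
    (hd : ∀ i j x, |a i j x - a0 i j| ≤ C * ∑ k, ∑ l, |pd l (v k) x - A k l|) (k : Fin n) (x : Eu n) (t : ℝ) :
    |∫ y, (- ∑ i, y i * pd i (z k) (x - t • y)) * bump 3 K y| ≤
      (n * (n * (C * (n * M / σ) * (n * n)))) * ∫ y in closedBall 0 (1/4), ∑ k, ∑ l, pd l (z k) (x - t • y) ^ 2 := by
  have hzs : ∀ k, ContDiff ℝ ∞ (z k) := fun k => by rw [hz]; exact (h.hv k).sub (aff_cd _ _)
  have hzp : ∀ k l x, pd l (z k) x = pd l (v k) x - A k l := by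
    intro k l x; rw [hz, pd_sub l (cd (h.hv k) (by simp) x) (cd (aff_cd (m := ∞) _ _) (by simp) x), pd_aff']
  have hzpp : ∀ k i l x, pd i (pd l (z k)) x = pd i (pd l (v k)) x := by
    intro k i l x
    have : pd l (z k) = fun x => pd l (v k) x - A k l := funext fun x => hzp k l x
    rw [this, pd_sub i (cd (pd_smooth l (h.hv k)) (by simp) x) (by fun_prop), pd_const, sub_zero]
  have he : ∀ x, ∑ i, ∑ j, a i j x * pd i (pd j (z k)) x = 0 := by
    intro x; simp_rw [hzpp]; exact h.eqn k x
  have hf := flux_zero h (hzs k) he (hk.pot_cd.of_le (by norm_num)) hk.pot_hcs x t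
  have cη : ∀ j, Continuous (pd j (pot σ K)) := fun j => pd_cont j (hk.pot_cd.of_le (by norm_num))
  have cz : ∀ k i, Continuous (pd i (z k)) := fun k i => (pd_smooth i (hzs k)).continuous
  have ca : ∀ i j, Continuous (a i j) := fun i j => (h.ha i j).continuous
  simp_rw [hk.inner_eq hσ]
  rw [setInt_of_supp (r := 1/4) (fun y hy => by simp [hk.pd_pot_supp hσ _ y hy])] at hf ⊢
  rw [← sub_zero (∫ y in _, _), ← hf, ← integral_sub, ← integral_const_mul, ← Real.norm_eq_abs]
  rotate_left
  · exact intOn (by fun_prop) _ _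
  · exact intOn (by fun_prop) _ _
  refine norm_integral_le_of_norm_le (intOn (by fun_prop) _ _) (Filter.Eventually.of_forall fun y => ?_)
  set w := x - t • y
  simp_rw [Finset.sum_mul]
  rw [← Finset.sum_sub_distrib]
  simp_rw [← Finset.sum_sub_distrib]
  rw [Real.norm_eq_abs]
  have hS := sum2_sq_le (fun k l => pd l (z k) w)
  set S := ∑ k, ∑ l, |pd l (z k) w|
  have hS0 : 0 ≤ S := Finset.sum_nonneg fun _ _ => Finset.sum_nonneg fun _ _ => abs_nonneg _
  calc _ ≤ (n:ℝ) * (n * (C * (n * M / σ) * (n * n * ∑ k, ∑ l, pd l (z k) w ^ 2))) := by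
        apply sum2_abs_le
        intro j i
        have e : a0 i j * pd i (z k) w * pd j (pot σ K) y - a i j w * pd i (z k) w * pd j (pot σ K) y =
          -((a i j w - a0 i j) * pd i (z k) w * pd j (pot σ K) y) := by ring
        rw [e, abs_neg, abs_mul, abs_mul]
        have h1 := hd i j w
        simp_rw [← hzp] at h1
        have h2 : |pd i (z k) w| ≤ S := le_sum2 (fun k l => |pd l (z k) w|) (fun _ _ => abs_nonneg _) k i
        have h3 := hk.pd_pot_bd hσ j y
        calc _ ≤ (C * S) * S * (n * M / σ) := by gcongr
          _ = C * (n * M / σ) * S ^ 2 := by ring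
          _ ≤ _ := mul_le_mul_of_nonneg_left hS (mul_nonneg hC ((abs_nonneg _).trans h3))
    _ = _ := by ring

lemma inner_hess (h : Adm n Λ M m C σ v a) (hk : KerD n M σ a0 K) (hσ : 0 < σ) (hM : 0 ≤ M) (k : Fin n) (x : Eu n) 
    (t : ℝ) (ht : t ∈ Set.Icc (0:ℝ) 1) :
    |∫ y, (- ∑ i, y i * pd i (v k) (x - t • y)) * bump 3 K y| ≤
      (n * (n * (M * (1 / (8*σ))))) * ∫ y in closedBall 0 (1/4), ∑ k, ∑ i, ∑ j, |pd i (pd j (v k)) (x - t • y)| := by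
  have cη : ∀ j, Continuous (pd j (pot σ K)) := fun j => pd_cont j (hk.pot_cd.of_le (by norm_num))
  have cp : Continuous (pot σ K) := hk.pot_cd.continuous
  have cz : ∀ k i, Continuous (pd i (v k)) := fun k i => (pd_smooth i (h.hv k)).continuous
  have czz : ∀ k i j, Continuous (pd i (pd j (v k))) := fun k i j => (pd_smooth i (pd_smooth j (h.hv k))).continuous
  have ex : ∀ y : Eu n, x - t • y = x + (-t) • y := by intro y; rw [neg_smul, sub_eq_add_neg]
  have hcs : ∀ j, HasCompactSupport (pd j (pot σ K)) := fun j => pd_hcs j hk.pot_hcs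
  simp_rw [hk.inner_eq hσ]
  have key : ∫ y, ∑ j, ∑ i, a0 i j * pd i (v k) (x - t • y) * pd j (pot σ K) y =
      ∫ y, ∑ j, ∑ i, a0 i j * (t * pd j (pd i (v k)) (x - t • y)) * pot σ K y := by
    rw [integral_finsetSum, integral_finsetSum]
    · refine Finset.sum_congr rfl fun j _ => ?_
      rw [integral_finsetSum, integral_finsetSum]
      · refine Finset.sum_congr rfl fun i _ => ?_
        rw [ibp (f := fun y => a0 i j * pd i (v k) (x - t • y)) j ?_ (hk.pot_cd.of_le (by norm_num)) hk.pot_hcs, ← integral_neg]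
        · congr 1; ext y
          rw [pd_const_mul j _ ?_]
          · simp_rw [ex]
            rw [pd_affine ((pd_smooth i (h.hv k)).differentiable (by simp))]; ring
          · exact cd (m := ∞) ((pd_smooth i (h.hv k)).comp (shm_cd x t)) (by simp) y
        · exact ((contDiff_const.mul ((pd_smooth i (h.hv k)).comp (shm_cd x t))).of_le one_le_inf)
      · intro i _
        exact Continuous.integrable_of_hasCompactSupport (f := fun y => a0 i j * (t * pd j (pd i (v k)) (x - t • y)) * pot σ K y) (by fun_prop) (hcs_mul_left hk.pot_hcs)
      · intro i _
        exact Continuous.integrable_of_hasCompactSupport (f := fun y => a0 i j * pd i (v k) (x - t • y) * pd j (pot σ K) y) (by fun_prop) (hcs_mul_left (hcs j))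
    · intro j _
      exact Continuous.integrable_of_hasCompactSupport (f := fun y => ∑ i, a0 i j * (t * pd j (pd i (v k)) (x - t • y)) * pot σ K y) (by fun_prop) (hcs_sum fun i _ => hcs_mul_left hk.pot_hcs)
    · intro j _
      exact Continuous.integrable_of_hasCompactSupport (f := fun y => ∑ i, a0 i j * pd i (v k) (x - t • y) * pd j (pot σ K) y) (by fun_prop) (hcs_sum fun i _ => hcs_mul_left (hcs j))
  rw [key, setInt_of_supp (r := 1/4) (fun y hy => by simp [pot, hk.supp 3 y hy]), ← integral_const_mul, ← Real.norm_eq_abs]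
  refine norm_integral_le_of_norm_le (intOn (by fun_prop) _ _) (Filter.Eventually.of_forall fun y => ?_)
  set w := x - t • y
  rw [Real.norm_eq_abs]
  calc _ ≤ (n:ℝ) * (n * (M * (1 / (8*σ)) * ∑ k, ∑ i, ∑ j, |pd i (pd j (v k)) w|)) := by
        apply sum2_abs_le
        intro j i
        rw [abs_mul, abs_mul, abs_mul, abs_of_nonneg ht.1]
        have h1 := hk.bd0 i j
        have h3 := hk.pot_bd hσ y
        have h2 : |pd j (pd i (v k)) w| ≤ ∑ k, ∑ i, ∑ j, |pd i (pd j (v k)) w| :=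
          (le_sum2 (fun j i => |pd j (pd i (v k)) w|) (fun _ _ => abs_nonneg _) j i).trans
          (Finset.single_le_sum (f := fun k => ∑ i, ∑ j, |pd i (pd j (v k)) w|)
            (fun k _ => Finset.sum_nonneg fun _ _ => Finset.sum_nonneg fun _ _ => abs_nonneg _) (Finset.mem_univ k))
        have h4 : t * |pd j (pd i (v k)) w| ≤ ∑ k, ∑ i, ∑ j, |pd i (pd j (v k)) w| :=
          (mul_le_of_le_one_left (abs_nonneg _) ht.2).trans h2
        have h5 : 0 ≤ t * |pd j (pd i (v k)) w| := mul_nonneg ht.1 (abs_nonneg _)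
        calc _ ≤ M * (∑ k, ∑ i, ∑ j, |pd i (pd j (v k)) w|) * (1 / (8*σ)) := by gcongr
          _ = _ := by ring
    _ = _ := by ring

end SL
end Part7

section Part8
open scoped ContDiff
open MeasureTheory Metric

namespace SL
variable {n : ℕ}
variable {Λ M m C σ : ℝ} {v : Fin n → Eu n → ℝ} {a : Fin n → Fin n → Eu n → ℝ}
variable {a0 K : Fin n → Fin n → ℝ}

lemma bv_scale {r : ℝ} (hr : 0 ≤ r) : bv n r = r ^ n * bv n 1 := by
  unfold bv
  have := Measure.addHaar_real_closedBall' (volume : Measure (Eu n)) 0 hr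
  rw [this]; simp

lemma bv_mono {r s : ℝ} (h : r ≤ s) : bv n r ≤ bv n s := by
  unfold bv
  exact measureReal_mono (closedBall_subset_closedBall h) (isCompact_closedBall _ _).measure_lt_top.ne

lemma setInt_mono_r {f : Eu n → ℝ} (hf : Continuous f) (h0 : ∀ x, 0 ≤ f x) {r s : ℝ} (h : r ≤ s) :
    ∫ x in closedBall 0 r, f x ≤ ∫ x in closedBall 0 s, f x :=
  setIntegral_mono_set (intOn hf _ _) (Filter.Eventually.of_forall fun x => h0 x)
    (closedBall_subset_closedBall h).eventuallyLE

lemma cs_ball {z : Eu n → ℝ} (hz : Continuous z) {r : ℝ} (hr : 0 < r) :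
    (∫ x in closedBall 0 r, |z x|) ^ 2 ≤ bv n r * ∫ x in closedBall 0 r, z x ^ 2 := by
  have hV := bv_pos (n := n) hr
  set V := bv n r with hVd
  set I := ∫ x in closedBall 0 r, |z x| with hI
  have h0 : 0 ≤ ∫ x in closedBall 0 r, (V * |z x| - I) ^ 2 := integral_nonneg fun x => sq_nonneg _
  have e : ∀ x, (V * |z x| - I) ^ 2 = V ^ 2 * z x ^ 2 - 2 * V * I * |z x| + I ^ 2 := by
    intro x; rw [← sq_abs (z x)]; ring
  simp_rw [e] at h0
  rw [integral_add, integral_sub, integral_const_mul, integral_const_mul, ← hI, setIntegral_const] at h0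
  · change 0 ≤ V ^ 2 * _ - 2 * V * I * I + V * I ^ 2 at h0
    have : 0 ≤ V * (V * (∫ x in closedBall 0 r, z x ^ 2) - I ^ 2) := by linarith
    have := nonneg_of_mul_nonneg_right this hV
    linarith
  · exact intOn (by fun_prop) _ _
  · exact intOn (by fun_prop) _ _
  · exact intOn (by fun_prop) _ _
  · exact intOn (by fun_prop) _ _

lemma step_aff (h : Adm n Λ M m C σ v a) (hk : KerD n M σ a0 K) {c : ℝ} (hc : 0 < c) (hcc : c = ∫ y, bump 3 K y)
    {b : ℝ} {A : Fin n → ℝ} (k : Fin n) {z : Eu n → ℝ} (hz : z = fun x => v k x - aff b A x)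
    {X S D θ : ℝ}
    (hS0 : 0 ≤ S) (hD0 : 0 ≤ D) (hθ : θ ≤ 1/4)
    (hX : ∫ x in closedBall 0 (1/4), |conv (bump 3 K) z x - c * z x| ≤ X)
    (hS : ∀ x, ‖x‖ ≤ 1/4 → |conv (bump 3 K) z x - c * z x| ≤ S)
    (hD : ∀ x, ‖x‖ ≤ 1/4 → ∀ i j, |pd i (pd j (conv (bump 3 K) z)) x| ≤ D) :
    ∃ (b' : ℝ) (A' : Fin n → ℝ), (∀ i, |A' i| ≤ Λ) ∧ ∫ x in closedBall 0 θ, (v k x - aff b' A' x) ^ 2 ≤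
      (1 / c^2) * (2 * (S * X) + 2 * ((n * (n * D) * θ ^ 2) ^ 2 * bv n θ)) := by
  have hzs : ContDiff ℝ ∞ z := by rw [hz]; exact (h.hv k).sub (aff_cd _ _)
  have hρ : ContDiff ℝ 2 (bump 3 K) := bump_contDiff 2 K
  have hρc : HasCompactSupport (bump 3 K) := bump_hcs 2 hk.lo1
  have hW : ContDiff ℝ 2 (conv (bump 3 K) z) := conv_contDiff (k := 2) (by exact_mod_cast hρ) hρc hzs.continuous
  have hcl := closing hzs.continuous hW hc hS0 hD0 hθ hX hS hD
  set W := conv (bump 3 K) z with hWd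
  refine ⟨b + W 0 / c, fun i => A i + pd i W 0 / c, ?_, ?_⟩
  · intro i
    have h1 : pd i W 0 = conv (bump 3 K) (pd i z) 0 := by
      rw [hWd, pd_conv i (hρ.of_le (by norm_num)) hρc hzs.continuous,
        conv_ibp i (hρ.of_le (by norm_num)) hρc (hzs.of_le one_le_inf)]
    have hzp : ∀ x, pd i z x = pd i (v k) x - A i := by
      intro x; rw [hz, pd_sub i (cd (h.hv k) (by simp) x) (cd (aff_cd (m := ∞) _ _) (by simp) x), pd_aff']
    have h2 := conv_sub_le (ρ := bump 3 K) (z := pd i z) (x := 0) (q := - A i) (S := Λ) hρ.continuous (pd_smooth i hzs).continuous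
      (bump_nonneg 3 K) (hk.supp 2) (fun y _ => by rw [hzp]; simpa using h.lip k i (0 - y))
    rw [← h1, ← hcc] at h2
    have e : A i + pd i W 0 / c = (pd i W 0 - c * - A i) / c := by field_simp; ring
    dsimp only
    rw [e, abs_div, abs_of_pos hc, div_le_iff₀ hc]; linarith
  · refine le_trans (le_of_eq ?_) hcl
    congr 1; ext x
    rw [hz]; unfold aff
    simp_rw [add_mul, Finset.sum_add_distrib]; ring

lemma decay_lemma (n : ℕ) (Λ M m C σ : ℝ) (hm : 0 < m) (hσ : 0 < σ) (hC : 0 ≤ C) (hM : 0 ≤ M) :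
    ∃ C3 ≥ 0, ∀ (v : Fin n → Eu n → ℝ) (a : Fin n → Fin n → Eu n → ℝ), Adm n Λ M m C σ v a →
      ∀ (b : Fin n → ℝ) (A : Fin n → Fin n → ℝ), (∀ k l, |A k l| ≤ Λ) → ∀ θ μ : ℝ, 0 < θ → θ ≤ 1/4 → 0 ≤ μ →
      (∀ k x, ‖x‖ ≤ 1/2 → |v k x - aff (b k) (A k) x| ≤ μ) →
      ∃ (b' : Fin n → ℝ) (A' : Fin n → Fin n → ℝ), (∀ k l, |A' k l| ≤ Λ) ∧
        ∑ k, ∫ x in closedBall 0 θ, (v k x - aff (b' k) (A' k) x) ^ 2 ≤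
          C3 * (μ + θ ^ (n+4)) * ∑ k, ∫ x in closedBall 0 1, (v k x - aff (b k) (A k) x) ^ 2 := by
  obtain ⟨c0, hc0, hc0'⟩ := mass_ge n M σ hM
  set c1 := bv n (1/4)
  have hc1 : 0 < c1 := bv_pos (by norm_num)
  set D1 : ℝ := (n * (n * (C * (n * M / σ) * (n * n))))
  set Cc : ℝ := (2 * (n * (n * (M * (8 * (6 * n * n + 1))))))
  set D2 : ℝ := 3 * 2 * (2 * 2 * (n * M) * (n * M) + M)
  have hD1 : 0 ≤ D1 := by positivity
  have hCc : 0 ≤ Cc := by positivity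
  have hD2 : 0 ≤ D2 := by positivity
  have hb1 : 0 < bv n 1 := bv_pos one_pos
  refine ⟨n * ((1/c0^2) * (4 * c1 * D1 * c1 * (Cc/m) + 2 * (n^4 * D2^2 * bv n 1 * bv n 1))), by positivity, ?_⟩
  intro v a h b A hA θ μ hθ0 hθ hμ hsup
  obtain ⟨a0, K, hk, hd⟩ := h.ker A hA
  set z : Fin n → Eu n → ℝ := fun k x => v k x - aff (b k) (A k) x with hz
  have hzs : ∀ k, ContDiff ℝ ∞ (z k) := fun k => (h.hv k).sub (aff_cd _ _)
  set J := ∑ k, ∫ x in closedBall 0 1, (v k x - aff (b k) (A k) x) ^ 2 with hJ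
  have hJk : ∀ k, ∫ x in closedBall 0 1, z k x ^ 2 ≤ J := fun k =>
    Finset.single_le_sum (f := fun k => ∫ x in closedBall 0 1, z k x ^ 2) (fun k _ => integral_nonneg fun x => sq_nonneg _) (Finset.mem_univ k)
  have hJ0 : 0 ≤ J := Finset.sum_nonneg fun k _ => integral_nonneg fun x => sq_nonneg _
  set c := ∫ y, bump 3 K y with hc
  have hcc : c0 ≤ c := hc0' _ _ hk
  have hcp : 0 < c := hc0.trans_le hcc
  have hcl : c ≤ c1 := hk.mass_le
  have hρ : ContDiff ℝ 2 (bump 3 K) := bump_contDiff 2 K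
  have hρc : HasCompactSupport (bump 3 K) := bump_hcs 2 hk.lo1
  have hzpp : ∀ k i l x, pd i (pd l (z k)) x = pd i (pd l (v k)) x := by
    intro k i l x
    have : pd l (z k) = fun x => pd l (v k) x - A k l := funext fun x => by
      rw [hz]; dsimp only; rw [pd_sub l (cd (h.hv k) (by simp) x) (cd (aff_cd (m := ∞) _ _) (by simp) x), pd_aff']
    rw [this, pd_sub i (cd (pd_smooth l (h.hv k)) (by simp) x) (by fun_prop), pd_const, sub_zero]
  have cz : ∀ k i, Continuous (pd i (z k)) := fun k i => (pd_smooth i (hzs k)).continuous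
  -- energy bound
  have hp : ∫ x in closedBall 0 (1/2), ∑ k, ∑ l, pd l (z k) x ^ 2 ≤ (Cc/m) * J := by
    rw [integral_finsetSum _ (fun k _ => intOn (by fun_prop) _ _), hJ, Finset.mul_sum]
    refine Finset.sum_le_sum fun k _ => ?_
    have := cacc h hm.le (hzs k) (fun x => by simp_rw [hzpp]; exact h.eqn k x)
    rw [div_mul_eq_mul_div, le_div_iff₀ hm]; linarith
  have main : ∀ k, ∃ (b' : ℝ) (A' : Fin n → ℝ), (∀ i, |A' i| ≤ Λ) ∧ ∫ x in closedBall 0 θ, (v k x - aff b' A' x) ^ 2 ≤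
      ((1/c0^2) * (4 * c1 * D1 * c1 * (Cc/m) + 2 * (n^4 * D2^2 * bv n 1 * bv n 1))) * (μ + θ ^ (n+4)) * J := by
    intro k
    have hL := ker_L1 (z := z k) (ρ := bump 3 K) (p := fun w => ∑ k, ∑ l, pd l (z k) w ^ 2) ((hzs k).of_le one_le_inf)
      hρ.continuous (hk.supp 2) (by fun_prop) (fun x => Finset.sum_nonneg fun _ _ => Finset.sum_nonneg fun _ _ => sq_nonneg _)
      hD1 (fun x t _ => inner_flux h hk hσ hC (fun k => rfl) hd k x t)
      (conv_contDiff (k := 2) (by exact_mod_cast hρ) hρc (hzs k).continuous).continuous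
    set I := ∫ x in closedBall 0 (1/2), |z k x| with hI
    have hI0 : 0 ≤ I := integral_nonneg fun x => abs_nonneg _
    have hI2 : I ^ 2 ≤ bv n 1 * J := by
      calc I ^ 2 ≤ bv n (1/2) * ∫ x in closedBall 0 (1/2), z k x ^ 2 := cs_ball (hzs k).continuous (by norm_num)
        _ ≤ bv n 1 * ∫ x in closedBall 0 1, z k x ^ 2 := by
          have c2 : Continuous (fun x => z k x ^ 2) := (hzs k).continuous.pow 2
          have := setInt_mono_r c2 (fun x => sq_nonneg _) (r := 1/2) (s := 1) (by norm_num)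
          have := bv_mono (n := n) (r := 1/2) (s := 1) (by norm_num)
          gcongr
        _ ≤ _ := by gcongr; exact hJk k
    have hSS : ∀ x, ‖x‖ ≤ 1/4 → |conv (bump 3 K) (z k) x - c * z k x| ≤ c * (2 * μ) := by
      intro x hx
      apply conv_sub_le hρ.continuous (hzs k).continuous (bump_nonneg 3 K) (hk.supp 2)
      intro y hy
      have h1 : |z k (x - y)| ≤ μ := hsup k (x - y) ((norm_sub_le _ _).trans (by linarith))
      have h2 : |z k x| ≤ μ := hsup k x (by linarith)
      calc _ ≤ |z k (x - y)| + |z k x| := abs_sub _ _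
        _ ≤ _ := by linarith
    have hDD : ∀ x, ‖x‖ ≤ 1/4 → ∀ i j, |pd i (pd j (conv (bump 3 K) (z k))) x| ≤ D2 * I := by
      intro x hx i j
      have e : pd j (conv (bump 3 K) (z k)) = conv (pd j (bump 3 K)) (z k) := funext fun x =>
        pd_conv j (hρ.of_le (by norm_num)) hρc (hzs k).continuous x
      have h1 : ContDiff ℝ 1 (pd j (bump 3 K)) := pd_contDiff (k := 1) j (by exact_mod_cast hρ)
      rw [e, pd_conv i h1 (pd_hcs j hρc) (hzs k).continuous]
      refine conv_abs_le (pd_cont i h1) (hzs k).continuous ?_ ?_ hx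
      · intro y hy
        rw [pd_pd_bump hk.symm 0]
        have e1 : bump 1 K y = 0 := hk.supp 0 y hy
        have e2 : bump 2 K y = 0 := hk.supp 1 y hy
        simp [e1, e2]
      · intro y
        have := bump_pd2_bd hk.symm hk.bd hk.lo1 0 i j y
        simpa [D2] using this
    obtain ⟨b', A', hA', hr⟩ := step_aff h hk hcp hc k (z := z k) rfl (X := D1 * (c1 * ((Cc/m) * J))) (S := c * (2 * μ)) (D := D2 * I)
      (by positivity) (by positivity) hθ (hL.trans (by gcongr)) hSS hDD
    refine ⟨b', A', hA', hr.trans ?_⟩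
    rw [bv_scale hθ0.le]
    have e1 : 1/c^2 ≤ 1/c0^2 := by gcongr
    calc _ = (1/c^2) * (4 * c * D1 * c1 * (Cc/m) * μ * J + 2 * (n^4 * D2^2 * I^2 * bv n 1) * θ^(n+4)) := by ring
      _ ≤ (1/c0^2) * (4 * c1 * D1 * c1 * (Cc/m) * μ * J + 2 * (n^4 * D2^2 * (bv n 1 * J) * bv n 1) * θ^(n+4)) := by gcongr
      _ ≤ (1/c0^2) * (4 * c1 * D1 * c1 * (Cc/m) * μ * J + 2 * (n^4 * D2^2 * (bv n 1 * J) * bv n 1) * θ^(n+4)) +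
          (1/c0^2) * (4 * c1 * D1 * c1 * (Cc/m) * θ^(n+4) * J + 2 * (n^4 * D2^2 * (bv n 1 * J) * bv n 1) * μ) := by
          apply le_add_of_nonneg_right; positivity
      _ = _ := by ring
  choose b' A' hA' hr using main
  refine ⟨b', A', hA', ?_⟩
  calc _ ≤ ∑ k : Fin n, _ := Finset.sum_le_sum fun k _ => hr k
    _ = _ := by simp; ring

end SL
end Part8

section Part9
open scoped ContDiff
open MeasureTheory Metric

namespace SL
variable {n : ℕ}
variable {Λ M m C σ : ℝ} {v : Fin n → Eu n → ℝ} {a : Fin n → Fin n → Eu n → ℝ}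
variable {a0 K : Fin n → Fin n → ℝ}

/-- total second derivative -/
noncomputable def D2s (v : Fin n → Eu n → ℝ) (x : Eu n) : ℝ := ∑ k, ∑ i, ∑ j, |pd i (pd j (v k)) x|

lemma D2s_nonneg (x : Eu n) : 0 ≤ D2s v x := Finset.sum_nonneg fun _ _ => Finset.sum_nonneg fun _ _ =>
  Finset.sum_nonneg fun _ _ => abs_nonneg _

lemma le_D2s (k i j : Fin n) (x : Eu n) : |pd i (pd j (v k)) x| ≤ D2s v x :=
  (le_sum2 (fun j i => |pd j (pd i (v k)) x|) (fun _ _ => abs_nonneg _) i j).trans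
    (Finset.single_le_sum (f := fun k => ∑ i, ∑ j, |pd i (pd j (v k)) x|)
      (fun k _ => Finset.sum_nonneg fun _ _ => Finset.sum_nonneg fun _ _ => abs_nonneg _) (Finset.mem_univ k))

lemma D2s_cont (hv : ∀ k, ContDiff ℝ ∞ (v k)) : Continuous (D2s v) := by
  have czz : ∀ k i j, Continuous (pd i (pd j (v k))) := fun k i j => (pd_smooth i (pd_smooth j (hv k))).continuous
  unfold D2s; fun_prop

lemma initial_lemma (n : ℕ) (Λ M m C σ : ℝ) (hσ : 0 < σ) (hM : 0 ≤ M) (hΛ : 0 ≤ Λ) :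
    ∃ C5 ≥ 0, ∀ (v : Fin n → Eu n → ℝ) (a : Fin n → Fin n → Eu n → ℝ), Adm n Λ M m C σ v a →
      ∃ (b' : Fin n → ℝ) (A' : Fin n → Fin n → ℝ), (∀ k l, |A' k l| ≤ Λ) ∧
        ∑ k, ∫ x in closedBall 0 (1/4), (v k x - aff (b' k) (A' k) x) ^ 2 ≤
          C5 * ((∫ x in closedBall 0 (1/2), D2s v x) + (∫ x in closedBall 0 (1/2), D2s v x) ^ 2) := by
  obtain ⟨c0, hc0, hc0'⟩ := mass_ge n M σ hM
  set c1 := bv n (1/4)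
  have hc1 : 0 < c1 := bv_pos (by norm_num)
  set D1 : ℝ := (n * (n * (M * (1 / (8*σ)))))
  have hD1 : 0 ≤ D1 := by positivity
  refine ⟨n * ((1/c0^2) * (2 * (c1 * (n * Λ * (1/4)) * (D1 * c1)) + 2 * ((n * n * (1/4)^2)^2 * c1))), by positivity, ?_⟩
  intro v a h
  set Θ := ∫ x in closedBall 0 (1/2), D2s v x with hΘ
  have hΘ0 : 0 ≤ Θ := integral_nonneg fun x => D2s_nonneg x
  obtain ⟨a0, K, hk, hd⟩ := h.ker (fun _ _ => 0) (by simpa using fun _ _ => hΛ)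
  set c := ∫ y, bump 3 K y with hc
  have hcc : c0 ≤ c := hc0' _ _ hk
  have hcp : 0 < c := hc0.trans_le hcc
  have hcl : c ≤ c1 := hk.mass_le
  have hρ : ContDiff ℝ 2 (bump 3 K) := bump_contDiff 2 K
  have hρ1 : ContDiff ℝ 1 (bump 3 K) := hρ.of_le (by norm_num)
  have hρc : HasCompactSupport (bump 3 K) := bump_hcs 2 hk.lo1
  have main : ∀ k, ∃ (b' : ℝ) (A' : Fin n → ℝ), (∀ i, |A' i| ≤ Λ) ∧ ∫ x in closedBall 0 (1/4), (v k x - aff b' A' x) ^ 2 ≤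
      ((1/c0^2) * (2 * (c1 * (n * Λ * (1/4)) * (D1 * c1)) + 2 * ((n * n * (1/4)^2)^2 * c1))) * (Θ + Θ^2) := by
    intro k
    have hL := ker_L1 (z := v k) (ρ := bump 3 K) (p := D2s v) ((h.hv k).of_le one_le_inf)
      hρ.continuous (hk.supp 2) (D2s_cont h.hv) (fun x => D2s_nonneg x)
      hD1 (fun x t ht => inner_hess h hk hσ hM k x t ht)
      (conv_contDiff (k := 2) (by exact_mod_cast hρ) hρc (h.hv k).continuous).continuous
    have hz : v k = fun x => v k x - aff 0 (fun _ => 0) x := by ext x; simp [aff]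
    have hSS : ∀ x, ‖x‖ ≤ 1/4 → |conv (bump 3 K) (v k) x - c * v k x| ≤ c * (n * Λ * (1/4)) := by
      intro x hx
      apply conv_sub_le hρ.continuous (h.hv k).continuous (bump_nonneg 3 K) (hk.supp 2)
      intro y hy
      refine (mvt' ((h.hv k).differentiable (by simp)) hΛ (fun x i => h.lip k i x) _ _).trans ?_
      have : ‖x - y - x‖ = ‖y‖ := by rw [sub_sub_cancel_left, norm_neg]
      rw [this]; gcongr
    have hDD : ∀ x, ‖x‖ ≤ 1/4 → ∀ i j, |pd i (pd j (conv (bump 3 K) (v k))) x| ≤ Θ := by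
      intro x hx i j
      have e : pd j (conv (bump 3 K) (v k)) = conv (pd j (bump 3 K)) (v k) := funext fun x =>
        pd_conv j hρ1 hρc (h.hv k).continuous x
      have h1 : ContDiff ℝ 1 (pd j (bump 3 K)) := pd_contDiff (k := 1) j (by exact_mod_cast hρ)
      rw [e, pd_conv i h1 (pd_hcs j hρc) (h.hv k).continuous, conv_ibp i h1 (pd_hcs j hρc) ((h.hv k).of_le one_le_inf),
        conv_ibp j hρ1 hρc ((pd_smooth i (h.hv k)).of_le one_le_inf)]
      have cc : Continuous (pd j (pd i (v k))) := (pd_smooth j (pd_smooth i (h.hv k))).continuous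
      refine (conv_abs_le (B := 1) hρ.continuous cc (hk.supp 2) ?_ hx).trans ?_
      · intro y; rw [abs_of_nonneg (bump_nonneg _ _ _)]; exact bump_le_one (le_trans (by positivity) (hk.lo1 y))
      · rw [one_mul]
        exact setIntegral_mono (intOn cc.abs _ _) (intOn (D2s_cont h.hv) _ _) (fun x => le_D2s k j i x)
    obtain ⟨b', A', hA', hr⟩ := step_aff h hk hcp hc k (z := v k) hz (X := D1 * (c1 * Θ)) (S := c * (n * Λ * (1/4))) (D := Θ)
      (by positivity) hΘ0 (le_refl (1/4)) hL hSS hDD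
    refine ⟨b', A', hA', hr.trans ?_⟩
    have e1 : 1/c^2 ≤ 1/c0^2 := by gcongr
    calc _ = (1/c^2) * (2 * (c * (n * Λ * (1/4)) * (D1 * c1)) * Θ + 2 * ((n * n * (1/4)^2)^2 * c1) * Θ^2) := by ring
      _ ≤ (1/c0^2) * (2 * (c1 * (n * Λ * (1/4)) * (D1 * c1)) * Θ + 2 * ((n * n * (1/4)^2)^2 * c1) * Θ^2) := by gcongr
      _ ≤ (1/c0^2) * (2 * (c1 * (n * Λ * (1/4)) * (D1 * c1)) * Θ + 2 * ((n * n * (1/4)^2)^2 * c1) * Θ^2) +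
          (1/c0^2) * (2 * (c1 * (n * Λ * (1/4)) * (D1 * c1)) * Θ^2 + 2 * ((n * n * (1/4)^2)^2 * c1) * Θ) := by
          apply le_add_of_nonneg_right; positivity
      _ = _ := by ring
  choose b' A' hA' hr using main
  refine ⟨b', A', hA', ?_⟩
  calc _ ≤ ∑ k : Fin n, _ := Finset.sum_le_sum fun k _ => hr k
    _ = _ := by simp; ring

lemma sup_lemma (n : ℕ) (Λ : ℝ) (hΛ : 0 ≤ Λ) (μ : ℝ) (hμ : 0 < μ) : ∃ η > 0, ∀ z : Eu n → ℝ, ContDiff ℝ ∞ z →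
    (∀ i x, |pd i z x| ≤ 2 * Λ) → ∫ x in closedBall 0 1, z x ^ 2 ≤ η → ∀ x, ‖x‖ ≤ 1/2 → |z x| ≤ μ := by
  obtain ⟨r, hr, hr1, hr2⟩ : ∃ r : ℝ, 0 < r ∧ n * (2 * Λ) * r ≤ μ / 2 ∧ r ≤ 1/2 := by
    refine ⟨min (1/2) (μ / 2 / (n * (2 * Λ) + 1)), by positivity, ?_, min_le_left _ _⟩
    calc n * (2 * Λ) * min (1/2) (μ / 2 / (n * (2 * Λ) + 1)) ≤ n * (2 * Λ) * (μ / 2 / (n * (2 * Λ) + 1)) := by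
          gcongr; exact min_le_right _ _
      _ ≤ _ := by
          rw [mul_div_assoc', div_le_iff₀ (by positivity)]; nlinarith
  have hb := bv_pos (n := n) hr
  refine ⟨(μ/2)^2 * bv n r / 2, by positivity, ?_⟩
  intro z hz hp hI x hx
  by_contra hcon
  push Not at hcon
  have key : (μ/2)^2 * bv n r ≤ ∫ x in closedBall 0 1, z x ^ 2 := by
    have c2 : Continuous (fun x => z x ^ 2) := hz.continuous.pow 2
    calc (μ/2)^2 * bv n r = ∫ y in closedBall x r, (μ/2)^2 := by
          rw [setIntegral_const, smul_eq_mul, Measure.addHaar_real_closedBall_center, mul_comm]; rfl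
      _ ≤ ∫ y in closedBall x r, z y ^ 2 := by
          refine setIntegral_mono_on (intOn continuous_const _ _) (intOn c2 _ _) isClosed_closedBall.measurableSet ?_
          intro y hy
          rw [← sq_abs (z y)]
          have h1 := mvt' (hz.differentiable (by simp)) (by positivity) (fun x i => hp i x) x y
          have h2 : ‖x - y‖ ≤ r := by rw [← dist_eq_norm, dist_comm]; exact hy
          have h3 : n * (2 * Λ) * ‖x - y‖ ≤ n * (2 * Λ) * r := by gcongr
          have h4 : μ / 2 ≤ |z y| := by
            have := abs_sub_abs_le_abs_sub (z x) (z y); linarith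
          gcongr
      _ ≤ _ := by
          refine setIntegral_mono_set (intOn c2 _ _) (Filter.Eventually.of_forall fun x => sq_nonneg _) (LE.le.eventuallyLE ?_)
          apply closedBall_subset_closedBall'
          rw [dist_zero_right]; linarith
  have : 0 < (μ/2)^2 * bv n r := by positivity
  linarith

end SL
end Part9

section Part10
open scoped ContDiff Pointwise
open MeasureTheory Metric

namespace SL
variable {n : ℕ}
variable {Λ M m C σ : ℝ} {v : Fin n → Eu n → ℝ} {a : Fin n → Fin n → Eu n → ℝ}

lemma setInt_scale (f : Eu n → ℝ) {R : ℝ} (hR : 0 < R) (r : ℝ) :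
    R ^ n * ∫ x in closedBall 0 r, f (R • x) = ∫ x in closedBall 0 (R * r), f x := by
  rw [Measure.setIntegral_comp_smul_of_pos _ _ _ hR, smul_closedBall' hR.ne']
  simp only [smul_zero, finrank_euclideanSpace, Fintype.card_fin, smul_eq_mul, Real.norm_eq_abs, abs_of_pos hR]
  rw [← mul_assoc, mul_inv_cancel₀ (by positivity), one_mul]

/-- rescaling -/
noncomputable def sc (R : ℝ) (v : Fin n → Eu n → ℝ) (k : Fin n) (x : Eu n) : ℝ := R⁻¹ * v k (R • x)

lemma smul_cd (R : ℝ) {k : WithTop ℕ∞} : ContDiff ℝ k (fun y : Eu n => R • y) := by fun_prop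

lemma pd_smul {f : Eu n → ℝ} (hf : ContDiff ℝ ∞ f) (i : Fin n) (R : ℝ) (x : Eu n) :
    pd i (fun x => f (R • x)) x = R * pd i f (R • x) := by
  have := pd_affine (hf.differentiable (by simp)) i 0 x R
  simpa using this

lemma pd_sc (hv : ∀ k, ContDiff ℝ ∞ (v k)) {R : ℝ} (hR : 0 < R) (i k : Fin n) (x : Eu n) :
    pd i (sc R v k) x = pd i (v k) (R • x) := by
  unfold sc
  change pd i (fun x => R⁻¹ * (fun x => v k (R • x)) x) x = _
  rw [pd_const_mul (f := fun x => v k (R • x)) i R⁻¹ (cd ((hv k).comp (smul_cd R)) (by simp) x), pd_smul (hv k)]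
  field_simp

lemma pd2_sc (hv : ∀ k, ContDiff ℝ ∞ (v k)) {R : ℝ} (hR : 0 < R) (i j k : Fin n) (x : Eu n) :
    pd i (pd j (sc R v k)) x = R * pd i (pd j (v k)) (R • x) := by
  have : pd j (sc R v k) = fun x => pd j (v k) (R • x) := funext fun x => pd_sc hv hR j k x
  rw [this, pd_smul (pd_smooth j (hv k))]

lemma sc_cd (hv : ∀ k, ContDiff ℝ ∞ (v k)) (R : ℝ) (k : Fin n) : ContDiff ℝ ∞ (sc R v k) :=
  contDiff_const.mul ((hv k).comp (smul_cd R))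

lemma Adm.scale (h : Adm n Λ M m C σ v a) {R : ℝ} (hR : 0 < R) :
    Adm n Λ M m C σ (sc R v) (fun i j x => a i j (R • x)) where
  hv k := sc_cd h.hv R k
  ha i j := (h.ha i j).comp (smul_cd R)
  symm i j x := h.symm i j _
  div j x := by
    simp_rw [pd_smul (h.ha _ _), ← Finset.mul_sum, h.div, mul_zero]
  eqn k x := by
    simp_rw [pd2_sc h.hv hR]
    have := h.eqn k (R • x)
    calc _ = R * ∑ i, ∑ j, a i j (R • x) * pd i (pd j (v k)) (R • x) := by
          simp_rw [Finset.mul_sum]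
          exact Finset.sum_congr rfl fun i _ => Finset.sum_congr rfl fun j _ => by ring
      _ = 0 := by rw [this, mul_zero]
  ell x ξ := h.ell _ ξ
  bdd i j x := h.bdd i j _
  lip k j x := by rw [pd_sc h.hv hR]; exact h.lip k j _
  ker A hA := by
    obtain ⟨a0, K, hk, hd⟩ := h.ker A hA
    refine ⟨a0, K, hk, fun i j x => ?_⟩
    simp_rw [pd_sc h.hv hR]; exact hd i j _

/-- excess -/
def ExR (Λ : ℝ) (v : Fin n → Eu n → ℝ) (R τ : ℝ) : Prop := ∃ (b : Fin n → ℝ) (A : Fin n → Fin n → ℝ),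
  (∀ k l, |A k l| ≤ Λ) ∧ ∑ k, ∫ x in closedBall 0 R, (v k x - aff (b k) (A k) x) ^ 2 ≤ τ * R ^ (n+2)

lemma ex_int {R : ℝ} (hR : 0 < R) (b : Fin n → ℝ) (A : Fin n → Fin n → ℝ) (r : ℝ) :
    R ^ (n+2) * ∑ k, ∫ x in closedBall 0 r, (sc R v k x - aff (R⁻¹ * b k) (A k) x) ^ 2 =
    ∑ k, ∫ x in closedBall 0 (R * r), (v k x - aff (b k) (A k) x) ^ 2 := by
  rw [Finset.mul_sum]
  refine Finset.sum_congr rfl fun k _ => ?_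
  rw [← setInt_scale _ hR]
  have : ∀ x, (sc R v k x - aff (R⁻¹ * b k) (A k) x) ^ 2 = (R^2)⁻¹ * (v k (R • x) - aff (b k) (A k) (R • x)) ^ 2 := by
    intro x
    have e : aff (R⁻¹ * b k) (A k) x = R⁻¹ * aff (b k) (A k) (R • x) := by
      unfold aff; rw [mul_add, Finset.mul_sum]; congr 1
      refine Finset.sum_congr rfl fun i _ => ?_
      simp only [PiLp.smul_apply, smul_eq_mul]; field_simp
    rw [e]; unfold sc; rw [← mul_sub, mul_pow, inv_pow]
  simp_rw [this]
  rw [integral_const_mul, pow_add, mul_assoc, ← mul_assoc (R^2), mul_inv_cancel₀ (by positivity), one_mul]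

lemma ExR_sc {R : ℝ} (hR : 0 < R) (r τ : ℝ) : ExR Λ (sc R v) r τ ↔ ExR Λ v (R * r) τ := by
  have hp : 0 < R ^ (n+2) := by positivity
  constructor
  · rintro ⟨b, A, hA, h⟩
    refine ⟨fun k => R * b k, A, hA, ?_⟩
    rw [← ex_int hR]
    have : ∀ k, R⁻¹ * (R * b k) = b k := by intro k; field_simp
    simp_rw [this]
    calc _ ≤ R ^ (n+2) * (τ * r^(n+2)) := by gcongr
      _ = _ := by ring
  · rintro ⟨b, A, hA, h⟩
    refine ⟨fun k => R⁻¹ * b k, A, hA, ?_⟩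
    rw [← ex_int hR] at h
    refine le_of_mul_le_mul_left (h.trans (le_of_eq ?_)) hp
    ring

lemma start_lemma (n : ℕ) (Λ M m C σ : ℝ) (hσ : 0 < σ) (hM : 0 ≤ M) (hΛ : 0 ≤ Λ) (τ : ℝ) (hτ : 0 < τ) :
    ∃ η > 0, ∀ (v : Fin n → Eu n → ℝ) (a : Fin n → Fin n → Eu n → ℝ), Adm n Λ M m C σ v a → ∀ R > 0,
      R ^ 2 * ∫ x in closedBall 0 R, D2s v x ^ 2 ≤ η * R ^ n → ExR Λ v (R * (1/4)) τ := by
  obtain ⟨C5, hC5, H⟩ := initial_lemma n Λ M m C σ hσ hM hΛ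
  have hb : 0 < bv n 1 := bv_pos one_pos
  obtain ⟨s, hs, hs1, hs2⟩ : ∃ s : ℝ, 0 < s ∧ s ≤ 1 ∧ C5 * (2 * s) ≤ τ * (1/4)^(n+2) := by
    refine ⟨min 1 (τ * (1/4)^(n+2) / (2 * C5 + 1)), by positivity, min_le_left _ _, ?_⟩
    calc _ ≤ C5 * (2 * (τ * (1/4)^(n+2) / (2 * C5 + 1))) := by gcongr; exact min_le_right _ _
      _ = 2 * C5 * (τ * (1/4)^(n+2)) / (2 * C5 + 1) := by ring
      _ ≤ _ := by rw [div_le_iff₀ (by positivity)]; have : 0 < τ * (1/4)^(n+2) := by positivity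
                  nlinarith
  refine ⟨s^2 / bv n 1, by positivity, ?_⟩
  intro v a h R hR hη
  rw [← ExR_sc hR]
  obtain ⟨b, A, hA, hr⟩ := H _ _ (h.scale hR)
  refine ⟨b, A, hA, hr.trans ?_⟩
  set Θ := ∫ x in closedBall 0 (1/2), D2s (sc R v) x with hΘ
  have hΘ0 : 0 ≤ Θ := integral_nonneg fun x => D2s_nonneg x
  have cD := D2s_cont (h.scale hR).hv
  have e : ∀ x, D2s (sc R v) x = R * D2s v (R • x) := by
    intro x; unfold D2s
    simp_rw [pd2_sc h.hv hR, abs_mul, abs_of_pos hR, Finset.mul_sum]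
  have h1 : Θ ^ 2 ≤ s ^ 2 := by
    calc Θ ^ 2 ≤ (∫ x in closedBall 0 1, |D2s (sc R v) x|) ^ 2 := by
          gcongr
          refine (setInt_mono_r cD (fun x => D2s_nonneg x) (by norm_num : (1/2:ℝ) ≤ 1)).trans ?_
          exact setIntegral_mono (intOn cD _ _) (intOn cD.abs _ _) (fun x => le_abs_self _)
      _ ≤ bv n 1 * ∫ x in closedBall 0 1, D2s (sc R v) x ^ 2 := cs_ball cD one_pos
      _ ≤ bv n 1 * (s^2 / bv n 1) := by
          gcongr
          simp_rw [e, mul_pow]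
          rw [integral_const_mul]
          have e2 := setInt_scale (fun x => D2s v x ^ 2) hR 1
          rw [mul_one] at e2
          rw [← e2] at hη
          have hRn : 0 < R ^ n := by positivity
          refine le_of_mul_le_mul_right (le_trans (le_of_eq ?_) hη) hRn
          ring
      _ = s ^ 2 := by field_simp
  have h2 : Θ ≤ s := by exact abs_le_of_sq_le_sq' h1 hs.le |>.2
  calc C5 * (Θ + Θ^2) ≤ C5 * (s + s^2) := by gcongr
    _ ≤ C5 * (2 * s) := by gcongr; nlinarith
    _ ≤ _ := hs2

lemma improve (n : ℕ) (Λ M m C σ : ℝ) (hm : 0 < m) (hσ : 0 < σ) (hC : 0 ≤ C) (hM : 0 ≤ M) (hΛ : 0 ≤ Λ) :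
    ∃ θ > 0, θ ≤ 1/4 ∧ ∃ η0 > 0, ∀ (v : Fin n → Eu n → ℝ) (a : Fin n → Fin n → Eu n → ℝ), Adm n Λ M m C σ v a →
      ∀ R > 0, ∀ τ ≤ η0, ExR Λ v R τ → ExR Λ v (R * θ) (τ / 2) := by
  obtain ⟨C3, hC3, H⟩ := decay_lemma n Λ M m C σ hm hσ hC hM
  obtain ⟨θ, hθ, hθ1, hθ2⟩ : ∃ θ : ℝ, 0 < θ ∧ θ ≤ 1/4 ∧ C3 * θ^2 ≤ 1/4 := by
    refine ⟨1 / (4 * (C3 + 1)), by positivity, ?_, ?_⟩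
    · rw [div_le_div_iff₀ (by positivity) (by norm_num)]; linarith
    · rw [div_pow, mul_div_assoc', div_le_div_iff₀ (by positivity) (by norm_num)]; nlinarith
  obtain ⟨μ, hμ, hμ2⟩ : ∃ μ : ℝ, 0 < μ ∧ C3 * μ ≤ θ^(n+2) / 4 := by
    refine ⟨θ^(n+2) / (4 * (C3 + 1)), by positivity, ?_⟩
    rw [mul_div_assoc', div_le_div_iff₀ (by positivity) (by norm_num)]
    have : 0 < θ^(n+2) := by positivity
    nlinarith
  obtain ⟨η, hη, Hs⟩ := sup_lemma n Λ hΛ μ hμ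
  refine ⟨θ, hθ, hθ1, η, hη, ?_⟩
  intro v a h R hR τ hτ hex
  rw [← mul_one R, ← ExR_sc hR] at hex
  rw [← ExR_sc hR]
  have h' := h.scale hR
  set w := sc R v
  obtain ⟨b, A, hA, hJ⟩ := hex
  rw [one_pow, mul_one] at hJ
  have hsup : ∀ k x, ‖x‖ ≤ 1/2 → |w k x - aff (b k) (A k) x| ≤ μ := by
    intro k
    refine Hs (fun x => w k x - aff (b k) (A k) x) ((h'.hv k).sub (aff_cd _ _)) ?_ ?_
    · intro i x
      rw [pd_sub i (cd (h'.hv k) (by simp) x) (cd (aff_cd (m := ∞) _ _) (by simp) x), pd_aff']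
      have := abs_sub (pd i (w k) x) (A k i)
      linarith [h'.lip k i x, hA k i]
    · refine le_trans ?_ (hJ.trans hτ)
      exact Finset.single_le_sum (f := fun k => ∫ x in closedBall 0 1, (w k x - aff (b k) (A k) x) ^ 2)
        (fun k _ => integral_nonneg fun x => sq_nonneg _) (Finset.mem_univ k)
  obtain ⟨b', A', hA', hr⟩ := H _ _ h' b A hA θ μ hθ hθ1 hμ.le hsup
  refine ⟨b', A', hA', hr.trans ?_⟩
  have hJ0 : 0 ≤ ∑ k, ∫ x in closedBall 0 1, (w k x - aff (b k) (A k) x) ^ 2 :=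
    Finset.sum_nonneg fun k _ => integral_nonneg fun x => sq_nonneg _
  have h3 : C3 * (μ + θ^(n+4)) ≤ θ^(n+2) / 2 := by
    have : C3 * θ^(n+4) = (C3 * θ^2) * θ^(n+2) := by ring
    have h4 : (C3 * θ^2) * θ^(n+2) ≤ 1/4 * θ^(n+2) := by gcongr
    rw [mul_add]; linarith
  calc _ ≤ θ^(n+2) / 2 * τ := by gcongr
    _ = _ := by ring

lemma iter_ex {θ η0 : ℝ} (hθ : 0 < θ) (hη : 0 < η0)
    (H : ∀ R > 0, ∀ τ ≤ η0, ExR Λ v R τ → ExR Λ v (R * θ) (τ / 2)) (R : ℝ) (hR : 0 < R) (h : ExR Λ v R η0) (j : ℕ) :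
    ExR Λ v (R * θ^j) (η0 / 2^j) := by
  induction j with
  | zero => simpa using h
  | succ j ih =>
    have := H (R * θ^j) (by positivity) (η0 / 2^j) (div_le_self hη.le (one_le_pow₀ (by norm_num))) ih
    have e1 : R * θ^(j+1) = R * θ^j * θ := by ring
    have e2 : η0 / 2^(j+1) = η0 / 2^j / 2 := by rw [pow_succ]; field_simp
    rw [e1, e2]; exact this

lemma flat (hm : 0 < m) (hσ : 0 < σ) (hC : 0 ≤ C) (hM : 0 ≤ M) (hΛ : 0 ≤ Λ) (h : Adm n Λ M m C σ v a)
    (hmon : ∀ η > 0, ∀ R0 : ℝ, ∃ R ≥ R0, R ^ 2 * ∫ x in closedBall 0 R, D2s v x ^ 2 ≤ η * R ^ n)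
    (k i j : Fin n) (x : Eu n) : pd i (pd j (v k)) x = 0 := by
  obtain ⟨θ, hθ, hθ1, η0, hη0, H⟩ := improve n Λ M m C σ hm hσ hC hM hΛ
  obtain ⟨η, hη, Hs⟩ := start_lemma n Λ M m C σ hσ hM hΛ η0 hη0
  have small : ∀ r > 0, ∀ τ > 0, ∃ (b : ℝ) (A : Fin n → ℝ), ∫ x in closedBall 0 r, (v k x - aff b A x) ^ 2 ≤ τ := by
    intro r hr τ hτ
    obtain ⟨j0, hj0⟩ : ∃ j0 : ℕ, (1/2 : ℝ)^j0 < τ / (η0 * (r/θ)^(n+2)) :=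
      exists_pow_lt_of_lt_one (by positivity) (by norm_num)
    obtain ⟨R, hR, hRη⟩ := hmon η hη (4 * r / θ^(j0+1))
    have hR0 : 0 < R := lt_of_lt_of_le (by positivity) hR
    have hst := Hs v a h R hR0 hRη
    set R' := R * (1/4) with hR'
    have hR'0 : 0 < R' := by positivity
    have hRr : r / R' ≤ θ^(j0+1) := by
      rw [ge_iff_le, div_le_iff₀ (by positivity)] at hR
      rw [div_le_iff₀ hR'0, hR']; linarith
    have hle1 : r / R' ≤ 1 := hRr.trans (pow_le_one₀ hθ.le (by linarith))
    obtain ⟨j, hj1, hj2⟩ := exists_nat_pow_near_of_lt_one (x := r / R') (y := θ) (by positivity) hle1 hθ (by linarith)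
    have hjj : j0 ≤ j := by
      have := hj1.trans_le hRr
      rw [pow_lt_pow_iff_right_of_lt_one₀ hθ (by linarith)] at this; omega
    obtain ⟨b, A, hA, hb⟩ := iter_ex hθ hη0 (fun R hR τ hτ hx => H v a h R hR τ hτ hx) R' hR'0 hst j
    refine ⟨b k, A k, ?_⟩
    have cc : Continuous (fun x => (v k x - aff (b k) (A k) x)^2) :=
      ((h.hv k).continuous.sub (aff_cd (m := ∞) _ _).continuous).pow 2
    have hr1 : r ≤ R' * θ^j := by rw [div_le_iff₀ hR'0] at hj2; linarith
    have hr2 : R' * θ^j ≤ r / θ := by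
      rw [lt_div_iff₀ hR'0, pow_succ] at hj1
      rw [le_div_iff₀ hθ]; linarith
    calc _ ≤ ∫ x in closedBall 0 (R' * θ^j), (v k x - aff (b k) (A k) x)^2 := setInt_mono_r cc (fun x => sq_nonneg _) hr1
      _ ≤ ∑ k, ∫ x in closedBall 0 (R' * θ^j), (v k x - aff (b k) (A k) x)^2 :=
        Finset.single_le_sum (f := fun k => ∫ x in closedBall 0 (R' * θ^j), (v k x - aff (b k) (A k) x) ^ 2)
        (fun k _ => integral_nonneg fun x => sq_nonneg _) (Finset.mem_univ k)
      _ ≤ η0 / 2^j * (R' * θ^j)^(n+2) := hb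
      _ ≤ η0 * (1/2)^j0 * (r/θ)^(n+2) := by
        have : (1/2:ℝ)^j ≤ (1/2)^j0 := pow_le_pow_of_le_one (by norm_num) (by norm_num) hjj
        have e : η0 / 2^j = η0 * (1/2)^j := by rw [one_div, inv_pow]; rfl
        rw [e]; gcongr
      _ ≤ τ := by
        rw [lt_div_iff₀ (by positivity)] at hj0
        linarith
  have hsm : ContDiff ℝ ∞ (pd i (pd j (v k))) := pd_smooth i (pd_smooth j (h.hv k))
  have hae := ae_eq_zero_of_integral_contDiff_smul_eq_zero (μ := volume) hsm.continuous.locallyIntegrable (fun φ hφ hφc => ?_)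
  · have : pd i (pd j (v k)) = fun _ => 0 := (hsm.continuous.ae_eq_iff_eq volume continuous_const).1 hae
    rw [this]
  · simp_rw [smul_eq_mul]
    have hφ1 : ∀ l, ContDiff ℝ ∞ (pd l φ) := fun l => pd_smooth l hφ
    set ψ := pd j (pd i φ) with hψ
    have hψs : ContDiff ℝ ∞ ψ := pd_smooth j (hφ1 i)
    have hψc : HasCompactSupport ψ := pd_hcs j (pd_hcs i hφc)
    obtain ⟨r, hr, hsup⟩ : ∃ r > 0, ∀ y : Eu n, r < ‖y‖ → ψ y = 0 := by
      obtain ⟨r, hr⟩ := hψc.isCompact.isBounded.subset_closedBall 0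
      refine ⟨max r 1, by positivity, fun y hy => ?_⟩
      apply image_eq_zero_of_notMem_tsupport
      intro hm
      have := hr hm
      simp at this
      linarith [le_max_left r 1]
    obtain ⟨B, hB⟩ : ∃ B, ∀ y, |ψ y| ≤ B := by
      obtain ⟨B, hB⟩ := hψc.exists_bound_of_continuous hψs.continuous
      exact ⟨B, hB⟩
    have hB0 : 0 ≤ B := (abs_nonneg _).trans (hB 0)
    have key : ∀ b A, ∫ y, φ y * pd i (pd j (v k)) y = ∫ y, (v k y - aff b A y) * ψ y := by
      intro b A
      set z : Eu n → ℝ := fun y => v k y - aff b A y with hz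
      have hzs : ContDiff ℝ ∞ z := (h.hv k).sub (aff_cd _ _)
      have e1 : pd j z = fun x => pd j (v k) x - A j := funext fun x => by
        rw [hz, pd_sub j (cd (h.hv k) (by simp) x) (cd (aff_cd (m := ∞) _ _) (by simp) x), pd_aff']
      have e2 : ∀ x, pd i (pd j z) x = pd i (pd j (v k)) x := fun x => by
        rw [e1, pd_sub i (cd (pd_smooth j (h.hv k)) (by simp) x) (by fun_prop), pd_const, sub_zero]
      have i1 := ibp (f := pd j z) (g := φ) i ((pd_smooth j hzs).of_le one_le_inf) (hφ.of_le one_le_inf) hφc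
      have i2 := ibp (f := z) (g := pd i φ) j (hzs.of_le one_le_inf) ((hφ1 i).of_le one_le_inf) (pd_hcs i hφc)
      simp_rw [e2] at i1
      rw [hψ, i2, i1, neg_neg]
      congr 1; ext y; ring
    have bound : ∀ τ > 0, (∫ y, φ y * pd i (pd j (v k)) y)^2 ≤ B^2 * bv n r * τ := by
      intro τ hτ
      obtain ⟨b, A, hbA⟩ := small r hr τ hτ
      have cc : Continuous (fun x => v k x - aff b A x) := (h.hv k).continuous.sub (aff_cd (m := ∞) _ _).continuous
      rw [key b A, setInt_of_supp (r := r) (fun y hy => by rw [hsup y hy, mul_zero])]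
      have : |∫ y in closedBall 0 r, (v k y - aff b A y) * ψ y| ≤ B * ∫ y in closedBall 0 r, |v k y - aff b A y| := by
        rw [← integral_const_mul, ← Real.norm_eq_abs]
        refine norm_integral_le_of_norm_le (intOn (continuous_const.mul cc.abs) _ _) (Filter.Eventually.of_forall fun y => ?_)
        rw [Real.norm_eq_abs, abs_mul, mul_comm]
        exact mul_le_mul_of_nonneg_right (hB y) (abs_nonneg _)
      rw [← sq_abs]
      calc _ ≤ (B * ∫ y in closedBall 0 r, |v k y - aff b A y|)^2 := by gcongr
        _ = B^2 * (∫ y in closedBall 0 r, |v k y - aff b A y|)^2 := by ring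
        _ ≤ B^2 * (bv n r * ∫ y in closedBall 0 r, (v k y - aff b A y)^2) := by gcongr; exact cs_ball cc hr
        _ ≤ B^2 * (bv n r * τ) := by gcongr; exact bv_nonneg r
        _ = _ := by ring
    set q := ∫ y, φ y * pd i (pd j (v k)) y
    set G := B^2 * bv n r
    have hG : 0 ≤ G := mul_nonneg (sq_nonneg _) (bv_nonneg r)
    by_contra hq
    have hq2 : 0 < q^2 := by positivity
    have := bound (q^2 / (2 * (G+1))) (by positivity)
    rw [mul_div_assoc', le_div_iff₀ (by positivity)] at this
    nlinarith

end SL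
end Part10

section Part11
open scoped ContDiff
open MeasureTheory Metric

namespace SL
variable {n : ℕ}
variable {v : Fin n → Eu n → ℝ} {a : Fin n → Fin n → Eu n → ℝ}

lemma pp_supp {s : Eu n → ℝ} (hs : ∀ x, ‖x‖^2 ≤ s x) (k : ℕ) {R ρ : ℝ} (hR : |R| ≤ ρ) (x : Eu n) (hx : ρ < ‖x‖) :
    pp (k+1) (R^2 - s x) = 0 := by
  apply pp_of_nonpos
  have h1 : R^2 ≤ ρ^2 := by rw [← sq_abs]; gcongr
  have h2 : ρ^2 ≤ ‖x‖^2 := by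
    have : 0 ≤ ρ := (abs_nonneg R).trans hR
    gcongr
  linarith [hs x]

lemma I_deriv {s w : Eu n → ℝ} (cs : Continuous s) (cw : Continuous w) (hs : ∀ x, ‖x‖^2 ≤ s x) {B : ℝ}
    (hw : ∀ x, |w x| ≤ B) (R : ℝ) :
    HasDerivAt (fun R => ∫ x, pp 3 (R^2 - s x) * w x) (6 * R * ∫ x, pp 2 (R^2 - s x) * w x) R := by
  set ρ := |R| + 1
  have hB : 0 ≤ B := (abs_nonneg _).trans (hw 0)
  have hρ : 0 ≤ ρ := by positivity
  have cpp := pp_cont 3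
  have cpp2 := pp_cont 2
  have hnear : ∀ R' ∈ ball R 1, |R'| ≤ ρ := by
    intro R' hR'
    rw [mem_ball, Real.dist_eq] at hR'
    have := abs_sub_abs_le_abs_sub R' R
    simp only [ρ]; linarith
  have key := hasDerivAt_integral_of_dominated_loc_of_deriv_le (μ := volume.restrict (closedBall (0 : Eu n) ρ))
    (F := fun R x => pp 3 (R^2 - s x) * w x) (F' := fun R x => 6 * R * (pp 2 (R^2 - s x) * w x)) (x₀ := R)
    (bound := fun _ => 6 * ρ * ((ρ^2)^2 * B)) (ball_mem_nhds R one_pos)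
    (Filter.Eventually.of_forall fun R => by
      have : Continuous (fun x => pp 3 (R^2 - s x) * w x) := by fun_prop
      exact this.aestronglyMeasurable) (intOn (by fun_prop) _ _)
    (by
      have : Continuous (fun x => 6 * R * (pp 2 (R^2 - s x) * w x)) := by fun_prop
      exact this.aestronglyMeasurable) ?_ (intOn continuous_const _ _) ?_
  · have h2 := key.2
    rw [integral_const_mul, ← setInt_of_supp (f := fun x => pp 2 (R^2 - s x) * w x) (r := ρ)
      (fun x hx => by rw [pp_supp hs 1 (hnear R (mem_ball_self one_pos)) x hx, zero_mul])] at h2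
    refine h2.congr_of_eventuallyEq ?_
    filter_upwards [ball_mem_nhds R one_pos] with R' hR'
    exact setInt_of_supp (fun x hx => by rw [pp_supp hs 2 (hnear R' hR') x hx, zero_mul])
  · refine Filter.Eventually.of_forall fun x R' hR' => ?_
    have h1 := hnear R' hR'
    rw [Real.norm_eq_abs, abs_mul, abs_mul, abs_mul, abs_of_nonneg (pp_nonneg 2 _), abs_of_pos (by norm_num : (0:ℝ) < 6)]
    have h2 : pp 2 (R'^2 - s x) ≤ (ρ^2)^2 := by
      unfold pp
      have h1' : R'^2 ≤ ρ^2 := by rw [← sq_abs]; gcongr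
      have : max (R'^2 - s x) 0 ≤ ρ^2 := max_le (by nlinarith [hs x, sq_nonneg ‖x‖]) (by positivity)
      gcongr
    have h3 := hw x
    have := pp_nonneg 2 (R'^2 - s x)
    gcongr
  · refine Filter.Eventually.of_forall fun x R' hR' => ?_
    have h1 := pp_hasDerivAt 1 (R'^2 - s x)
    have h2 : HasDerivAt (fun R : ℝ => R^2 - s x) (2 * R') R' := by
      simpa using (hasDerivAt_pow 2 R').sub_const (s x)
    have h3 := (h1.comp R' h2).mul_const (w x)
    refine h3.congr_deriv ?_
    push_cast; norm_num; ring

lemma mono_ineq {s f V : Eu n → ℝ} (ha : ∀ i j, ContDiff ℝ ∞ (a i j)) (hsy : ∀ i j x, a i j x = a j i x)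
    (hdiv : ∀ j x, ∑ i, pd i (a i j) x = 0) (hs : ContDiff ℝ ∞ s) (hf : ContDiff ℝ ∞ f) (hV : Continuous V)
    (hs0 : ∀ x, ‖x‖^2 ≤ s x) (hV0 : ∀ x, 0 ≤ V x) (hf0 : ∀ x, 0 ≤ f x)
    (h1 : ∀ x, ∑ i, ∑ j, a i j x * pd i (pd j s) x = 2 * n * V x)
    (h2 : ∀ x, ∑ i, ∑ j, a i j x * (pd i s x * pd j s x) ≤ 4 * V x * s x) (R : ℝ) :
    ∫ x, pp 4 (R^2 - s x) * ∑ i, ∑ j, a i j x * pd i (pd j f) x ≤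
      48 * R^2 * (∫ x, pp 2 (R^2 - s x) * (f x * V x)) - (8 * n + 48) * ∫ x, pp 3 (R^2 - s x) * (f x * V x) := by
  have cs := hs.continuous
  have cf := hf.continuous
  have cpp2 := pp_cont 2
  have cpp3 := pp_cont 3
  have hsupp : ∀ k, HasCompactSupport (fun x => pp (k+1) (R^2 - s x)) := by
    intro k
    refine HasCompactSupport.intro (isCompact_closedBall (0 : Eu n) |R|) fun x hx => ?_
    exact pp_supp hs0 k le_rfl x (by simpa using hx)
  have hφ : ContDiff ℝ 2 (fun x => pp 4 (R^2 - s x)) := by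
    have : ContDiff ℝ 3 (pp 4) := pp_contDiff 3
    exact (this.of_le (by norm_num)).comp (contDiff_const.sub (hs.of_le two_le_inf))
  have ds : ∀ x, DifferentiableAt ℝ (fun x => R^2 - s x) x := fun x => cd (contDiff_const.sub hs) (by simp) x
  have hps : ∀ j x, pd j (fun x => R^2 - s x) x = - pd j s x := by
    intro j x; rw [pd_sub j (by fun_prop) (cd hs (by simp) x), pd_const, zero_sub]
  have e1 : ∀ j, pd j (fun x => pp 4 (R^2 - s x)) = fun x => (-4) * (pp 3 (R^2 - s x) * pd j s x) := by
    intro j; ext x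
    have := pp_hasDerivAt 2 (R^2 - s x)
    rw [pd_comp (g := pp 4) (f := fun x => R^2 - s x) j this (ds x), hps]
    push_cast; ring
  have e2 : ∀ i j x, pd i (pd j (fun x => pp 4 (R^2 - s x))) x =
      12 * pp 2 (R^2 - s x) * (pd i s x * pd j s x) - 4 * pp 3 (R^2 - s x) * pd i (pd j s) x := by
    intro i j x
    have hd : HasDerivAt (pp 3) _ (R^2 - s x) := pp_hasDerivAt 1 (R^2 - s x)
    have dj := cd (pd_smooth j hs) (by simp) x
    have dp : DifferentiableAt ℝ (fun x => pp 3 (R^2 - s x)) x := DifferentiableAt.fun_comp' (g := pp 3) (f := fun x => R^2 - s x) x hd.differentiableAt (ds x)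
    rw [e1, pd_const_mul i _ (dp.fun_mul dj), pd_mul i dp dj,
      pd_comp (g := pp 3) (f := fun x => R^2 - s x) i hd (ds x), hps]
    push_cast; norm_num; ring
  rw [green (fun i j => (ha i j).of_le one_le_inf) hsy hdiv (hf.of_le two_le_inf) hφ (hsupp 3)]
  rw [← integral_const_mul, ← integral_const_mul, ← integral_sub]
  · have hi : ∀ k, Integrable (fun x => pp (k+1) (R^2 - s x) * (f x * V x)) := fun k => by
      have := pp_cont (k+1)
      exact Continuous.integrable_of_hasCompactSupport (by fun_prop) (hcs_mul_right (hsupp k))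
    have cφ : ∀ i j, Continuous (pd i (pd j (fun x => pp 4 (R^2 - s x)))) := fun i j =>
      pd_cont i (pd_contDiff (k := 1) j (by exact_mod_cast hφ))
    have ca : ∀ i j, Continuous (a i j) := fun i j => (ha i j).continuous
    refine integral_mono ?_ (((hi 1).const_mul _).sub ((hi 2).const_mul _)) ?_
    · refine Continuous.integrable_of_hasCompactSupport (by fun_prop) ?_
      refine hcs_mul_left (hcs_sum fun i _ => hcs_sum fun j _ => hcs_mul_left (pd_hcs i (pd_hcs j (hsupp 3))))
    · intro x
      simp only [e2]
      have e3 : ∑ i, ∑ j, a i j x * (12 * pp 2 (R^2 - s x) * (pd i s x * pd j s x) - 4 * pp 3 (R^2 - s x) * pd i (pd j s) x) =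
          12 * pp 2 (R^2 - s x) * (∑ i, ∑ j, a i j x * (pd i s x * pd j s x)) -
            4 * pp 3 (R^2 - s x) * ∑ i, ∑ j, a i j x * pd i (pd j s) x := by
        simp_rw [Finset.mul_sum, ← Finset.sum_sub_distrib]
        exact Finset.sum_congr rfl fun i _ => Finset.sum_congr rfl fun j _ => by ring
      rw [e3, h1]
      have e4 : pp 3 (R^2 - s x) = (R^2 - s x) * pp 2 (R^2 - s x) := pp_succ 1 _
      have h5 : 12 * pp 2 (R^2 - s x) * (∑ i, ∑ j, a i j x * (pd i s x * pd j s x)) ≤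
          12 * pp 2 (R^2 - s x) * (4 * V x * s x) :=
        mul_le_mul_of_nonneg_left (h2 x) (by have := pp_nonneg 2 (R^2 - s x); positivity)
      calc _ ≤ f x * (12 * pp 2 (R^2 - s x) * (4 * V x * s x) - 4 * pp 3 (R^2 - s x) * (2 * n * V x)) :=
            mul_le_mul_of_nonneg_left (by linarith) (hf0 x)
        _ = _ := by rw [e4]; ring
  · exact Integrable.const_mul (Continuous.integrable_of_hasCompactSupport (f := fun x => pp 2 (R^2 - s x) * (f x * V x)) (by fun_prop) (hcs_mul_right (hsupp 1))) _
  · exact Integrable.const_mul (Continuous.integrable_of_hasCompactSupport (f := fun x => pp 3 (R^2 - s x) * (f x * V x)) (by fun_prop) (hcs_mul_right (hsupp 2))) _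

lemma log_growth {Ψ Ψ' : ℝ → ℝ} {R1 c B : ℝ} (hR1 : 0 < R1) (hc : 0 < c) (hd : ∀ R ≥ R1, HasDerivAt Ψ (Ψ' R) R)
    (hl : ∀ R ≥ R1, c / R ≤ Ψ' R) (hB : ∀ R ≥ R1, Ψ R ≤ B) (h0 : 0 ≤ Ψ R1) : False := by
  have hdd : ∀ R ≥ R1, HasDerivAt (fun R => Ψ R - c * Real.log R) (Ψ' R - c * R⁻¹) R := fun R hR =>
    (hd R hR).sub ((Real.hasDerivAt_log (hR1.trans_le hR).ne').const_mul c)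
  have hm : MonotoneOn (fun R => Ψ R - c * Real.log R) (Set.Ici R1) := by
    refine monotoneOn_of_deriv_nonneg (convex_Ici R1) (fun R hR => (hdd R hR).continuousAt.continuousWithinAt)
      (fun R hR => (hdd R (interior_subset hR)).differentiableAt.differentiableWithinAt) ?_
    intro R hR
    have hR' : R1 ≤ R := interior_subset hR
    rw [(hdd R hR').deriv]
    have := hl R hR'
    rw [div_eq_mul_inv] at this; linarith
  have ht := (Real.tendsto_log_atTop).eventually_gt_atTop ((B + c * Real.log R1) / c)
  obtain ⟨R, hR, hR1'⟩ := (ht.and (Filter.eventually_ge_atTop R1)).exists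
  have h1 := hm (Set.mem_Ici.2 le_rfl) (Set.mem_Ici.2 hR1') hR1'
  have h2 := hB R hR1'
  rw [div_lt_iff₀ hc] at hR
  simp only at h1
  linarith

lemma monot {s f V : Eu n → ℝ} (hv : ∀ k, ContDiff ℝ ∞ (v k)) (ha : ∀ i j, ContDiff ℝ ∞ (a i j)) (hsy : ∀ i j x, a i j x = a j i x)
    (hdiv : ∀ j x, ∑ i, pd i (a i j) x = 0) (hs : ContDiff ℝ ∞ s) (hf : ContDiff ℝ ∞ f) (hV : Continuous V)
    (hs0 : ∀ x, ‖x‖^2 ≤ s x) (hV0 : ∀ x, 0 ≤ V x) (hf0 : ∀ x, 0 ≤ f x)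
    (h1 : ∀ x, ∑ i, ∑ j, a i j x * pd i (pd j s) x = 2 * n * V x)
    (h2 : ∀ x, ∑ i, ∑ j, a i j x * (pd i s x * pd j s x) ≤ 4 * V x * s x)
    {B κ δ : ℝ} (hB : ∀ x, f x * V x ≤ B) (hκ : 0 < κ) (hsκ : ∀ x, s x ≤ κ^2 / 2 * ‖x‖^2) (hδ : 0 < δ)
    (h3 : ∀ x, δ * D2s v x ^ 2 ≤ ∑ i, ∑ j, a i j x * pd i (pd j f) x) :
    ∀ η > 0, ∀ R0 : ℝ, ∃ R ≥ R0, R ^ 2 * ∫ x in closedBall 0 R, D2s v x ^ 2 ≤ η * R ^ n := by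
  intro η hη R0
  by_contra hcon
  push Not at hcon
  have cs := hs.continuous
  have cw : Continuous (fun x => f x * V x) := hf.continuous.mul hV
  have cD := D2s_cont hv
  have hw0 : ∀ x, 0 ≤ f x * V x := fun x => mul_nonneg (hf0 x) (hV0 x)
  have hwB : ∀ x, |f x * V x| ≤ B := fun x => by rw [abs_of_nonneg (hw0 x)]; exact hB x
  have hB0 : 0 ≤ B := (abs_nonneg _).trans (hwB 0)
  set I2 : ℝ → ℝ := fun R => ∫ x, pp 2 (R^2 - s x) * (f x * V x) with hI2
  set I3 : ℝ → ℝ := fun R => ∫ x, pp 3 (R^2 - s x) * (f x * V x) with hI3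
  have hI3d : ∀ R, HasDerivAt I3 (6 * R * I2 R) R := fun R => I_deriv cs cw hs0 hwB R
  have hE : ∀ R > 0, δ * (R^8 / 16) * (∫ x in closedBall 0 (R / κ), D2s v x ^ 2) ≤ 48 * R^2 * I2 R - (8 * n + 48) * I3 R := by
    intro R hR
    refine le_trans ?_ (mono_ineq ha hsy hdiv hs hf hV hs0 hV0 hf0 h1 h2 R)
    have cpp4 := pp_cont 4
    have ca : ∀ i j, Continuous (a i j) := fun i j => (ha i j).continuous
    have cf2 : ∀ i j, Continuous (pd i (pd j f)) := fun i j => (pd_smooth i (pd_smooth j hf)).continuous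
    have cint : Continuous (fun x => pp 4 (R^2 - s x) * ∑ i, ∑ j, a i j x * pd i (pd j f) x) := by fun_prop
    have hnn : ∀ x, 0 ≤ pp 4 (R^2 - s x) * ∑ i, ∑ j, a i j x * pd i (pd j f) x := fun x =>
      mul_nonneg (pp_nonneg _ _) (le_trans (by positivity) (h3 x))
    rw [← integral_const_mul]
    calc _ ≤ ∫ x in closedBall 0 (R / κ), pp 4 (R^2 - s x) * ∑ i, ∑ j, a i j x * pd i (pd j f) x := by
          refine setIntegral_mono_on (intOn (by fun_prop) _ _) (intOn cint _ _) isClosed_closedBall.measurableSet ?_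
          intro x hx
          have hx : ‖x‖ ≤ R / κ := by simpa using hx
          have hx2 : s x ≤ R^2 / 2 := by
            refine (hsκ x).trans ?_
            calc κ^2 / 2 * ‖x‖^2 ≤ κ^2 / 2 * (R / κ)^2 := by gcongr
              _ = _ := by field_simp
          have hp : R^8 / 16 ≤ pp 4 (R^2 - s x) := by
            calc R^8 / 16 = pp 4 (R^2/2) := by rw [pp_of_nonneg (by positivity)]; ring
              _ ≤ _ := pp_mono 4 (by linarith)
          calc _ = R^8 / 16 * (δ * D2s v x ^ 2) := by ring
            _ ≤ _ := mul_le_mul hp (h3 x) (by positivity) (pp_nonneg _ _)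
      _ ≤ _ := by
          refine setIntegral_le_integral ?_ (Filter.Eventually.of_forall hnn)
          refine cint.integrable_of_hasCompactSupport (hcs_mul_right ?_)
          refine HasCompactSupport.intro (isCompact_closedBall (0 : Eu n) |R|) fun x hx => ?_
          exact pp_supp hs0 3 le_rfl x (by simpa using hx)
  have hI30 : ∀ R, 0 ≤ I3 R := fun R => integral_nonneg fun x => mul_nonneg (pp_nonneg _ _) (hw0 x)
  have hI3B : ∀ R > 0, I3 R ≤ R^(n+6) * (B * bv n 1) := by
    intro R hR
    rw [hI3]; dsimp only
    rw [setInt_of_supp (r := R) (fun x hx => by rw [pp_supp hs0 2 (abs_of_pos hR).le x hx, zero_mul])]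
    have cpp3 := pp_cont 3
    calc _ ≤ ∫ x in closedBall (0 : Eu n) R, (R^2)^3 * B := by
          refine setIntegral_mono (intOn (by fun_prop) _ _) (intOn continuous_const _ _) fun x => ?_
          have h3 : pp 3 (R^2 - s x) ≤ (R^2)^3 := by
            rw [← pp_of_nonneg (k := 3) (by positivity)]; exact pp_mono 3 (by nlinarith [hs0 x, sq_nonneg ‖x‖])
          exact mul_le_mul h3 (hB x) (hw0 x) (by positivity)
      _ = bv n R * ((R^2)^3 * B) := by rw [setIntegral_const]; rfl
      _ = _ := by rw [bv_scale hR.le]; ring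
  set R1 := max (κ * R0) 1 with hR1
  have hR1p : 0 < R1 := lt_of_lt_of_le one_pos (le_max_right _ _)
  refine log_growth (Ψ := fun R => I3 R / R^(n+6))
    (Ψ' := fun R => (6 * R * I2 R * R^(n+6) - I3 R * ((n+6 : ℕ) * R^(n+5))) / (R^(n+6))^2)
    (c := δ * η * κ^2 / (128 * κ^n)) (B := B * bv n 1) hR1p (by positivity) ?_ ?_ ?_ ?_
  · intro R hR
    have hRp : 0 < R := hR1p.trans_le hR
    exact (hI3d R).div (hasDerivAt_pow (n+6) R) (by positivity)
  · intro R hR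
    have hRp : 0 < R := hR1p.trans_le hR
    have hrR : R0 ≤ R / κ := by rw [le_div_iff₀ hκ]; linarith [le_max_left (κ * R0) 1]
    have hc := hcon (R / κ) hrR
    have he := hE R hRp
    set E := ∫ x in closedBall 0 (R / κ), D2s v x ^ 2
    have hc2 : η * R^n * κ^2 ≤ R^2 * E * κ^n := by
      rw [div_pow, div_pow, div_mul_eq_mul_div, mul_div_assoc', div_lt_div_iff₀ (by positivity) (by positivity)] at hc
      linarith
    rw [div_div, div_le_div_iff₀ (by positivity) (by positivity)]
    have e1 : (6 * R * I2 R * R^(n+6) - I3 R * ((n+6 : ℕ) * R^(n+5))) = R^(n+5) / 8 * (48 * R^2 * I2 R - (8 * n + 48) * I3 R) := by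
      push_cast; ring
    rw [e1]
    calc δ * η * κ^2 * (R^(n+6))^2 = δ * R^(n+12) * (η * R^n * κ^2) := by ring
      _ ≤ δ * R^(n+12) * (R^2 * E * κ^n) := by gcongr
      _ = R^(n+5) / 8 * (δ * (R^8 / 16) * E) * (128 * κ^n * R) := by ring
      _ ≤ _ := by gcongr
  · intro R hR
    have hRp : 0 < R := hR1p.trans_le hR
    rw [div_le_iff₀ (by positivity)]; linarith [hI3B R hRp]
  · have := hI30 R1; positivity

end SL
end Part11

section Part12
open scoped ContDiff
open MeasureTheory Metric

namespace SL
variable {n : ℕ}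

lemma hasDerivAt_det {F : ℝ → Matrix (Fin n) (Fin n) ℂ} {F' : Matrix (Fin n) (Fin n) ℂ} {t : ℝ}
    (hF : ∀ i j, HasDerivAt (fun t => F t i j) (F' i j) t) :
    HasDerivAt (fun t => (F t).det) (Matrix.trace (Matrix.adjugate (F t) * F')) t := by
  have e : ∀ t, (F t).det = ∑ σ : Equiv.Perm (Fin n), ((Equiv.Perm.sign σ : ℤ) : ℂ) * ∏ i, F t (σ i) i :=
    fun t => Matrix.det_apply' _
  simp_rw [e]
  have h1 : HasDerivAt (fun t => ∑ σ : Equiv.Perm (Fin n), ((Equiv.Perm.sign σ : ℤ) : ℂ) * ∏ i, F t (σ i) i)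
      (∑ σ : Equiv.Perm (Fin n), ((Equiv.Perm.sign σ : ℤ) : ℂ) *
        ∑ i, (∏ j ∈ Finset.univ.erase i, F t (σ j) j) • F' (σ i) i) t := by
    apply HasDerivAt.fun_sum
    intro σ _
    apply HasDerivAt.const_mul
    exact HasDerivAt.fun_finsetProd fun i _ => hF _ _
  convert h1 using 1
  have h2 : ∀ i, ∑ j, (F t).adjugate i j * F' j i = ((F t).updateCol i (fun j => F' j i)).det := by
    intro i
    rw [← Matrix.cramer_apply, Matrix.cramer_eq_adjugate_mulVec]; rfl
  simp only [Matrix.trace, Matrix.diag, Matrix.mul_apply, h2]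
  simp_rw [Finset.mul_sum]
  rw [Finset.sum_comm]
  refine Finset.sum_congr rfl fun i _ => ?_
  rw [Matrix.det_apply']
  refine Finset.sum_congr rfl fun σ _ => ?_
  rw [← Finset.mul_prod_erase _ _ (Finset.mem_univ i)]
  simp only [Matrix.updateCol_self, smul_eq_mul]
  rw [mul_comm (F' (σ i) i)]
  congr 2
  refine Finset.prod_congr rfl fun j hj => ?_
  rw [Matrix.updateCol_ne (Finset.ne_of_mem_erase hj)]

/-- complexification -/
noncomputable abbrev cx (A : Matrix (Fin n) (Fin n) ℝ) : Matrix (Fin n) (Fin n) ℂ := Complex.ofRealHom.mapMatrix A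

lemma logder {H : ℝ → Matrix (Fin n) (Fin n) ℝ} {H' G : Matrix (Fin n) (Fin n) ℝ}
    (hH : ∀ i j, HasDerivAt (fun t => H t i j) (H' i j) 0) {V : ℝ → ℝ} {V' : ℝ} (hV : HasDerivAt V V' 0)
    (hV0 : V 0 ≠ 0) (c : ℝ) (hdet : ∀ t, (1 + Complex.I • cx (H t)).det = V t * Complex.exp (c * Complex.I))
    (hG : (1 + H 0 * H 0) * G = 1) :
    Matrix.trace (G * H') = 0 ∧ V' = V 0 * Matrix.trace (H 0 * G * H') := by
  have hF : ∀ i j, HasDerivAt (fun t => (1 + Complex.I • cx (H t)) i j) ((Complex.I • cx H') i j) 0 := by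
    intro i j
    simp only [Matrix.add_apply, Matrix.smul_apply, RingHom.mapMatrix_apply, Matrix.map_apply, smul_eq_mul]
    apply HasDerivAt.const_add
    apply HasDerivAt.const_mul
    exact (hH i j).ofReal_comp
  have hd := hasDerivAt_det hF
  simp_rw [hdet] at hd
  have hd2 : HasDerivAt (fun t => (V t : ℂ) * Complex.exp (c * Complex.I)) (V' * Complex.exp (c * Complex.I)) 0 :=
    hV.ofReal_comp.mul_const _
  have e := hd2.unique hd
  set F := 1 + Complex.I • cx (H 0) with hFd
  set N := (1 - Complex.I • cx (H 0)) * cx G with hN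
  have hFN : F * N = 1 := by
    rw [hN, ← mul_assoc]
    have : F * (1 - Complex.I • cx (H 0)) = cx (1 + H 0 * H 0) := by
      rw [hFd, cx, cx, map_add, map_mul, map_one]
      rw [mul_sub, mul_one, add_mul, one_mul, smul_mul_smul_comm, Complex.I_mul_I]
      simp; abel
    rw [this, cx, cx, ← map_mul, hG, map_one]
  have hadj : F.adjugate = F.det • N := by
    calc F.adjugate = F.adjugate * (F * N) := by rw [hFN, mul_one]
      _ = _ := by rw [← mul_assoc, Matrix.adjugate_mul, smul_mul_assoc, one_mul]
  rw [hadj, hFd, hdet, smul_mul_assoc, Matrix.trace_smul, smul_eq_mul] at e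
  have hexp : Complex.exp (c * Complex.I) ≠ 0 := Complex.exp_ne_zero _
  have e2 : (V' : ℂ) = V 0 * (N * Complex.I • cx H').trace := by
    apply mul_right_cancel₀ hexp; rw [e]; ring
  have e3 : (N * Complex.I • cx H').trace = Complex.I * (Matrix.trace (G * H') : ℝ) + (Matrix.trace (H 0 * G * H') : ℝ) := by
    have q : ∀ A : Matrix (Fin n) (Fin n) ℝ, ((Matrix.trace A : ℝ) : ℂ) = (cx A).trace := by
      intro A; simp [Matrix.trace]
    rw [q, q, hN, mul_smul_comm, sub_mul, sub_mul, one_mul, smul_sub, smul_mul_assoc, smul_mul_assoc, smul_smul,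
      Complex.I_mul_I]
    simp only [cx, map_mul, Matrix.trace_sub, Matrix.trace_smul]
    simp
  rw [e3] at e2
  have hre := congrArg Complex.re e2
  have him := congrArg Complex.im e2
  simp at hre him
  exact ⟨him.resolve_left hV0, hre⟩

end SL
end Part12

section Part13
open scoped ContDiff
open MeasureTheory Metric

namespace SL
variable {n : ℕ}

/-- orthogonal matrix -/
structure Orth (Q : Matrix (Fin n) (Fin n) ℝ) : Prop where
  l : Q.transpose * Q = 1
  r : Q * Q.transpose = 1

/-- conjugated diagonal matrix -/
noncomputable def dg (Q : Matrix (Fin n) (Fin n) ℝ) (w : Fin n → ℝ) : Matrix (Fin n) (Fin n) ℝ :=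
  Q * Matrix.diagonal w * Q.transpose

lemma dg_apply (Q : Matrix (Fin n) (Fin n) ℝ) (w : Fin n → ℝ) (i j : Fin n) :
    dg Q w i j = ∑ r, w r * (Q i r * Q j r) := by
  unfold dg; rw [Matrix.mul_apply]
  refine Finset.sum_congr rfl fun r _ => ?_
  rw [Matrix.mul_diagonal, Matrix.transpose_apply]; ring

lemma dg_mul {Q : Matrix (Fin n) (Fin n) ℝ} (hQ : Orth Q) (w z : Fin n → ℝ) :
    dg Q w * dg Q z = dg Q (fun i => w i * z i) := by
  unfold dg
  calc _ = Q * Matrix.diagonal w * (Q.transpose * Q) * Matrix.diagonal z * Q.transpose := by simp only [mul_assoc]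
    _ = _ := by rw [hQ.l, mul_one, mul_assoc Q, Matrix.diagonal_mul_diagonal]

lemma dg_one {Q : Matrix (Fin n) (Fin n) ℝ} (hQ : Orth Q) : dg Q (fun _ => 1) = 1 := by
  unfold dg; rw [Matrix.diagonal_one, mul_one, hQ.r]

lemma dg_add (Q : Matrix (Fin n) (Fin n) ℝ) (w z : Fin n → ℝ) :
    dg Q w + dg Q z = dg Q (fun i => w i + z i) := by
  unfold dg; rw [← Matrix.diagonal_add, mul_add, add_mul]

lemma spec {H : Matrix (Fin n) (Fin n) ℝ} (hH : H.IsHermitian) :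
    ∃ Q, Orth Q ∧ H = dg Q hH.eigenvalues := by
  refine ⟨hH.eigenvectorUnitary, ⟨?_, ?_⟩, ?_⟩
  · have := Unitary.coe_star_mul_self hH.eigenvectorUnitary
    simpa [Matrix.star_eq_conjTranspose, Matrix.conjTranspose_eq_transpose_of_trivial] using this
  · have := Unitary.coe_mul_star_self hH.eigenvectorUnitary
    simpa [Matrix.star_eq_conjTranspose, Matrix.conjTranspose_eq_transpose_of_trivial] using this
  · have := hH.spectral_theorem
    conv_lhs => rw [this]
    rw [Unitary.conjStarAlgAut_apply, Matrix.star_eq_conjTranspose, Matrix.conjTranspose_eq_transpose_of_trivial]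
    rfl

/-- the inverse metric weights -/
noncomputable def gw (lam : Fin n → ℝ) (i : Fin n) : ℝ := (1 + lam i ^ 2)⁻¹

lemma gw_pos (lam : Fin n → ℝ) (i : Fin n) : 0 < gw lam i := by unfold gw; positivity
lemma gw_eq (lam : Fin n → ℝ) (i : Fin n) : (1 + lam i ^ 2) * gw lam i = 1 := by
  unfold gw; exact mul_inv_cancel₀ (by positivity)

lemma g_dg {Q : Matrix (Fin n) (Fin n) ℝ} (hQ : Orth Q) (lam : Fin n → ℝ) :
    1 + dg Q lam * dg Q lam = dg Q (fun i => 1 + lam i ^ 2) := by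
  rw [dg_mul hQ, ← dg_one hQ, dg_add]; simp only [sq]

lemma g_mul {Q : Matrix (Fin n) (Fin n) ℝ} (hQ : Orth Q) (lam : Fin n → ℝ) :
    (1 + dg Q lam * dg Q lam) * dg Q (gw lam) = 1 := by
  rw [g_dg hQ, dg_mul hQ]; simp_rw [gw_eq]; exact dg_one hQ

lemma g_inv {Q : Matrix (Fin n) (Fin n) ℝ} (hQ : Orth Q) (lam : Fin n → ℝ) :
    (1 + dg Q lam * dg Q lam)⁻¹ = dg Q (gw lam) := Matrix.inv_eq_right_inv (g_mul hQ lam)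

lemma det_dg {Q : Matrix (Fin n) (Fin n) ℝ} (hQ : Orth Q) (w : Fin n → ℝ) : (dg Q w).det = ∏ i, w i := by
  unfold dg
  rw [Matrix.det_mul, Matrix.det_mul, mul_right_comm, ← Matrix.det_mul, hQ.r, Matrix.det_one, one_mul, Matrix.det_diagonal]

lemma det_cx {Q : Matrix (Fin n) (Fin n) ℝ} (hQ : Orth Q) (lam : Fin n → ℝ) :
    (1 + Complex.I • cx (dg Q lam)).det = ∏ i, (1 + Complex.I * (lam i : ℂ)) := by
  have h1 : cx Q * cx Q.transpose = 1 := by rw [← map_mul, hQ.r, map_one]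
  have : 1 + Complex.I • cx (dg Q lam) = cx Q * Matrix.diagonal (fun i => 1 + Complex.I * (lam i : ℂ)) * cx Q.transpose := by
    have e : Matrix.diagonal (fun i => 1 + Complex.I * (lam i : ℂ)) = 1 + Complex.I • cx (Matrix.diagonal lam) := by
      ext i j
      by_cases h : i = j
      · subst h; simp
      · simp [h]
    rw [e, mul_add, add_mul, mul_one, h1, mul_smul_comm, smul_mul_assoc]
    unfold dg cx; rw [map_mul, map_mul]
  rw [this, Matrix.det_mul, Matrix.det_mul, mul_right_comm, ← Matrix.det_mul, h1, Matrix.det_one, one_mul, Matrix.det_diagonal]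

lemma one_add_I (t : ℝ) : (1 + Complex.I * (t : ℂ)) = (Real.sqrt (1 + t^2) : ℝ) * Complex.exp (Real.arctan t * Complex.I) := by
  have hs : 0 < Real.sqrt (1 + t^2) := Real.sqrt_pos.2 (by positivity)
  rw [Complex.exp_mul_I, ← Complex.ofReal_cos, ← Complex.ofReal_sin, Real.cos_arctan, Real.sin_arctan]
  apply Complex.ext
  · simp; field_simp
  · simp; field_simp

lemma det_vol {Q : Matrix (Fin n) (Fin n) ℝ} (hQ : Orth Q) (lam : Fin n → ℝ) {c : ℝ} (hc : ∑ i, Real.arctan (lam i) = c) :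
    (1 + Complex.I • cx (dg Q lam)).det =
      (Real.sqrt ((1 + dg Q lam * dg Q lam).det) : ℝ) * Complex.exp (c * Complex.I) := by
  rw [det_cx hQ, g_dg hQ, det_dg hQ, ← hc, Complex.ofReal_sum, Finset.sum_mul, Complex.exp_sum]
  simp_rw [one_add_I, Finset.prod_mul_distrib]
  rw [Real.sqrt_prod _ (fun i _ => by positivity)]
  push_cast; rfl

/-- rotated tensor -/
noncomputable def rot (Q : Matrix (Fin n) (Fin n) ℝ) (T : Fin n → Matrix (Fin n) (Fin n) ℝ) (r p q : Fin n) : ℝ :=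
  ∑ k, ∑ i, ∑ j, Q k r * Q i p * Q j q * T k i j

lemma rot_eq (Q : Matrix (Fin n) (Fin n) ℝ) (T : Fin n → Matrix (Fin n) (Fin n) ℝ) (r p q : Fin n) :
    rot Q T r p q = ∑ k, Q k r * (Q.transpose * T k * Q) p q := by
  unfold rot
  refine Finset.sum_congr rfl fun k _ => ?_
  simp only [Matrix.mul_apply, Matrix.transpose_apply, Finset.mul_sum, Finset.sum_mul]
  rw [Finset.sum_comm]
  refine Finset.sum_congr rfl fun i _ => Finset.sum_congr rfl fun j _ => by ring

lemma rot_symm23 (Q : Matrix (Fin n) (Fin n) ℝ) {T : Fin n → Matrix (Fin n) (Fin n) ℝ} (hT : ∀ k i j, T k i j = T k j i)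
    (r p q : Fin n) : rot Q T r p q = rot Q T r q p := by
  unfold rot
  refine Finset.sum_congr rfl fun k _ => ?_
  rw [Finset.sum_comm]
  refine Finset.sum_congr rfl fun i _ => Finset.sum_congr rfl fun j _ => by rw [hT]; ring

lemma rot_symm12 (Q : Matrix (Fin n) (Fin n) ℝ) {T : Fin n → Matrix (Fin n) (Fin n) ℝ} (hT : ∀ k i j, T k i j = T i k j)
    (r p q : Fin n) : rot Q T r p q = rot Q T p r q := by
  unfold rot
  rw [Finset.sum_comm]
  refine Finset.sum_congr rfl fun i _ => Finset.sum_congr rfl fun k _ => Finset.sum_congr rfl fun j _ => by rw [hT]; ring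

lemma tr_dg (Q : Matrix (Fin n) (Fin n) ℝ) (w : Fin n → ℝ) (A : Matrix (Fin n) (Fin n) ℝ) :
    (dg Q w * A).trace = ∑ p, w p * (Q.transpose * A * Q) p p := by
  unfold dg
  rw [mul_assoc, mul_assoc, Matrix.trace_mul_comm, mul_assoc, mul_assoc, Matrix.trace]
  simp

lemma tr_dg2 (Q : Matrix (Fin n) (Fin n) ℝ) (w z : Fin n → ℝ) (A B : Matrix (Fin n) (Fin n) ℝ) :
    (dg Q w * A * dg Q z * B).trace = ∑ p, ∑ q, w p * z q * ((Q.transpose * A * Q) p q * (Q.transpose * B * Q) q p) := by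
  rw [mul_assoc, mul_assoc, tr_dg]
  refine Finset.sum_congr rfl fun p _ => ?_
  have : Q.transpose * (A * (dg Q z * B)) * Q = (Q.transpose * A * Q) * (Matrix.diagonal z * (Q.transpose * B * Q)) := by
    unfold dg; simp only [mul_assoc]
  rw [this, Matrix.mul_apply, Finset.mul_sum]
  refine Finset.sum_congr rfl fun q _ => ?_
  rw [Matrix.diagonal_mul]; ring

lemma contr2 (Q : Matrix (Fin n) (Fin n) ℝ) (w : Fin n → ℝ) (α β : Fin n → ℝ) :
    ∑ k, ∑ l, dg Q w k l * (α k * β l) = ∑ r, w r * ((∑ k, Q k r * α k) * (∑ l, Q l r * β l)) := by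
  simp_rw [dg_apply, Finset.sum_mul, Finset.mul_sum]
  rw [Finset.sum_comm]
  conv_rhs => rw [Finset.sum_comm]
  rw [Finset.sum_comm]
  refine Finset.sum_congr rfl fun k _ => ?_
  rw [Finset.sum_comm]
  refine Finset.sum_congr rfl fun r _ => ?_
  refine Finset.sum_congr rfl fun l _ => ?_
  ring

/-- the basic contraction -/
lemma contr (Q : Matrix (Fin n) (Fin n) ℝ) {T : Fin n → Matrix (Fin n) (Fin n) ℝ} (hT : ∀ k i j, T k i j = T k j i)
    (w x y : Fin n → ℝ) :
    ∑ k, ∑ l, dg Q w k l * (dg Q x * T k * dg Q y * T l).trace =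
      ∑ r, ∑ p, ∑ q, w r * (x p * y q) * rot Q T r p q ^ 2 := by
  simp_rw [tr_dg2, Finset.mul_sum]
  have e1 : ∀ p q, ∑ k, ∑ l, dg Q w k l * (x p * y q * ((Q.transpose * T k * Q) p q * (Q.transpose * T l * Q) q p)) =
      ∑ r, w r * (x p * y q) * rot Q T r p q ^ 2 := by
    intro p q
    have := contr2 Q w (fun k => (Q.transpose * T k * Q) p q) (fun l => (Q.transpose * T l * Q) q p)
    simp_rw [← rot_eq] at this
    calc _ = (x p * y q) * ∑ k, ∑ l, dg Q w k l * ((Q.transpose * T k * Q) p q * (Q.transpose * T l * Q) q p) := by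
          simp_rw [Finset.mul_sum]
          refine Finset.sum_congr rfl fun k _ => Finset.sum_congr rfl fun l _ => by ring
      _ = _ := by
          rw [this, Finset.mul_sum]
          refine Finset.sum_congr rfl fun r _ => ?_
          rw [rot_symm23 Q hT r q p]; ring
  calc _ = ∑ p, ∑ q, ∑ k, ∑ l, dg Q w k l * (x p * y q * ((Q.transpose * T k * Q) p q * (Q.transpose * T l * Q) q p)) := by
        have s1 : ∀ F : Fin n → Fin n → Fin n → Fin n → ℝ, ∑ k, ∑ l, ∑ p, ∑ q, F k l p q = ∑ p, ∑ q, ∑ k, ∑ l, F k l p q := by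
          intro F
          calc _ = ∑ k, ∑ p, ∑ l, ∑ q, F k l p q := Finset.sum_congr rfl fun k _ => Finset.sum_comm
            _ = ∑ p, ∑ k, ∑ l, ∑ q, F k l p q := Finset.sum_comm
            _ = ∑ p, ∑ k, ∑ q, ∑ l, F k l p q := Finset.sum_congr rfl fun p _ => Finset.sum_congr rfl fun k _ => Finset.sum_comm
            _ = _ := Finset.sum_congr rfl fun p _ => Finset.sum_comm
        exact s1 _
    _ = ∑ p, ∑ q, ∑ r, w r * (x p * y q) * rot Q T r p q ^ 2 := by simp_rw [e1]
    _ = ∑ p, ∑ r, ∑ q, w r * (x p * y q) * rot Q T r p q ^ 2 := Finset.sum_congr rfl fun p _ => Finset.sum_comm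
    _ = _ := Finset.sum_comm

end SL
end Part13

section Part14
open scoped ContDiff
open MeasureTheory Metric

namespace SL
variable {n : ℕ}

/-- the pair-sum -/
def PP (a b c : ℝ) : ℝ := 3 + a * b + b * c + c * a

lemma sum3_cyc (F : Fin n → Fin n → Fin n → ℝ) : ∑ r, ∑ p, ∑ q, F r p q = ∑ r, ∑ p, ∑ q, F p q r := by
  calc _ = ∑ r, ∑ q, ∑ p, F r p q := Finset.sum_congr rfl fun p _ => Finset.sum_comm
    _ = ∑ q, ∑ r, ∑ p, F r p q := Finset.sum_comm
    _ = _ := rfl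

lemma symmz {h : Fin n → Fin n → Fin n → ℝ} (h23 : ∀ r p q, h r p q = h r q p) (h12 : ∀ r p q, h r p q = h p r q)
    (g lam : Fin n → ℝ) :
    ∑ r, ∑ p, ∑ q, g r * g p * g q * (1 - lam p * lam q + lam r * lam p + lam r * lam q) * h r p q ^ 2 =
    ∑ r, ∑ p, ∑ q, g r * g p * g q * (PP (lam r) (lam p) (lam q) / 3) * h r p q ^ 2 := by
  have hc : ∀ r p q, h p q r = h r p q := fun r p q => by rw [h23 p q r, h12 p r q]
  have hc2 : ∀ r p q, h q r p = h r p q := fun r p q => by rw [hc, hc]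
  have e1 : ∑ r, ∑ p, ∑ q, g r * g p * g q * (lam p * lam q) * h r p q ^ 2 =
      ∑ r, ∑ p, ∑ q, g p * g q * g r * (lam q * lam r) * h r p q ^ 2 := by
    rw [sum3_cyc]
    refine Finset.sum_congr rfl fun r _ => Finset.sum_congr rfl fun p _ => Finset.sum_congr rfl fun q _ => ?_
    rw [hc]
  have e2 : ∑ r, ∑ p, ∑ q, g p * g q * g r * (lam q * lam r) * h r p q ^ 2 =
      ∑ r, ∑ p, ∑ q, g q * g r * g p * (lam r * lam p) * h r p q ^ 2 := by
    rw [sum3_cyc]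
    refine Finset.sum_congr rfl fun r _ => Finset.sum_congr rfl fun p _ => Finset.sum_congr rfl fun q _ => ?_
    rw [hc]
  have k : ∀ r p q, g r * g p * g q * (1 - lam p * lam q + lam r * lam p + lam r * lam q) * h r p q ^ 2 =
      g r * g p * g q * (PP (lam r) (lam p) (lam q) / 3) * h r p q ^ 2
      + (2/3) * (g p * g q * g r * (lam q * lam r) * h r p q ^ 2)
      + (2/3) * (g q * g r * g p * (lam r * lam p) * h r p q ^ 2)
      - (4/3) * (g r * g p * g q * (lam p * lam q) * h r p q ^ 2) := by
    intro r p q; unfold PP; ring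
  simp_rw [k, Finset.sum_sub_distrib, Finset.sum_add_distrib, ← Finset.mul_sum]
  linarith

lemma PP_nonneg_aux {a b c : ℝ} (ha : 0 ≤ a) (hb : 0 ≤ b) (h1 : 0 ≤ 3 + a^2 + 2*a*c)
    (h2 : 0 ≤ 3 + b^2 + 2*b*c) (h3 : 0 ≤ 3 + c^2 + 2*c*a) (h4 : 0 ≤ 3 + c^2 + 2*c*b) : 0 ≤ PP a b c := by
  unfold PP
  wlog hab : b ≤ a generalizing a b
  · have := this hb ha h2 h1 h4 h3 (by linarith); linarith
  rcases le_total 0 c with hc | hc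
  · positivity
  obtain ⟨m, rfl⟩ : ∃ m, c = -m := ⟨-c, by ring⟩
  have hm : 0 ≤ m := by linarith
  rcases le_total m a with hma | hma
  · have hm3 : m^2 ≤ 3 := by nlinarith
    rcases le_total m b with hmb | hmb
    · nlinarith [mul_nonneg (sub_nonneg.2 hma) (sub_nonneg.2 hmb)]
    · nlinarith [mul_nonneg hb (sub_nonneg.2 hma)]
  · have ha3 : a^2 ≤ 3 := by nlinarith
    rcases ha.eq_or_lt with h0 | h0
    · have : b = 0 := by linarith
      subst this; rw [← h0]; norm_num
    · by_contra hcon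
      push Not at hcon
      have e : 2 * a * (3 + a * b + b * -m + -m * a) = (3 + a^2 + 2 * a * (-m)) * (a + b) + (a - b) * (3 - a^2) := by ring
      have : 0 ≤ 2 * a * (3 + a * b + b * -m + -m * a) := by
        rw [e]; apply add_nonneg
        · positivity
        · exact mul_nonneg (by linarith) (by linarith)
      nlinarith

lemma PP_nonneg_aux2 {a b c : ℝ} (hab : 0 ≤ a * b) (h1 : 0 ≤ 3 + a^2 + 2*a*c)
    (h2 : 0 ≤ 3 + b^2 + 2*b*c) (h3 : 0 ≤ 3 + c^2 + 2*c*a) (h4 : 0 ≤ 3 + c^2 + 2*c*b) : 0 ≤ PP a b c := by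
  rcases le_total 0 a with ha | ha <;> rcases le_total 0 b with hb | hb
  · exact PP_nonneg_aux ha hb h1 h2 h3 h4
  · rcases mul_eq_zero.1 (le_antisymm (mul_nonpos_of_nonneg_of_nonpos ha hb) hab) with h | h
    · subst h
      have := PP_nonneg_aux (a := 0) (b := -b) (c := -c) le_rfl (by linarith) (by linarith) (by linarith) (by linarith) (by linarith)
      unfold PP at *; linarith
    · subst h
      exact PP_nonneg_aux ha le_rfl h1 h2 h3 h4
  · rcases mul_eq_zero.1 (le_antisymm (mul_nonpos_of_nonpos_of_nonneg ha hb) hab) with h | h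
    · subst h
      exact PP_nonneg_aux le_rfl hb h1 h2 h3 h4
    · subst h
      have := PP_nonneg_aux (a := -a) (b := 0) (c := -c) (by linarith) le_rfl (by linarith) (by linarith) (by linarith) (by linarith)
      unfold PP at *; linarith
  · have := PP_nonneg_aux (a := -a) (b := -b) (c := -c) (by linarith) (by linarith) (by linarith) (by linarith) (by linarith) (by linarith)
    unfold PP at *; linarith

lemma some_pair (a b c : ℝ) : 0 ≤ a * b ∨ 0 ≤ b * c ∨ 0 ≤ c * a := by
  by_contra! h
  obtain ⟨h1, h2, h3⟩ := h
  nlinarith [mul_pos_of_neg_of_neg h1 h2, mul_self_nonneg b]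

lemma PP_nonneg {lam : Fin n → ℝ} {ε : ℝ} (hε : 0 < ε) (hc : ∀ i j, 0 ≤ 3 + (1 - ε) * lam i ^ 2 + 2 * lam i * lam j)
    (i j k : Fin n) : 0 ≤ PP (lam i) (lam j) (lam k) := by
  have hc' : ∀ i j, 0 ≤ 3 + lam i ^ 2 + 2 * lam i * lam j := fun i j => by
    have := hc i j; nlinarith [mul_nonneg hε.le (sq_nonneg (lam i))]
  rcases some_pair (lam i) (lam j) (lam k) with h | h | h
  · exact PP_nonneg_aux2 h (hc' _ _) (hc' _ _) (hc' _ _) (hc' _ _)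
  · have := PP_nonneg_aux2 (c := lam i) h (hc' _ _) (hc' _ _) (hc' _ _) (hc' _ _)
    unfold PP at *; linarith
  · have := PP_nonneg_aux2 (c := lam j) h (hc' _ _) (hc' _ _) (hc' _ _) (hc' _ _)
    unfold PP at *; linarith

lemma PP_pos {lam : Fin n → ℝ} {t : ℝ} (ht : 0 < t) (hc : ∀ i j, 0 ≤ 3 - t * lam i ^ 2 + 2 * lam i * lam j)
    (i j k : Fin n) : 3 * t / (t + 2) ≤ PP (lam i) (lam j) (lam k) := by
  have key : ∀ i j k, 0 ≤ lam i * lam j → 3 * t ≤ PP (lam i) (lam j) (lam k) * (t + 2) := by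
    intro i j k h
    have h1 := hc i k
    have h2 := hc k i
    have h3 := hc j k
    have h4 := hc k j
    have p1 : t / 4 * (lam i^2 + lam j^2 + 2 * lam k^2) ≤ PP (lam i) (lam j) (lam k) := by unfold PP; linarith
    have p2 : 3 - (lam i^2 + lam j^2 + 2 * lam k^2) / 2 ≤ PP (lam i) (lam j) (lam k) := by
      unfold PP; nlinarith [sq_nonneg (lam i + lam k), sq_nonneg (lam j + lam k)]
    nlinarith [mul_le_mul_of_nonneg_left p2 ht.le]
  rw [div_le_iff₀ (by linarith)]
  rcases some_pair (lam i) (lam j) (lam k) with h | h | h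
  · exact key _ _ _ h
  · have := key _ _ i h
    have e : PP (lam j) (lam k) (lam i) = PP (lam i) (lam j) (lam k) := by unfold PP; ring
    rwa [e] at this
  · have := key _ _ j h
    have e : PP (lam k) (lam i) (lam j) = PP (lam i) (lam j) (lam k) := by unfold PP; ring
    rwa [e] at this

lemma ptw {h : Fin n → Fin n → Fin n → ℝ} (h23 : ∀ r p q, h r p q = h r q p) (h12 : ∀ r p q, h r p q = h p r q)
    {lam g : Fin n → ℝ} (hg : ∀ i, 0 < g i) {ε : ℝ} (hn : 0 < n) (hε : 0 < ε) (hε1 : ε ≤ 1)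
    (hc : ∀ i j, 0 ≤ 3 + (1 - ε) * lam i ^ 2 + 2 * lam i * lam j) :
    ε / n * ∑ r, g r * (∑ p, lam p * g p * h r p p) ^ 2 ≤
    ∑ r, ∑ p, ∑ q, g r * g p * g q * (PP (lam r) (lam p) (lam q) / 3) * h r p q ^ 2 := by
  set W : Fin n → Fin n → Fin n → ℝ := fun r p q => g r * g p * g q * (PP (lam r) (lam p) (lam q) / 3) * h r p q ^ 2 with hW
  have hW0 : ∀ r p q, 0 ≤ W r p q := by
    intro r p q
    have := PP_nonneg hε hc r p q
    have := hg r; have := hg p; have := hg q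
    simp only [hW]; positivity
  have hn' : (0:ℝ) < n := by exact_mod_cast hn
  have s1 : ε / n * ∑ r, g r * (∑ p, lam p * g p * h r p p) ^ 2 ≤ ∑ r, ∑ p, ε * (g r * (lam p * g p * h r p p) ^ 2) := by
    rw [Finset.mul_sum]
    refine Finset.sum_le_sum fun r _ => ?_
    have := sq_sum_le_card_mul_sum_sq (s := Finset.univ) (f := fun p => lam p * g p * h r p p)
    simp only [Finset.card_univ, Fintype.card_fin] at this
    calc _ ≤ ε / n * (g r * (n * ∑ p, (lam p * g p * h r p p) ^ 2)) := by
          have := hg r; gcongr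
      _ = _ := by
          simp_rw [← Finset.mul_sum]; field_simp
  refine s1.trans ?_
  have s2 : ∀ r p, ε * (g r * (lam p * g p * h r p p) ^ 2) ≤ 3 * W r p p - 2 * (if r = p then W r p p else 0) := by
    intro r p
    have gr := hg r; have gp := hg p
    split_ifs with e
    · subst e
      have k1 : 0 ≤ g r ^ 3 * h r r r ^ 2 := by positivity
      have e2 : 0 ≤ (1 - ε) * lam r^2 := mul_nonneg (by linarith) (sq_nonneg _)
      have e3 : 3 * W r r r - 2 * W r r r - ε * (g r * (lam r * g r * h r r r) ^ 2)
        = g r ^ 3 * h r r r ^ 2 * (1 + (1 - ε) * lam r ^2) := by simp only [hW]; unfold PP; ring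
      have := mul_nonneg k1 (by linarith : 0 ≤ 1 + (1 - ε) * lam r ^2)
      linarith
    · have k1 : 0 ≤ g r * g p ^ 2 * h r p p ^ 2 := by positivity
      have e3 : 3 * W r p p - 2 * 0 - ε * (g r * (lam p * g p * h r p p) ^ 2)
        = g r * g p ^ 2 * h r p p ^ 2 * (3 + (1 - ε) * lam p ^ 2 + 2 * lam p * lam r) := by simp only [hW]; unfold PP; ring
      have := mul_nonneg k1 (hc p r)
      linarith
  have hc1 : ∀ r p q, h p q r = h r p q := fun r p q => by rw [h23 p q r, h12 p r q]
  have Wc : ∀ r p q, W p q r = W r p q := by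
    intro r p q; simp only [hW, hc1 r p q]; unfold PP; ring
  have hs : ∀ r p q, W r p q * ((if p = q then 1 else 0) + (if r = p then 1 else 0) + (if q = r then 1 else 0)
      - 2 * (if r = p then if p = q then 1 else 0 else 0)) ≤ W r p q := by
    intro r p q
    have := hW0 r p q
    have e : ((if p = q then 1 else 0) + (if r = p then 1 else 0) + (if q = r then 1 else 0)
      - 2 * (if r = p then if p = q then 1 else 0 else 0) : ℝ) ≤ 1 := by
      by_cases a1 : p = q
      · subst a1
        by_cases a2 : r = p
        · subst a2; norm_num
        · have a3 : ¬ p = r := fun e => a2 e.symm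
          simp [a2, a3]
      · by_cases a2 : r = p
        · subst a2
          have a3 : ¬ q = r := fun e => a1 e.symm
          simp [a1, a3]
        · simp only [a1, a2, if_false]
          split_ifs <;> norm_num
    nlinarith
  have t1 : ∑ r, ∑ p, ∑ q, W r p q * (if p = q then 1 else 0) = ∑ r, ∑ p, W r p p := by simp
  have t2 : ∑ r, ∑ p, ∑ q, W r p q * (if q = r then 1 else 0) = ∑ r, ∑ p, W r p p := by
    rw [sum3_cyc, sum3_cyc, ← t1]
    refine Finset.sum_congr rfl fun r _ => Finset.sum_congr rfl fun p _ => Finset.sum_congr rfl fun q _ => ?_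
    rw [← Wc, ← Wc]
  have t3 : ∑ r, ∑ p, ∑ q, W r p q * (if r = p then 1 else 0) = ∑ r, ∑ p, W r p p := by
    rw [sum3_cyc, ← t1]
    refine Finset.sum_congr rfl fun r _ => Finset.sum_congr rfl fun p _ => Finset.sum_congr rfl fun q _ => ?_
    rw [Wc]
  have t4 : ∑ r, ∑ p, ∑ q, W r p q * (if r = p then if p = q then 1 else 0 else 0) = ∑ r, ∑ p, (if r = p then W r p p else 0) := by
    refine Finset.sum_congr rfl fun r _ => Finset.sum_congr rfl fun p _ => ?_
    split_ifs <;> simp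
  calc _ ≤ ∑ r, ∑ p, (3 * W r p p - 2 * (if r = p then W r p p else 0)) :=
        Finset.sum_le_sum fun r _ => Finset.sum_le_sum fun p _ => s2 r p
    _ = ∑ r, ∑ p, ∑ q, W r p q * ((if p = q then 1 else 0) + (if r = p then 1 else 0) + (if q = r then 1 else 0)
      - 2 * (if r = p then if p = q then 1 else 0 else 0)) := by
        have e : ∀ r p q, W r p q * ((if p = q then 1 else 0) + (if r = p then 1 else 0) + (if q = r then 1 else 0)
          - 2 * (if r = p then if p = q then 1 else 0 else 0)) = W r p q * (if p = q then 1 else 0)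
          + W r p q * (if r = p then 1 else 0) + W r p q * (if q = r then 1 else 0)
          - 2 * (W r p q * (if r = p then if p = q then 1 else 0 else 0)) := fun r p q => by ring
        simp_rw [e, Finset.sum_sub_distrib, Finset.sum_add_distrib, ← Finset.mul_sum, t1, t2, t3, t4]
        ring
    _ ≤ _ := Finset.sum_le_sum fun r _ => Finset.sum_le_sum fun p _ => Finset.sum_le_sum fun q _ => hs r p q

/-- lower bound in the strict case -/
lemma ptw2 {h : Fin n → Fin n → Fin n → ℝ} {lam : Fin n → ℝ} {t Λ : ℝ} (ht : 0 < t)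
    (hL : ∀ i, |lam i| ≤ Λ)
    (hc : ∀ i j, 0 ≤ 3 - t * lam i ^ 2 + 2 * lam i * lam j) :
    t / (t + 2) * ((1 + Λ^2)⁻¹)^3 * ∑ r, ∑ p, ∑ q, h r p q ^ 2 ≤
    ∑ r, ∑ p, ∑ q, gw lam r * gw lam p * gw lam q * (PP (lam r) (lam p) (lam q) / 3) * h r p q ^ 2 := by
  have hg : ∀ i, (1 + Λ^2)⁻¹ ≤ gw lam i := by
    intro i; unfold gw
    have := sq_le_sq' (abs_le.1 (hL i)).1 (abs_le.1 (hL i)).2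
    gcongr
  simp_rw [Finset.mul_sum]
  refine Finset.sum_le_sum fun r _ => Finset.sum_le_sum fun p _ => Finset.sum_le_sum fun q _ => ?_
  have h1 : t / (t + 2) ≤ PP (lam r) (lam p) (lam q) / 3 := by
    have := PP_pos ht hc r p q
    have e : 3 * t / (t + 2) = 3 * (t / (t + 2)) := by ring
    rw [e] at this; linarith
  have a1 := hg r; have a2 := hg p; have a3 := hg q
  calc _ = (1 + Λ^2)⁻¹ * (1 + Λ^2)⁻¹ * (1 + Λ^2)⁻¹ * (t / (t+2)) * h r p q ^ 2 := by ring
    _ ≤ _ := by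
      have := gw_pos lam r; have := gw_pos lam p; have := gw_pos lam q
      gcongr

end SL
end Part14

section Part15
open scoped ContDiff
open MeasureTheory Metric

namespace SL
variable {n : ℕ} {E : Type*} [NormedAddCommGroup E] [NormedSpace ℝ E]

/-- entrywise smooth matrix functions -/
def SM (F : E → Matrix (Fin n) (Fin n) ℝ) : Prop := ∀ i j, ContDiff ℝ ∞ (fun y => F y i j)

lemma SM.mul {F G : E → Matrix (Fin n) (Fin n) ℝ} (hF : SM F) (hG : SM G) : SM (fun y => F y * G y) := by
  intro i j; simp only [Matrix.mul_apply]
  exact ContDiff.sum fun k _ => (hF i k).mul (hG k j)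

lemma SM.add {F G : E → Matrix (Fin n) (Fin n) ℝ} (hF : SM F) (hG : SM G) : SM (fun y => F y + G y) := by
  intro i j; simp only [Matrix.add_apply]; exact (hF i j).add (hG i j)

lemma SM.const (A : Matrix (Fin n) (Fin n) ℝ) : SM (fun _ : E => A) := fun _ _ => contDiff_const

lemma SM.transpose {F : E → Matrix (Fin n) (Fin n) ℝ} (hF : SM F) : SM (fun y => (F y).transpose) :=
  fun i j => hF j i

lemma SM.det {F : E → Matrix (Fin n) (Fin n) ℝ} (hF : SM F) : ContDiff ℝ ∞ (fun y => (F y).det) := by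
  simp_rw [Matrix.det_apply']
  exact ContDiff.sum fun σ _ => contDiff_const.mul (contDiff_prod fun i _ => hF _ _)

lemma SM.trace {F : E → Matrix (Fin n) (Fin n) ℝ} (hF : SM F) : ContDiff ℝ ∞ (fun y => (F y).trace) := by
  simp_rw [Matrix.trace, Matrix.diag]
  exact ContDiff.sum fun i _ => hF i i

lemma SM.inv {F : E → Matrix (Fin n) (Fin n) ℝ} (hF : SM F) (h0 : ∀ y, (F y).det ≠ 0) : SM (fun y => (F y)⁻¹) := by
  intro i j
  have e : ∀ y, (F y)⁻¹ i j = ((F y).det)⁻¹ * ((F y).updateRow j (Pi.single i 1)).det := by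
    intro y
    rw [Matrix.inv_def, Ring.inverse_eq_inv', Matrix.smul_apply, Matrix.adjugate_apply, smul_eq_mul]
  simp_rw [e]
  refine (hF.det.inv h0).mul (SM.det (F := fun y => (F y).updateRow j (Pi.single i 1)) ?_)
  intro k l
  by_cases h : k = j
  · subst h; simp only [Matrix.updateRow_self]; exact contDiff_const
  · simp only [Matrix.updateRow_ne h]; exact hF k l

/-- entrywise derivative -/
noncomputable def pdM (k : Fin n) (F : Eu n → Matrix (Fin n) (Fin n) ℝ) (x : Eu n) : Matrix (Fin n) (Fin n) ℝ :=
  Matrix.of fun i j => pd k (fun y => F y i j) x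

lemma SM.da {F : Eu n → Matrix (Fin n) (Fin n) ℝ} (hF : SM F) (i j : Fin n) (x : Eu n) :
    DifferentiableAt ℝ (fun y => F y i j) x := cd (hF i j) (by simp) x

lemma pdM_mul (k : Fin n) {F G : Eu n → Matrix (Fin n) (Fin n) ℝ} (hF : SM F) (hG : SM G) (x : Eu n) :
    pdM k (fun y => F y * G y) x = pdM k F x * G x + F x * pdM k G x := by
  ext i j
  simp only [pdM, Matrix.of_apply, Matrix.add_apply, Matrix.mul_apply]
  rw [pd_sum k fun l _ => (hF.da i l x).fun_mul (hG.da l j x), ← Finset.sum_add_distrib]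
  exact Finset.sum_congr rfl fun l _ => pd_mul k (hF.da i l x) (hG.da l j x)

lemma pdM_add (k : Fin n) {F G : Eu n → Matrix (Fin n) (Fin n) ℝ} (hF : SM F) (hG : SM G) (x : Eu n) :
    pdM k (fun y => F y + G y) x = pdM k F x + pdM k G x := by
  ext i j
  simp only [pdM, Matrix.of_apply, Matrix.add_apply]
  exact pd_add k (hF.da i j x) (hG.da i j x)

lemma pdM_const (k : Fin n) (A : Matrix (Fin n) (Fin n) ℝ) (x : Eu n) : pdM k (fun _ => A) x = 0 := by
  ext i j; simp only [pdM, Matrix.of_apply, Matrix.zero_apply]; exact pd_const k _ x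

lemma pd_trace (k : Fin n) {F : Eu n → Matrix (Fin n) (Fin n) ℝ} (hF : SM F) (x : Eu n) :
    pd k (fun y => (F y).trace) x = (pdM k F x).trace := by
  simp only [Matrix.trace, Matrix.diag, pdM, Matrix.of_apply]
  exact pd_sum k fun i _ => hF.da i i x

lemma pdM_inv (k : Fin n) {F : Eu n → Matrix (Fin n) (Fin n) ℝ} (hF : SM F) (h0 : ∀ y, (F y).det ≠ 0) (x : Eu n) :
    pdM k (fun y => (F y)⁻¹) x = - ((F x)⁻¹ * pdM k F x * (F x)⁻¹) := by
  have hu : ∀ y, IsUnit (F y).det := fun y => isUnit_iff_ne_zero.2 (h0 y)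
  have h1 := pdM_mul k hF (hF.inv h0) x
  have e : (fun y => F y * (F y)⁻¹) = fun _ => 1 := by ext1 y; exact Matrix.mul_nonsing_inv _ (hu y)
  rw [e, pdM_const] at h1
  have h2 : F x * pdM k (fun y => (F y)⁻¹) x = - (pdM k F x * (F x)⁻¹) := by
    rw [eq_neg_iff_add_eq_zero, add_comm]; exact h1.symm
  calc _ = (F x)⁻¹ * (F x * pdM k (fun y => (F y)⁻¹) x) := by
        rw [← mul_assoc, Matrix.nonsing_inv_mul _ (hu x), one_mul]
    _ = _ := by rw [h2, mul_neg, mul_assoc]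

lemma pd_line {f : Eu n → ℝ} {x : Eu n} (hf : DifferentiableAt ℝ f x) (k : Fin n) :
    HasDerivAt (fun t : ℝ => f (x + t • EuclideanSpace.single k (1:ℝ))) (pd k f x) 0 := by
  have h1 : HasDerivAt (fun t : ℝ => x + t • EuclideanSpace.single k (1:ℝ)) (EuclideanSpace.single k (1:ℝ)) 0 := by
    simpa using ((hasDerivAt_id (0:ℝ)).smul_const (EuclideanSpace.single k (1:ℝ))).const_add x
  have h2 : HasFDerivAt f (fderiv ℝ f x) (x + (0:ℝ) • EuclideanSpace.single k (1:ℝ)) := by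
    simpa using hf.hasFDerivAt
  exact h2.comp_hasDerivAt (0:ℝ) h1

/-- the standing assumptions -/
structure Sol (u : Eu n → ℝ) (c : ℝ) (lam : Eu n → Fin n → ℝ) : Prop where
  hu : ContDiff ℝ ∞ u
  sp : ∀ x, ∃ Q, Orth Q ∧ Hess u x = dg Q (lam x)
  hc : ∀ x, ∑ i, Real.arctan (lam x i) = c

/-- third derivatives -/
noncomputable def T3 (u : Eu n → ℝ) (k : Fin n) (x : Eu n) : Matrix (Fin n) (Fin n) ℝ := pdM k (Hess u) x

variable {u : Eu n → ℝ} {c : ℝ} {lam : Eu n → Fin n → ℝ}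

namespace Sol

lemma H_apply (S : Sol u c lam) (i j : Fin n) (x : Eu n) : Hess u x i j = pd i (pd j u) x :=
  hess_eq (S.hu.of_le two_le_inf) i j x

lemma H_fun (S : Sol u c lam) (i j : Fin n) : (fun x => Hess u x i j) = pd i (pd j u) := by
  ext x; exact S.H_apply i j x

lemma smH (S : Sol u c lam) : SM (Hess u) := by
  intro i j; rw [S.H_fun]; exact pd_smooth i (pd_smooth j S.hu)

lemma H_symm (S : Sol u c lam) (i j : Fin n) (x : Eu n) : Hess u x i j = Hess u x j i := by
  rw [S.H_apply, S.H_apply, pd_comm S.hu]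

lemma T_apply (S : Sol u c lam) (k i j : Fin n) (x : Eu n) : T3 u k x i j = pd k (pd i (pd j u)) x := by
  unfold T3 pdM; rw [Matrix.of_apply, S.H_fun]

lemma T_fun (S : Sol u c lam) (k i j : Fin n) : (fun x => T3 u k x i j) = pd k (pd i (pd j u)) := by
  ext x; exact S.T_apply k i j x

lemma smT (S : Sol u c lam) (k : Fin n) : SM (T3 u k) := by
  intro i j; rw [S.T_fun]; exact pd_smooth k (pd_smooth i (pd_smooth j S.hu))

lemma T12 (S : Sol u c lam) (x : Eu n) (k i j : Fin n) : T3 u k x i j = T3 u i x k j := by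
  rw [S.T_apply, S.T_apply, pd_comm (pd_smooth j S.hu)]

lemma T23 (S : Sol u c lam) (x : Eu n) (k i j : Fin n) : T3 u k x i j = T3 u k x j i := by
  rw [S.T_apply, S.T_apply]
  congr 1; ext y; exact pd_comm S.hu i j y

lemma det_eq (S : Sol u c lam) (x : Eu n) : (gMat u x).det = ∏ i, (1 + lam x i ^ 2) := by
  obtain ⟨Q, hQ, h⟩ := S.sp x
  unfold gMat; rw [h, g_dg hQ, det_dg hQ]

lemma one_le_det (S : Sol u c lam) (x : Eu n) : 1 ≤ (gMat u x).det := by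
  rw [S.det_eq]
  calc (1:ℝ) = ∏ i : Fin n, 1 := by simp
    _ ≤ _ := Finset.prod_le_prod (fun _ _ => zero_le_one) fun i _ => by nlinarith [sq_nonneg (lam x i)]

lemma det_ne (S : Sol u c lam) (x : Eu n) : (gMat u x).det ≠ 0 := by linarith [S.one_le_det x]

lemma smg (S : Sol u c lam) : SM (gMat u) := (SM.const 1).add (S.smH.mul S.smH)

lemma smG (S : Sol u c lam) : SM (fun y => (gMat u y)⁻¹) := S.smg.inv S.det_ne

lemma one_le_V (S : Sol u c lam) (x : Eu n) : 1 ≤ Vol u x := by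
  unfold Vol; exact Real.one_le_sqrt.2 (S.one_le_det x)

lemma smV (S : Sol u c lam) : ContDiff ℝ ∞ (Vol u) := S.smg.det.sqrt S.det_ne

lemma smL (S : Sol u c lam) : ContDiff ℝ ∞ (fun y => Real.log (Vol u y)) :=
  S.smV.log fun x => by linarith [S.one_le_V x]

lemma g_mul' (S : Sol u c lam) (x : Eu n) : gMat u x * (gMat u x)⁻¹ = 1 :=
  Matrix.mul_nonsing_inv _ (isUnit_iff_ne_zero.2 (S.det_ne x))

lemma first (S : Sol u c lam) (k : Fin n) (x : Eu n) :
    ((gMat u x)⁻¹ * T3 u k x).trace = 0 ∧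
    pd k (Vol u) x = Vol u x * (Hess u x * (gMat u x)⁻¹ * T3 u k x).trace := by
  have hx : x + (0:ℝ) • EuclideanSpace.single k (1:ℝ) = x := by simp
  have := logder (H := fun t : ℝ => Hess u (x + t • EuclideanSpace.single k (1:ℝ))) (H' := T3 u k x) (G := (gMat u x)⁻¹)
    (V := fun t : ℝ => Vol u (x + t • EuclideanSpace.single k (1:ℝ))) (V' := pd k (Vol u) x)
    (fun i j => by
      have := pd_line (S.smH.da i j x) k
      exact this) (pd_line (cd S.smV (by simp) x) k) (by rw [hx]; linarith [S.one_le_V x]) c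
    (fun t => by
      obtain ⟨Q, hQ, h⟩ := S.sp (x + t • EuclideanSpace.single k (1:ℝ))
      unfold Vol gMat
      rw [h]; exact det_vol hQ _ (S.hc _)) (by rw [hx]; exact S.g_mul' x)
  simpa only [hx] using this

lemma pdL (S : Sol u c lam) (k : Fin n) (x : Eu n) :
    pd k (fun y => Real.log (Vol u y)) x = (Hess u x * (gMat u x)⁻¹ * T3 u k x).trace := by
  have hV := S.one_le_V x
  rw [pd_comp (g := Real.log) k (Real.hasDerivAt_log (by linarith)) (cd S.smV (by simp) x), (S.first k x).2]
  field_simp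

lemma pdg (S : Sol u c lam) (k : Fin n) (x : Eu n) :
    pdM k (gMat u) x = T3 u k x * Hess u x + Hess u x * T3 u k x := by
  have := pdM_add k (SM.const 1) (S.smH.mul S.smH) x
  rw [pdM_const, zero_add, pdM_mul k S.smH S.smH] at this
  exact this

lemma pdG (S : Sol u c lam) (k : Fin n) (x : Eu n) :
    pdM k (fun y => (gMat u y)⁻¹) x =
      - ((gMat u x)⁻¹ * (T3 u k x * Hess u x + Hess u x * T3 u k x) * (gMat u x)⁻¹) := by
  rw [pdM_inv k S.smg S.det_ne, S.pdg]

/-- second trace identity -/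
lemma second (S : Sol u c lam) (k l : Fin n) (x : Eu n) :
    ((gMat u x)⁻¹ * pdM k (T3 u l) x).trace =
      ((gMat u x)⁻¹ * (T3 u k x * Hess u x + Hess u x * T3 u k x) * (gMat u x)⁻¹ * T3 u l x).trace := by
  have h1 := pd_trace k (S.smG.mul (S.smT l)) x
  have e : (fun y => ((gMat u y)⁻¹ * T3 u l y).trace) = fun _ => 0 := by ext y; exact (S.first l y).1
  rw [e, pd_const, pdM_mul k S.smG (S.smT l), S.pdG, Matrix.trace_add, neg_mul, Matrix.trace_neg] at h1
  linarith

lemma T4 (S : Sol u c lam) (x : Eu n) (k l i j : Fin n) : pdM k (T3 u l) x i j = pdM i (T3 u j) x k l := by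
  have e : ∀ k l i j, pdM k (T3 u l) x i j = pd k (pd l (pd i (pd j u))) x := by
    intro k l i j; unfold pdM; rw [Matrix.of_apply, S.T_fun]
  have c0 : ∀ k l, pd k (pd l u) = pd l (pd k u) := fun k l => by ext y; exact pd_comm S.hu k l y
  have c1 : ∀ k l j, pd k (pd l (pd j u)) = pd l (pd k (pd j u)) := fun k l j => by ext y; exact pd_comm (pd_smooth j S.hu) k l y
  have c2 : ∀ k l i j, pd k (pd l (pd i (pd j u))) x = pd l (pd k (pd i (pd j u))) x :=
    fun k l i j => pd_comm (pd_smooth i (pd_smooth j S.hu)) k l x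
  rw [e, e]
  -- k l i j = i j k l
  rw [c1 l i j, c2 k i l j, c0 l j, c1 k j l]

lemma T4s (S : Sol u c lam) (x : Eu n) (k l i j : Fin n) : pdM k (T3 u l) x i j = pdM l (T3 u k) x j i := by
  have e : ∀ k l i j, pdM k (T3 u l) x i j = pd k (pd l (pd i (pd j u))) x := by
    intro k l i j; unfold pdM; rw [Matrix.of_apply, S.T_fun]
  have c0 : ∀ k l, pd k (pd l u) = pd l (pd k u) := fun k l => by ext y; exact pd_comm S.hu k l y
  rw [e, e, c0 i j]
  exact pd_comm (pd_smooth j (pd_smooth i S.hu)) k l x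

lemma G_symm (S : Sol u c lam) (x : Eu n) (i j : Fin n) : (gMat u x)⁻¹ i j = (gMat u x)⁻¹ j i := by
  obtain ⟨Q, hQ, h⟩ := S.sp x
  unfold gMat; rw [h, g_inv hQ, dg_apply, dg_apply]
  exact Finset.sum_congr rfl fun r _ => by ring

lemma pdpdL (S : Sol u c lam) (k l : Fin n) (x : Eu n) :
    pd k (pd l (fun y => Real.log (Vol u y))) x =
      ((T3 u k x * (gMat u x)⁻¹ - Hess u x * ((gMat u x)⁻¹ * (T3 u k x * Hess u x + Hess u x * T3 u k x) * (gMat u x)⁻¹)) * T3 u l x).trace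
      + (Hess u x * (gMat u x)⁻¹ * pdM k (T3 u l) x).trace := by
  have e : pd l (fun y => Real.log (Vol u y)) = fun x => (Hess u x * (gMat u x)⁻¹ * T3 u l x).trace := by
    ext y; exact S.pdL l y
  rw [e, pd_trace k ((S.smH.mul S.smG).mul (S.smT l)), pdM_mul k (S.smH.mul S.smG) (S.smT l), pdM_mul k S.smH S.smG,
    S.pdG, Matrix.trace_add, mul_neg, ← sub_eq_add_neg]
  rfl

/-- the Laplacian of log V in matrix form -/
lemma lapL (S : Sol u c lam) (x : Eu n) :
    ∑ k, ∑ l, (gMat u x)⁻¹ k l * pd k (pd l (fun y => Real.log (Vol u y))) x =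
    ∑ k, ∑ l, (gMat u x)⁻¹ k l * ((T3 u k x * (gMat u x)⁻¹ - Hess u x * ((gMat u x)⁻¹ * (T3 u k x * Hess u x + Hess u x * T3 u k x) * (gMat u x)⁻¹)) * T3 u l x).trace
    + ∑ k, ∑ l, (Hess u x * (gMat u x)⁻¹) k l *
      ((gMat u x)⁻¹ * (T3 u k x * Hess u x + Hess u x * T3 u k x) * (gMat u x)⁻¹ * T3 u l x).trace := by
  have sp : ∀ g X Y : Fin n → Fin n → ℝ, ∑ k, ∑ l, g k l * (X k l + Y k l) = ∑ k, ∑ l, g k l * X k l + ∑ k, ∑ l, g k l * Y k l := by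
    intro g X Y; simp_rw [mul_add, Finset.sum_add_distrib]
  simp_rw [S.pdpdL]
  refine (sp (fun k l => (gMat u x)⁻¹ k l) _ _).trans ?_
  congr 1
  simp_rw [← S.second]
  have tr : ∀ A B : Matrix (Fin n) (Fin n) ℝ, (A * B).trace = ∑ a, ∑ b, A a b * B b a := fun A B => by
    simp [Matrix.trace, Matrix.mul_apply]
  set A := Hess u x * (gMat u x)⁻¹
  set G := (gMat u x)⁻¹
  simp_rw [tr, Finset.mul_sum]
  -- LHS: G k l * (A a b * D k l b a); RHS: A k l * (G a b * D k l b a)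
  have s1 : ∀ F : Fin n → Fin n → Fin n → Fin n → ℝ, ∑ k, ∑ l, ∑ p, ∑ q, F k l p q = ∑ p, ∑ q, ∑ k, ∑ l, F k l p q := by
    intro F
    calc _ = ∑ k, ∑ p, ∑ l, ∑ q, F k l p q := Finset.sum_congr rfl fun k _ => Finset.sum_comm
      _ = ∑ p, ∑ k, ∑ l, ∑ q, F k l p q := Finset.sum_comm
      _ = ∑ p, ∑ k, ∑ q, ∑ l, F k l p q := Finset.sum_congr rfl fun p _ => Finset.sum_congr rfl fun k _ => Finset.sum_comm
      _ = _ := Finset.sum_congr rfl fun p _ => Finset.sum_comm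
  rw [s1]
  refine Finset.sum_congr rfl fun k _ => Finset.sum_congr rfl fun l _ => ?_
  refine Finset.sum_congr rfl fun a _ => Finset.sum_congr rfl fun b _ => ?_
  have e1 : pdM a (T3 u b) x l k = pdM k (T3 u l) x b a := by
    rw [S.T4, S.T4s]
  rw [e1]; ring

end Sol
end SL
end Part15

section Part16
open scoped ContDiff
open MeasureTheory Metric

namespace SL
variable {n : ℕ} {u : Eu n → ℝ} {c : ℝ} {lam : Eu n → Fin n → ℝ}
namespace Sol

lemma lapL_diag (S : Sol u c lam) (x : Eu n) {Q : Matrix (Fin n) (Fin n) ℝ} (hQ : Orth Q) (h : Hess u x = dg Q (lam x)) :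
    ∑ k, ∑ l, (gMat u x)⁻¹ k l * pd k (pd l (fun y => Real.log (Vol u y))) x =
    ∑ r, ∑ p, ∑ q, gw (lam x) r * gw (lam x) p * gw (lam x) q * (PP (lam x r) (lam x p) (lam x q) / 3)
      * rot Q (fun k => T3 u k x) r p q ^ 2 := by
  have hT : ∀ k i j, T3 u k x i j = T3 u k x j i := S.T23 x
  rw [← symmz (fun r p q => rot_symm23 Q (T := fun k => T3 u k x) (S.T23 x) r p q)
    (fun r p q => rot_symm12 Q (T := fun k => T3 u k x) (S.T12 x) r p q) (gw (lam x)) (lam x)]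
  rw [S.lapL]
  have hG : (gMat u x)⁻¹ = dg Q (gw (lam x)) := by unfold gMat; rw [h, g_inv hQ]
  rw [hG, h]
  generalize lam x = lm at *
  set T := fun k => T3 u k x with hTd
  have e1 : ∀ k l, ((T k * dg Q (gw lm) - dg Q lm * (dg Q (gw lm) * (T k * dg Q lm + dg Q lm * T k) * dg Q (gw lm))) * T l).trace
      = (dg Q (fun _ => 1) * T k * dg Q (gw lm) * T l).trace
        - (dg Q (fun i => lm i * gw lm i) * T k * dg Q (fun i => lm i * gw lm i) * T l).trace
        - (dg Q (fun i => lm i * gw lm i * lm i) * T k * dg Q (gw lm) * T l).trace := by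
    intro k l
    rw [← Matrix.trace_sub, ← Matrix.trace_sub]
    congr 1
    rw [← dg_mul hQ (fun i => lm i * gw lm i) lm, ← dg_mul hQ lm (gw lm), dg_one hQ]
    noncomm_ring
  have e2 : ∀ k l, (dg Q (gw lm) * (T k * dg Q lm + dg Q lm * T k) * dg Q (gw lm) * T l).trace
      = (dg Q (gw lm) * T k * dg Q (fun i => lm i * gw lm i) * T l).trace
        + (dg Q (fun i => gw lm i * lm i) * T k * dg Q (gw lm) * T l).trace := by
    intro k l
    rw [← Matrix.trace_add]
    congr 1
    rw [← dg_mul hQ (gw lm) lm, ← dg_mul hQ lm (gw lm)]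
    noncomm_ring
  change ∑ k, ∑ l, dg Q (gw lm) k l * ((T k * dg Q (gw lm) - dg Q lm * (dg Q (gw lm) * (T k * dg Q lm + dg Q lm * T k) * dg Q (gw lm))) * T l).trace
    + ∑ k, ∑ l, (dg Q lm * dg Q (gw lm)) k l * (dg Q (gw lm) * (T k * dg Q lm + dg Q lm * T k) * dg Q (gw lm) * T l).trace = _
  simp_rw [e1, e2, dg_mul hQ, mul_add, mul_sub, Finset.sum_add_distrib, Finset.sum_sub_distrib, contr (T := T) Q hT]
  simp_rw [← Finset.sum_add_distrib, ← Finset.sum_sub_distrib]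
  simp_rw [← Finset.sum_add_distrib]
  refine Finset.sum_congr rfl fun r _ => Finset.sum_congr rfl fun p _ => Finset.sum_congr rfl fun q _ => ?_
  have hp := gw_eq lm p
  have : gw lm r * (1 * gw lm q) - gw lm r * (lm p * gw lm p * lm p * gw lm q) = gw lm r * gw lm q * gw lm p := by
    have : 1 = lm p * gw lm p * lm p + gw lm p := by linarith
    linear_combination (gw lm r * gw lm q) * this
  linear_combination (rot Q T r p q ^ 2) * this

lemma gradL_diag (S : Sol u c lam) (x : Eu n) {Q : Matrix (Fin n) (Fin n) ℝ} (hQ : Orth Q) (h : Hess u x = dg Q (lam x)) :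
    ∑ k, ∑ l, (gMat u x)⁻¹ k l * (pd k (fun y => Real.log (Vol u y)) x * pd l (fun y => Real.log (Vol u y)) x) =
    ∑ r, gw (lam x) r * (∑ p, lam x p * gw (lam x) p * rot Q (fun k => T3 u k x) r p p) ^ 2 := by
  have hG : (gMat u x)⁻¹ = dg Q (gw (lam x)) := by unfold gMat; rw [h, g_inv hQ]
  have e : ∀ k, pd k (fun y => Real.log (Vol u y)) x = ∑ p, lam x p * gw (lam x) p * (Q.transpose * T3 u k x * Q) p p := by
    intro k; rw [S.pdL, hG, h, dg_mul hQ, tr_dg]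
  rw [hG, contr2]
  refine Finset.sum_congr rfl fun r _ => ?_
  have : ∑ k, Q k r * pd k (fun y => Real.log (Vol u y)) x = ∑ p, lam x p * gw (lam x) p * rot Q (fun k => T3 u k x) r p p := by
    simp_rw [e, rot_eq, Finset.mul_sum]
    rw [Finset.sum_comm]
    refine Finset.sum_congr rfl fun r _ => Finset.sum_congr rfl fun p _ => by ring
  rw [this]; ring

lemma reduce (S : Sol u c lam) {κ : ℝ} (hκ : 0 ≤ κ) (x : Eu n)
    (hJ : κ * ∑ k, ∑ l, (gMat u x)⁻¹ k l * (pd k (fun y => Real.log (Vol u y)) x * pd l (fun y => Real.log (Vol u y)) x) ≤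
      ∑ k, ∑ l, (gMat u x)⁻¹ k l * pd k (pd l (fun y => Real.log (Vol u y))) x) :
    2 * gradSq u (fun y => Vol u y ^ κ) x / (Vol u x ^ κ) ≤ lapg u (fun y => Vol u y ^ κ) x := by
  set L := fun y => Real.log (Vol u y) with hL
  have hb : (fun y => Vol u y ^ κ) = fun y => Real.exp (κ * L y) := by
    ext y; rw [Real.rpow_def_of_pos (by linarith [S.one_le_V y])]; simp only [hL]; ring_nf
  have hsL : ContDiff ℝ ∞ L := S.smL
  have hsb : ContDiff ℝ ∞ (fun y => Real.exp (κ * L y)) := (contDiff_const.mul hsL).exp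
  have hbx : Vol u x ^ κ = Real.exp (κ * L x) := congrFun hb x
  have dL : ∀ y, DifferentiableAt ℝ L y := fun y => cd hsL (by simp) y
  have dκ : ∀ y, DifferentiableAt ℝ (fun y => κ * L y) y := fun y => (dL y).const_mul κ
  have p1 : ∀ k, pd k (fun y => Real.exp (κ * L y)) = fun y => Real.exp (κ * L y) * (κ * pd k L y) := by
    intro k; ext y
    rw [pd_comp (g := Real.exp) (f := fun y => κ * L y) k (Real.hasDerivAt_exp _) (dκ y), pd_const_mul k κ (dL y)]
  have p2 : ∀ k l, pd k (pd l (fun y => Real.exp (κ * L y))) x =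
      Real.exp (κ * L x) * (κ * pd k (pd l L) x + κ^2 * (pd k L x * pd l L x)) := by
    intro k l
    have dl : DifferentiableAt ℝ (pd l L) x := cd (pd_smooth l hsL) (by simp) x
    rw [p1, pd_mul k (cd hsb (by simp) x) (dl.const_mul κ), p1, pd_const_mul k κ dl]; ring
  rw [hbx, hb]
  set b := Real.exp (κ * L x) with hbd
  have hbp : 0 < b := Real.exp_pos _
  have g1 : gradSq u (fun y => Real.exp (κ * L y)) x = b^2 * κ^2 * ∑ k, ∑ l, (gMat u x)⁻¹ k l * (pd k L x * pd l L x) := by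
    unfold gradSq
    simp_rw [Finset.mul_sum]
    refine Finset.sum_congr rfl fun k _ => Finset.sum_congr rfl fun l _ => ?_
    change (gMat u x)⁻¹ k l * pd k (fun y => Real.exp (κ * L y)) x * pd l (fun y => Real.exp (κ * L y)) x = _
    rw [p1, p1]; ring
  have g2 : lapg u (fun y => Real.exp (κ * L y)) x = b * κ * ∑ k, ∑ l, (gMat u x)⁻¹ k l * pd k (pd l L) x
      + b * κ^2 * ∑ k, ∑ l, (gMat u x)⁻¹ k l * (pd k L x * pd l L x) := by
    unfold lapg
    simp_rw [Finset.mul_sum, ← Finset.sum_add_distrib]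
    refine Finset.sum_congr rfl fun k _ => Finset.sum_congr rfl fun l _ => ?_
    rw [hess_eq (hsb.of_le two_le_inf), p2]; ring
  rw [g1, g2]
  generalize (∑ k, ∑ l, (gMat u x)⁻¹ k l * (pd k L x * pd l L x)) = A at *
  generalize (∑ k, ∑ l, (gMat u x)⁻¹ k l * pd k (pd l L) x) = B at *
  have : 2 * (b^2 * κ^2 * A) / b = 2 * b * κ^2 * A := by field_simp
  rw [this]
  nlinarith [mul_le_mul_of_nonneg_left hJ (mul_nonneg hbp.le hκ)]

lemma case1 (S : Sol u c lam) (hn : 0 < n) {ε : ℝ} (hε : 0 < ε) (hε1 : ε ≤ 1)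
    (hc : ∀ x i j, 0 ≤ 3 + (1 - ε) * lam x i ^ 2 + 2 * lam x i * lam x j) (x : Eu n) :
    2 * gradSq u (fun y => Vol u y ^ (ε / n : ℝ)) x / (Vol u x ^ (ε / n : ℝ)) ≤ lapg u (fun y => Vol u y ^ (ε / n : ℝ)) x := by
  apply S.reduce (by positivity)
  obtain ⟨Q, hQ, h⟩ := S.sp x
  rw [S.lapL_diag x hQ h, S.gradL_diag x hQ h]
  exact ptw (fun r p q => rot_symm23 Q (T := fun k => T3 u k x) (S.T23 x) r p q)
    (fun r p q => rot_symm12 Q (T := fun k => T3 u k x) (S.T12 x) r p q) (gw_pos _) hn hε hε1 (hc x)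

lemma case2 (S : Sol u c lam) {κ : ℝ} (hκ : 0 ≤ κ) (hT : ∀ k i j x, pd k (pd i (pd j u)) x = 0) (x : Eu n) :
    2 * gradSq u (fun y => Vol u y ^ κ) x / (Vol u x ^ κ) ≤ lapg u (fun y => Vol u y ^ κ) x := by
  apply S.reduce hκ
  obtain ⟨Q, hQ, h⟩ := S.sp x
  rw [S.lapL_diag x hQ h, S.gradL_diag x hQ h]
  have : ∀ r p q, rot Q (fun k => T3 u k x) r p q = 0 := by
    intro r p q; unfold rot; simp [S.T_apply, hT]
  simp [this]

end Sol
end SL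
end Part16

section Part17
open scoped ContDiff
open MeasureTheory Metric

namespace SL
variable {n : ℕ}

/-- metric of an arbitrary matrix -/
def g0 (A : Fin n → Fin n → ℝ) : Matrix (Fin n) (Fin n) ℝ := 1 + Matrix.of A * (Matrix.of A).transpose

lemma g0_quad (A : Fin n → Fin n → ℝ) (y : Fin n → ℝ) :
    ∑ i, ∑ j, g0 A i j * y i * y j = ∑ i, y i ^ 2 + ∑ l, (∑ i, A i l * y i) ^ 2 := by
  have e : ∀ i j, g0 A i j * y i * y j = (if i = j then y i * y j else 0) + ∑ l, (A i l * y i) * (A j l * y j) := by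
    intro i j
    unfold g0
    rw [Matrix.add_apply, Matrix.one_apply, Matrix.mul_apply]
    simp only [Matrix.of_apply, Matrix.transpose_apply, add_mul, Finset.sum_mul]
    congr 1
    · split_ifs <;> simp
    · exact Finset.sum_congr rfl fun l _ => by ring
  simp_rw [e, Finset.sum_add_distrib]
  congr 1
  · simp [sq]
  · have : ∀ l, (∑ i, A i l * y i) ^ 2 = ∑ i, ∑ j, (A i l * y i) * (A j l * y j) := fun l => by
      rw [sq, Finset.sum_mul_sum]
    simp_rw [this]
    calc _ = ∑ i, ∑ l, ∑ j, (A i l * y i) * (A j l * y j) := Finset.sum_congr rfl fun i _ => Finset.sum_comm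
      _ = _ := Finset.sum_comm

lemma g0_symm (A : Fin n → Fin n → ℝ) (i j : Fin n) : g0 A i j = g0 A j i := by
  unfold g0
  rw [Matrix.add_apply, Matrix.add_apply, Matrix.mul_apply, Matrix.mul_apply, Matrix.one_apply, Matrix.one_apply]
  congr 1
  · simp [eq_comm]
  · exact Finset.sum_congr rfl fun l _ => by simp [mul_comm]

lemma g0_det_pos (A : Fin n → Fin n → ℝ) : 0 < (g0 A).det := by
  apply Matrix.PosDef.det_pos
  refine Matrix.PosDef.add_posSemidef Matrix.PosDef.one ?_
  have := Matrix.posSemidef_self_mul_conjTranspose (Matrix.of A)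
  rwa [Matrix.conjTranspose_eq_transpose_of_trivial] at this

/-- volume -/
noncomputable def V0 (A : Fin n → Fin n → ℝ) : ℝ := Real.sqrt (g0 A).det

lemma V0_pos (A : Fin n → Fin n → ℝ) : 0 < V0 A := Real.sqrt_pos.2 (g0_det_pos A)

/-- coefficient matrix -/
noncomputable def aM (A : Fin n → Fin n → ℝ) (i j : Fin n) : ℝ := V0 A * (g0 A)⁻¹ i j

lemma sm_g0 : SM (g0 : (Fin n → Fin n → ℝ) → Matrix (Fin n) (Fin n) ℝ) := by
  have h1 : SM (fun A : Fin n → Fin n → ℝ => Matrix.of A) := by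
    intro i j
    simp only [Matrix.of_apply]
    exact (contDiff_apply ℝ ℝ j).comp (contDiff_apply ℝ (Fin n → ℝ) i)
  exact (SM.const 1).add (h1.mul h1.transpose)

lemma sm_V0 : ContDiff ℝ ∞ (V0 : (Fin n → Fin n → ℝ) → ℝ) := sm_g0.det.sqrt fun A => (g0_det_pos A).ne'

lemma sm_aM (i j : Fin n) : ContDiff ℝ ∞ (fun A : Fin n → Fin n → ℝ => aM A i j) :=
  sm_V0.mul (sm_g0.inv (fun A => (g0_det_pos A).ne') i j)

lemma cpt_bd (Λ : ℝ) {f : (Fin n → Fin n → ℝ) → ℝ} (hf : Continuous f) :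
    ∃ B, 0 ≤ B ∧ ∀ A : Fin n → Fin n → ℝ, (∀ k l, |A k l| ≤ Λ) → |f A| ≤ B := by
  by_cases hΛ : 0 ≤ Λ
  · obtain ⟨B, hB⟩ := (isCompact_closedBall (0 : Fin n → Fin n → ℝ) Λ).exists_bound_of_continuousOn hf.continuousOn
    refine ⟨max B 0, le_max_right _ _, fun A hA => (hB A ?_).trans (le_max_left _ _)⟩
    rw [mem_closedBall_zero_iff]
    exact (pi_norm_le_iff_of_nonneg hΛ).2 fun k => (pi_norm_le_iff_of_nonneg hΛ).2 fun l => hA k l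
  · rcases Nat.eq_zero_or_pos n with h | h
    · subst h
      refine ⟨|f 0|, abs_nonneg _, fun A _ => ?_⟩
      rw [Subsingleton.elim A 0]
    · exact ⟨0, le_rfl, fun A hA => absurd ((abs_nonneg _).trans (hA ⟨0, h⟩ ⟨0, h⟩)) hΛ⟩

lemma cpt_lip {Λ : ℝ} (hΛ : 0 ≤ Λ) {f : (Fin n → Fin n → ℝ) → ℝ} (hf : ContDiff ℝ ∞ f) :
    ∃ C, 0 ≤ C ∧ ∀ A B : Fin n → Fin n → ℝ, (∀ k l, |A k l| ≤ Λ) → (∀ k l, |B k l| ≤ Λ) →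
      |f A - f B| ≤ C * ∑ k, ∑ l, |A k l - B k l| := by
  obtain ⟨K, hK⟩ := hf.contDiffOn.exists_lipschitzOnWith (s := closedBall (0 : Fin n → Fin n → ℝ) Λ) (by simp) (convex_closedBall _ _)
    (isCompact_closedBall _ _)
  have mem : ∀ A : Fin n → Fin n → ℝ, (∀ k l, |A k l| ≤ Λ) → A ∈ closedBall (0 : Fin n → Fin n → ℝ) Λ := by
    intro A hA
    rw [mem_closedBall_zero_iff]
    exact (pi_norm_le_iff_of_nonneg hΛ).2 fun k => (pi_norm_le_iff_of_nonneg hΛ).2 fun l => hA k l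
  refine ⟨K, K.2, fun A B hA hB => ?_⟩
  have h1 := hK.dist_le_mul A (mem A hA) B (mem B hB)
  rw [Real.dist_eq, dist_eq_norm] at h1
  refine h1.trans (mul_le_mul_of_nonneg_left ?_ K.2)
  have h0 : ∀ k, 0 ≤ ∑ l, |A k l - B k l| := fun k => Finset.sum_nonneg fun _ _ => abs_nonneg _
  have h00 : 0 ≤ ∑ k, ∑ l, |A k l - B k l| := Finset.sum_nonneg fun k _ => h0 k
  refine (pi_norm_le_iff_of_nonneg h00).2 fun k => (pi_norm_le_iff_of_nonneg h00).2 fun l => ?_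
  calc ‖(A - B) k l‖ = |A k l - B k l| := rfl
    _ ≤ ∑ l, |A k l - B k l| := Finset.single_le_sum (f := fun l => |A k l - B k l|) (fun _ _ => abs_nonneg _) (Finset.mem_univ l)
    _ ≤ _ := Finset.single_le_sum (f := fun k => ∑ l, |A k l - B k l|) (fun k _ => h0 k) (Finset.mem_univ k)

lemma kern {Λ : ℝ} (hΛ : 0 ≤ Λ) : ∃ M C σ : ℝ, 0 ≤ M ∧ 0 ≤ C ∧ 0 < σ ∧ ∀ A : Fin n → Fin n → ℝ, (∀ k l, |A k l| ≤ Λ) →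
    V0 A ≤ M ∧ (∀ i j, |aM A i j| ≤ M) ∧ ∃ K, KerD n M σ (aM A) K ∧
    ∀ B : Fin n → Fin n → ℝ, (∀ k l, |B k l| ≤ Λ) → ∀ i j, |aM B i j - aM A i j| ≤ C * ∑ k, ∑ l, |B k l - A k l| := by
  obtain ⟨B1, hB1, h1⟩ := cpt_bd Λ (sm_V0 (n := n)).continuous
  choose B2 hB2 h2 using fun i j : Fin n => cpt_bd Λ (sm_aM i j).continuous
  have sK : ∀ i j : Fin n, ContDiff ℝ ∞ (fun A : Fin n → Fin n → ℝ => 16 * (B1 + 1) * (V0 A)⁻¹ * g0 A i j) := fun i j =>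
    (contDiff_const.mul (sm_V0.inv fun A => (V0_pos A).ne')).mul (sm_g0 i j)
  choose B3 hB3 h3 using fun i j : Fin n => cpt_bd Λ (sK i j).continuous
  choose C0 hC0 h4 using fun i j : Fin n => cpt_lip hΛ (sm_aM i j)
  have le2 : ∀ F : Fin n → Fin n → ℝ, (∀ i j, 0 ≤ F i j) → ∀ i j, F i j ≤ ∑ i, ∑ j, F i j := by
    intro F hF i j
    calc F i j ≤ ∑ j, F i j := Finset.single_le_sum (fun j _ => hF i j) (Finset.mem_univ j)
      _ ≤ _ := Finset.single_le_sum (f := fun i => ∑ j, F i j) (fun i _ => Finset.sum_nonneg fun j _ => hF i j) (Finset.mem_univ i)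
  have p2 : 0 ≤ ∑ i, ∑ j, B2 i j := Finset.sum_nonneg fun i _ => Finset.sum_nonneg fun j _ => hB2 i j
  have p3 : 0 ≤ ∑ i, ∑ j, B3 i j := Finset.sum_nonneg fun i _ => Finset.sum_nonneg fun j _ => hB3 i j
  have p4 : 0 ≤ ∑ i, ∑ j, C0 i j := Finset.sum_nonneg fun i _ => Finset.sum_nonneg fun j _ => hC0 i j
  refine ⟨B1 + ∑ i, ∑ j, B2 i j + ∑ i, ∑ j, B3 i j, ∑ i, ∑ j, C0 i j, 16 * (B1 + 1), by positivity, p4, by positivity, fun A hA => ?_⟩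
  have hV := V0_pos A
  have hVB : V0 A ≤ B1 := (le_abs_self _).trans (h1 A hA)
  have ha : ∀ i j, |aM A i j| ≤ B1 + ∑ i, ∑ j, B2 i j + ∑ i, ∑ j, B3 i j := fun i j => by
    have := h2 i j A hA; have := le2 B2 hB2 i j; linarith
  refine ⟨by linarith, ha, fun i j => 16 * (B1 + 1) * (V0 A)⁻¹ * g0 A i j, ⟨?_, ?_, ?_, ?_, ha⟩, ?_⟩
  · intro i j; simp only [g0_symm A i j]
  · intro i j
    have e : ∀ l, aM A i l * (16 * (B1 + 1) * (V0 A)⁻¹ * g0 A l j) = 16 * (B1 + 1) * ((g0 A)⁻¹ i l * g0 A l j) := by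
      intro l; unfold aM; field_simp
    simp_rw [e, ← Finset.mul_sum]
    rw [← Matrix.mul_apply, Matrix.nonsing_inv_mul _ (isUnit_iff_ne_zero.2 (g0_det_pos A).ne'), Matrix.one_apply]
    split_ifs <;> simp
  · intro y
    have e : Qf (fun i j => 16 * (B1 + 1) * (V0 A)⁻¹ * g0 A i j) y = 16 * (B1 + 1) * (V0 A)⁻¹ * ∑ i, ∑ j, g0 A i j * y i * y j := by
      unfold Qf; simp_rw [Finset.mul_sum]
      exact Finset.sum_congr rfl fun i _ => Finset.sum_congr rfl fun j _ => by ring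
    rw [e, g0_quad, nsq]
    have q1 : 1 ≤ (B1 + 1) * (V0 A)⁻¹ := by
      rw [← div_eq_mul_inv, le_div_iff₀ hV]; linarith
    have q2 : 0 ≤ ∑ l, (∑ i, A i l * y i) ^ 2 := Finset.sum_nonneg fun _ _ => sq_nonneg _
    have q3 := sq_nonneg ‖y‖
    nlinarith
  · intro i j
    have := h3 i j A hA; have := le2 B3 hB3 i j
    linarith
  · intro B hB i j
    refine (h4 i j B A hB hA).trans (mul_le_mul_of_nonneg_right (le2 C0 hC0 i j) ?_)
    exact Finset.sum_nonneg fun k _ => Finset.sum_nonneg fun l _ => abs_nonneg _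

lemma eig_aux {lm : Fin n → ℝ} {c t Λ : ℝ} (hn : 0 < n) (ht : 0 < t) (hc : ∀ i j, 0 ≤ 3 - t * lm i ^ 2 + 2 * lm i * lm j)
    (hs : ∑ i, Real.arctan (lm i) = c) (hcn : |c| / n < Real.pi / 2)
    (hΛ : 1 + 6 / t + 4 * Real.tan (|c| / n) / t ≤ Λ) (i : Fin n) : lm i ≤ Λ := by
  have hn' : (0:ℝ) < n := by exact_mod_cast hn
  by_contra! h
  have hc0 : 0 ≤ |c| / n := by positivity
  have hτ : 0 ≤ Real.tan (|c| / n) := Real.tan_nonneg_of_nonneg_of_le_pi_div_two hc0 hcn.le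
  set a := lm i with ha
  have h6 : 0 < 6 / t := by positivity
  have hτt : 0 ≤ 4 * Real.tan (|c| / n) / t := by positivity
  have a1 : 1 < a := by linarith
  have a2 : 6 < t * a := by
    have : 6 / t < a := by linarith
    rw [div_lt_iff₀ ht] at this; linarith
  have a3 : 4 * Real.tan (|c| / n) < t * a := by
    have : 4 * Real.tan (|c| / n) / t < a := by linarith
    rw [div_lt_iff₀ ht] at this; linarith
  have hb : ∀ j, Real.tan (|c| / n) < lm j := by
    intro j
    have := hc i j
    rw [← ha] at this
    have : t * a / 4 ≤ lm j := by
      have h2 : a * (t * a / 4) ≤ a * lm j := by nlinarith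
      exact le_of_mul_le_mul_left h2 (by linarith)
    linarith
  have hb2 : ∀ j, |c| / n < Real.arctan (lm j) := by
    intro j
    have := Real.arctan_strictMono (hb j)
    rwa [Real.arctan_tan (by linarith [Real.pi_pos]) hcn] at this
  have : |c| < c := by
    rw [← hs]
    calc |∑ i, Real.arctan (lm i)| = ∑ i : Fin n, |c| / n := by
          rw [hs]; simp; field_simp
      _ < _ := Finset.sum_lt_sum_of_nonempty ⟨i, Finset.mem_univ i⟩ fun j _ => hb2 j
  linarith [le_abs_self c]

lemma eig_bd {u : Eu n → ℝ} {c : ℝ} {lam : Eu n → Fin n → ℝ} (S : Sol u c lam) {t : ℝ} (hn : 0 < n) (ht : 0 < t)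
    (hc : ∀ x i j, 0 ≤ 3 - t * lam x i ^ 2 + 2 * lam x i * lam x j) : ∃ Λ, 0 ≤ Λ ∧ ∀ x i, |lam x i| ≤ Λ := by
  have hn' : (0:ℝ) < n := by exact_mod_cast hn
  have hcn : |c| / n < Real.pi / 2 := by
    rw [div_lt_iff₀ hn', ← S.hc 0]
    calc |∑ i, Real.arctan (lam 0 i)| ≤ ∑ i, |Real.arctan (lam 0 i)| := Finset.abs_sum_le_sum_abs _ _
      _ < ∑ i : Fin n, Real.pi / 2 := Finset.sum_lt_sum_of_nonempty ⟨⟨0, hn⟩, Finset.mem_univ _⟩ fun j _ =>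
          abs_lt.2 ⟨by linarith [Real.neg_pi_div_two_lt_arctan (lam 0 j)], Real.arctan_lt_pi_div_two _⟩
      _ = _ := by simp; ring
  have hτ : 0 ≤ Real.tan (|c| / n) := Real.tan_nonneg_of_nonneg_of_le_pi_div_two (by positivity) hcn.le
  refine ⟨1 + 6 / t + 4 * Real.tan (|c| / n) / t, by positivity, fun x i => abs_le.2 ⟨?_, ?_⟩⟩
  · have := eig_aux (lm := fun i => - lam x i) (c := -c) hn ht (fun i j => by have := hc x i j; linarith)
      (by simp [S.hc]) (by rwa [abs_neg]) (by rw [abs_neg]) i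
    linarith
  · exact eig_aux hn ht (hc x) (S.hc x) hcn le_rfl i

end SL
end Part17

section Part18
open scoped ContDiff
open MeasureTheory Metric

namespace SL
variable {n : ℕ}

lemma orth_sum {Q : Matrix (Fin n) (Fin n) ℝ} (hQ : Orth Q) (ξ : Fin n → ℝ) :
    ∑ r, (∑ k, Q k r * ξ k) ^ 2 = ∑ i, ξ i ^ 2 := by
  have h := contr2 Q (fun _ => 1) ξ ξ
  rw [dg_one hQ] at h
  simp only [Matrix.one_apply, ite_mul, one_mul, zero_mul, Finset.sum_ite_eq, Finset.mem_univ, if_true] at h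
  simp only [sq]; exact h.symm

lemma orth_dg {Q : Matrix (Fin n) (Fin n) ℝ} (hQ : Orth Q) (w ξ : Fin n → ℝ) (r : Fin n) :
    ∑ k, Q k r * (∑ l, dg Q w k l * ξ l) = w r * ∑ l, Q l r * ξ l := by
  have h : Q.transpose * dg Q w = Matrix.diagonal w * Q.transpose := by
    unfold dg; rw [← mul_assoc, ← mul_assoc, hQ.l, one_mul]
  have e : Q.transpose.mulVec ((dg Q w).mulVec ξ) = (Matrix.diagonal w).mulVec (Q.transpose.mulVec ξ) := by
    rw [Matrix.mulVec_mulVec, h, Matrix.mulVec_mulVec]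
  have := congrFun e r
  rw [Matrix.mulVec_diagonal] at this
  simpa [Matrix.mulVec, dotProduct] using this

lemma Q_le {Q : Matrix (Fin n) (Fin n) ℝ} (hQ : Orth Q) (i r : Fin n) : |Q i r| ≤ 1 := by
  have h : (Q * Q.transpose) i i = 1 := by rw [hQ.r, Matrix.one_apply_eq]
  rw [Matrix.mul_apply] at h
  have h2 := Finset.single_le_sum (f := fun r => Q i r * Q.transpose r i)
    (fun r _ => by rw [Matrix.transpose_apply]; exact mul_self_nonneg _) (Finset.mem_univ r)
  simp only [Matrix.transpose_apply] at h2 h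
  rw [h] at h2
  exact abs_le_one_iff_mul_self_le_one.2 h2

lemma dg_le {Q : Matrix (Fin n) (Fin n) ℝ} (hQ : Orth Q) {w : Fin n → ℝ} {Λ : ℝ} (hw : ∀ i, |w i| ≤ Λ) (i j : Fin n) :
    |dg Q w i j| ≤ n * Λ := by
  rw [dg_apply]
  calc _ ≤ ∑ r, |w r * (Q i r * Q j r)| := Finset.abs_sum_le_sum_abs _ _
    _ ≤ ∑ r : Fin n, Λ := Finset.sum_le_sum fun r _ => by
        rw [abs_mul, abs_mul]
        have h1 := mul_le_mul (Q_le hQ i r) (Q_le hQ j r) (abs_nonneg _) zero_le_one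
        rw [one_mul] at h1
        have h2 := mul_le_mul (hw r) h1 (by positivity) ((abs_nonneg _).trans (hw r))
        rwa [mul_one] at h2
    _ = _ := by simp

lemma tr_shift {T : Fin n → Matrix (Fin n) (Fin n) ℝ} (h12 : ∀ k i j, T k i j = T i k j) (h23 : ∀ k i j, T k i j = T k j i)
    (A B : Matrix (Fin n) (Fin n) ℝ) (j : Fin n) : ∑ i, (A * T i * B) i j = ∑ b, (A * T b).trace * B b j := by
  have e : ∀ i a b, T i a b = T b a i := fun i a b => by rw [h23, h12, h23]
  have l : ∀ i, (A * T i * B) i j = ∑ b, (∑ a, A i a * T b a i) * B b j := by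
    intro i; rw [Matrix.mul_apply]
    refine Finset.sum_congr rfl fun b _ => ?_
    rw [Matrix.mul_apply]
    congr 1
    exact Finset.sum_congr rfl fun a _ => by rw [e]
  simp_rw [l]
  rw [Finset.sum_comm]
  refine Finset.sum_congr rfl fun b _ => ?_
  rw [← Finset.sum_mul]; rfl

variable {u : Eu n → ℝ} {c : ℝ} {lam : Eu n → Fin n → ℝ}

namespace Sol

lemma comm_GH (S : Sol u c lam) (x : Eu n) : (gMat u x)⁻¹ * Hess u x = Hess u x * (gMat u x)⁻¹ := by
  obtain ⟨Q, hQ, h⟩ := S.sp x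
  unfold gMat; rw [h, g_inv hQ, dg_mul hQ, dg_mul hQ]; simp_rw [mul_comm]

lemma divf (S : Sol u c lam) (j : Fin n) (x : Eu n) :
    ∑ i, pd i (fun y => Vol u y * (gMat u y)⁻¹ i j) x = 0 := by
  have e : ∀ i, pd i (fun y => Vol u y * (gMat u y)⁻¹ i j) x =
      Vol u x * (((gMat u x)⁻¹ * Hess u x * T3 u i x).trace * (gMat u x)⁻¹ i j
        - (((gMat u x)⁻¹ * T3 u i x * (Hess u x * (gMat u x)⁻¹)) i j + ((gMat u x)⁻¹ * Hess u x * T3 u i x * (gMat u x)⁻¹) i j)) := by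
    intro i
    rw [pd_mul i (cd S.smV (by simp) x) (S.smG.da i j x), (S.first i x).2, S.comm_GH]
    have h := congrFun (congrFun (S.pdG i x) i) j
    unfold pdM at h
    rw [Matrix.of_apply] at h
    rw [h, Matrix.neg_apply, ← S.comm_GH, ← Matrix.add_apply]
    have : (gMat u x)⁻¹ * (T3 u i x * Hess u x + Hess u x * T3 u i x) * (gMat u x)⁻¹ =
      (gMat u x)⁻¹ * T3 u i x * ((gMat u x)⁻¹ * Hess u x) + (gMat u x)⁻¹ * Hess u x * T3 u i x * (gMat u x)⁻¹ := by
      have q : (gMat u x)⁻¹ * T3 u i x * ((gMat u x)⁻¹ * Hess u x) = (gMat u x)⁻¹ * T3 u i x * (Hess u x * (gMat u x)⁻¹) := by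
        rw [S.comm_GH]
      rw [q]; noncomm_ring
    rw [this]; ring
  simp_rw [e]
  rw [← Finset.mul_sum, Finset.sum_sub_distrib, Finset.sum_add_distrib,
    tr_shift (T := fun i => T3 u i x) (S.T12 x) (S.T23 x), tr_shift (T := fun i => T3 u i x) (S.T12 x) (S.T23 x)]
  simp [(S.first _ x).1]

lemma eqf (S : Sol u c lam) (k : Fin n) (x : Eu n) :
    ∑ i, ∑ j, (gMat u x)⁻¹ i j * pd i (pd j (pd k u)) x = 0 := by
  rw [← (S.first k x).1, Matrix.trace]
  refine Finset.sum_congr rfl fun i _ => ?_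
  rw [Matrix.diag_apply, Matrix.mul_apply]
  refine Finset.sum_congr rfl fun j _ => ?_
  rw [← S.T_apply, S.T23, S.T12, S.T23]

lemma ellf (S : Sol u c lam) {Λ : ℝ} (hΛ : ∀ x i, |lam x i| ≤ Λ) (x : Eu n) (ξ : Fin n → ℝ) :
    (1 + Λ ^ 2)⁻¹ * ∑ i, ξ i ^ 2 ≤ ∑ i, ∑ j, (Vol u x * (gMat u x)⁻¹ i j) * (ξ i * ξ j) := by
  obtain ⟨Q, hQ, h⟩ := S.sp x
  have e : ∑ i, ∑ j, (Vol u x * (gMat u x)⁻¹ i j) * (ξ i * ξ j) = Vol u x * ∑ r, gw (lam x) r * (∑ k, Q k r * ξ k) ^ 2 := by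
    simp_rw [sq]
    rw [← contr2]
    simp_rw [Finset.mul_sum, mul_assoc]
    unfold gMat; rw [h, g_inv hQ]
  rw [e, ← orth_sum hQ]
  have h1 : (1 + Λ ^ 2)⁻¹ * ∑ r, (∑ k, Q k r * ξ k) ^ 2 ≤ ∑ r, gw (lam x) r * (∑ k, Q k r * ξ k) ^ 2 := by
    rw [Finset.mul_sum]
    refine Finset.sum_le_sum fun r _ => mul_le_mul_of_nonneg_right ?_ (sq_nonneg _)
    unfold gw
    have := sq_le_sq' (abs_le.1 (hΛ x r)).1 (abs_le.1 (hΛ x r)).2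
    gcongr
  have h0 : 0 ≤ ∑ r, gw (lam x) r * (∑ k, Q k r * ξ k) ^ 2 :=
    Finset.sum_nonneg fun r _ => mul_nonneg (gw_pos _ r).le (sq_nonneg _)
  nlinarith [S.one_le_V x]

lemma V_eq (S : Sol u c lam) (x : Eu n) : g0 (fun i j => Hess u x i j) = gMat u x := by
  unfold g0 gMat
  have : (Matrix.of fun i j => Hess u x i j) = Hess u x := rfl
  have h2 : (Hess u x).transpose = Hess u x := by ext i j; exact S.H_symm j i x
  rw [this, h2]

lemma a_eq (S : Sol u c lam) (x : Eu n) (i j : Fin n) :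
    aM (fun i j => Hess u x i j) i j = Vol u x * (gMat u x)⁻¹ i j := by
  unfold aM V0 Vol; rw [S.V_eq]

/-- normalized gradient -/
noncomputable def gr (u : Eu n → ℝ) (k : Fin n) (x : Eu n) : ℝ := pd k u x - pd k u 0

lemma gr_sm (S : Sol u c lam) (k : Fin n) : ContDiff ℝ ∞ (gr u k) := (pd_smooth k S.hu).sub contDiff_const

lemma pd_gr (S : Sol u c lam) (j k : Fin n) : pd j (gr u k) = fun x => Hess u x j k := by
  ext x
  unfold gr
  rw [pd_sub j (cd (pd_smooth k S.hu) (by simp) x) (differentiableAt_const _), pd_const, sub_zero, S.H_apply]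

lemma pd2_gr (S : Sol u c lam) (i j k : Fin n) (x : Eu n) : pd i (pd j (gr u k)) x = pd i (pd j (pd k u)) x := by
  rw [S.pd_gr, S.H_fun]

/-- extrinsic distance squared -/
noncomputable def ss (u : Eu n → ℝ) (x : Eu n) : ℝ := ∑ i, x i ^ 2 + ∑ k, gr u k x ^ 2

lemma ss_sm (S : Sol u c lam) : ContDiff ℝ ∞ (ss u) :=
  (ContDiff.sum fun i _ => (contDiff_coord i).pow 2).add (ContDiff.sum fun k _ => (S.gr_sm k).pow 2)

lemma pd_sq {f : Eu n → ℝ} (hf : ContDiff ℝ ∞ f) (j : Fin n) (x : Eu n) : pd j (fun y => f y ^ 2) x = 2 * (f x * pd j f x) := by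
  simp_rw [sq]; rw [pd_mul j (cd hf (by simp) x) (cd hf (by simp) x)]; ring

lemma pd_ss (S : Sol u c lam) (j : Fin n) : pd j (ss u) = fun x => 2 * (x j + ∑ k, gr u k x * Hess u x j k) := by
  ext x
  unfold ss
  rw [pd_add j (cd (ContDiff.sum fun i _ => (contDiff_coord i).pow 2) (m := ∞) (by simp) x)
    (cd (ContDiff.sum fun k _ => (S.gr_sm k).pow 2) (by simp) x),
    pd_sum j (fun i _ => cd ((contDiff_coord i).pow 2) (m := ∞) (by simp) x),
    pd_sum j (fun k _ => cd ((S.gr_sm k).pow 2) (by simp) x)]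
  simp_rw [pd_sq (contDiff_coord _), pd_sq (S.gr_sm _), pd_coord, S.pd_gr]
  simp [Finset.mul_sum, mul_add]

lemma pd2_ss (S : Sol u c lam) (i j : Fin n) (x : Eu n) :
    pd i (pd j (ss u)) x = 2 * (gMat u x j i + ∑ k, gr u k x * pd i (pd j (pd k u)) x) := by
  have hh : ∀ k, ContDiff ℝ ∞ (fun x => Hess u x j k) := fun k => S.smH j k
  rw [S.pd_ss, pd_const_mul i 2 (cd ((contDiff_coord j).add (ContDiff.sum fun k _ => (S.gr_sm k).mul (hh k))) (by simp) x),
    pd_add i (cd (contDiff_coord j) (m := ∞) (by simp) x) (cd (ContDiff.sum fun k _ => (S.gr_sm k).mul (hh k)) (by simp) x),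
    pd_sum i (fun k _ => cd ((S.gr_sm k).mul (hh k)) (by simp) x)]
  have e : ∀ k, pd i (fun y => gr u k y * Hess u y j k) x = Hess u x j k * Hess u x k i + gr u k x * pd i (pd j (pd k u)) x := by
    intro k
    rw [pd_mul i (cd (S.gr_sm k) (by simp) x) (cd (hh k) (by simp) x), S.pd_gr, S.H_fun j k, S.H_symm k i x]
    ring
  simp_rw [e, pd_coord, Finset.sum_add_distrib]
  unfold gMat
  rw [Matrix.add_apply, Matrix.mul_apply, Matrix.one_apply]
  simp only [eq_comm (a := i)]; ring

lemma ss1 (S : Sol u c lam) (x : Eu n) :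
    ∑ i, ∑ j, (Vol u x * (gMat u x)⁻¹ i j) * pd i (pd j (ss u)) x = 2 * n * Vol u x := by
  have h1 : ∑ i, ∑ j, (gMat u x)⁻¹ i j * gMat u x j i = n := by
    have h := congrArg Matrix.trace (Matrix.nonsing_inv_mul _ (isUnit_iff_ne_zero.2 (S.det_ne x)))
    simpa [Matrix.trace, Matrix.mul_apply] using h
  have h2 : ∑ i, ∑ j, ∑ k, gr u k x * ((gMat u x)⁻¹ i j * pd i (pd j (pd k u)) x) = 0 := by
    have : ∀ i, ∑ j, ∑ k, gr u k x * ((gMat u x)⁻¹ i j * pd i (pd j (pd k u)) x) =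
        ∑ k, ∑ j, gr u k x * ((gMat u x)⁻¹ i j * pd i (pd j (pd k u)) x) := fun i => Finset.sum_comm
    simp_rw [this]
    rw [Finset.sum_comm]
    simp_rw [← Finset.mul_sum, S.eqf]
    simp
  calc _ = ∑ i, ∑ j, (2 * Vol u x * ((gMat u x)⁻¹ i j * gMat u x j i)
        + 2 * Vol u x * ∑ k, gr u k x * ((gMat u x)⁻¹ i j * pd i (pd j (pd k u)) x)) := by
        refine Finset.sum_congr rfl fun i _ => Finset.sum_congr rfl fun j _ => ?_
        rw [S.pd2_ss]
        have : ∑ k, gr u k x * ((gMat u x)⁻¹ i j * pd i (pd j (pd k u)) x) = (gMat u x)⁻¹ i j * ∑ k, gr u k x * pd i (pd j (pd k u)) x := by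
          rw [Finset.mul_sum]; exact Finset.sum_congr rfl fun k _ => by ring
        rw [this]; ring
    _ = 2 * Vol u x * ∑ i, ∑ j, (gMat u x)⁻¹ i j * gMat u x j i
        + 2 * Vol u x * ∑ i, ∑ j, ∑ k, gr u k x * ((gMat u x)⁻¹ i j * pd i (pd j (pd k u)) x) := by
        simp_rw [Finset.sum_add_distrib, ← Finset.mul_sum]
    _ = _ := by rw [h1, h2]; ring

lemma ss2 (S : Sol u c lam) (x : Eu n) :
    ∑ i, ∑ j, (Vol u x * (gMat u x)⁻¹ i j) * (pd i (ss u) x * pd j (ss u) x) ≤ 4 * Vol u x * ss u x := by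
  obtain ⟨Q, hQ, h⟩ := S.sp x
  have e : ∑ i, ∑ j, (Vol u x * (gMat u x)⁻¹ i j) * (pd i (ss u) x * pd j (ss u) x) =
      Vol u x * ∑ r, gw (lam x) r * (∑ k, Q k r * pd k (ss u) x) ^ 2 := by
    simp_rw [sq]
    rw [← contr2]
    simp_rw [Finset.mul_sum, mul_assoc]
    unfold gMat; rw [h, g_inv hQ]
  have e2 : ∀ r, ∑ k, Q k r * pd k (ss u) x = 2 * (∑ k, Q k r * x k + lam x r * ∑ k, Q k r * gr u k x) := by
    intro r
    rw [← orth_dg hQ, ← h, ← Finset.sum_add_distrib, Finset.mul_sum]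
    refine Finset.sum_congr rfl fun k _ => ?_
    rw [S.pd_ss]
    have : ∑ l, Hess u x k l * gr u l x = ∑ l, gr u l x * Hess u x k l := Finset.sum_congr rfl fun l _ => mul_comm _ _
    rw [this]; ring
  have e3 : ss u x = ∑ r, ((∑ k, Q k r * x k) ^ 2 + (∑ k, Q k r * gr u k x) ^ 2) := by
    rw [Finset.sum_add_distrib, orth_sum hQ, orth_sum hQ]; rfl
  rw [e, e3, mul_comm 4, mul_assoc]
  refine mul_le_mul_of_nonneg_left ?_ (by linarith [S.one_le_V x])
  rw [Finset.mul_sum]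
  refine Finset.sum_le_sum fun r _ => ?_
  rw [e2]
  set p := ∑ k, Q k r * x k
  set q := ∑ k, Q k r * gr u k x
  have hg := gw_pos (lam x) r
  have hge := gw_eq (lam x) r
  have : 4 * (p ^ 2 + q ^ 2) = gw (lam x) r * (4 * ((1 + lam x r ^ 2) * (p ^ 2 + q ^ 2))) := by
    linear_combination (-4 * (p ^ 2 + q ^ 2)) * hge
  rw [this]
  refine mul_le_mul_of_nonneg_left ?_ hg.le
  nlinarith [sq_nonneg (q - lam x r * p)]

lemma rot_sum (S : Sol u c lam) (x : Eu n) {Q : Matrix (Fin n) (Fin n) ℝ} (hQ : Orth Q) :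
    ∑ r, ∑ p, ∑ q, rot Q (fun k => T3 u k x) r p q ^ 2 = ∑ k, ∑ i, ∑ j, T3 u k x i j ^ 2 := by
  have h := contr Q (T := fun k => T3 u k x) (S.T23 x) (fun _ => 1) (fun _ => 1) (fun _ => 1)
  simp only [dg_one hQ, one_mul, mul_one, Matrix.one_apply, ite_mul, zero_mul, Finset.sum_ite_eq, Finset.mem_univ, if_true] at h
  rw [← h]
  refine Finset.sum_congr rfl fun k _ => ?_
  rw [Matrix.trace]
  refine Finset.sum_congr rfl fun i _ => ?_
  rw [Matrix.diag_apply, Matrix.mul_apply]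
  refine Finset.sum_congr rfl fun j _ => ?_
  rw [S.T23 x k j i, sq]

lemma D2s_le (S : Sol u c lam) (x : Eu n) : D2s (gr u) x ^ 2 ≤ (n : ℝ) ^ 3 * ∑ k, ∑ i, ∑ j, T3 u k x i j ^ 2 := by
  have e : D2s (gr u) x = ∑ k, ∑ i, ∑ j, |T3 u k x i j| := by
    unfold D2s
    refine Finset.sum_congr rfl fun k _ => Finset.sum_congr rfl fun i _ => Finset.sum_congr rfl fun j _ => ?_
    rw [S.pd2_gr, ← S.T_apply, S.T23, S.T12, S.T23]
  rw [e]
  calc (∑ k, ∑ i, ∑ j, |T3 u k x i j|) ^ 2 ≤ n * ∑ k, (∑ i, ∑ j, |T3 u k x i j|) ^ 2 := by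
        have := sq_sum_le_card_mul_sum_sq (s := Finset.univ) (f := fun k : Fin n => ∑ i, ∑ j, |T3 u k x i j|)
        simpa using this
    _ ≤ n * ∑ k, n * n * ∑ i, ∑ j, T3 u k x i j ^ 2 :=
        mul_le_mul_of_nonneg_left (Finset.sum_le_sum fun k _ => sum2_sq_le (fun i j => T3 u k x i j)) (by positivity)
    _ = _ := by rw [← Finset.mul_sum]; ring

lemma flatT (S : Sol u c lam) {t : ℝ} (hn : 0 < n) (ht : 0 < t)
    (hc : ∀ x i j, 0 ≤ 3 - t * lam x i ^ 2 + 2 * lam x i * lam x j) (k i j : Fin n) (x : Eu n) :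
    pd k (pd i (pd j u)) x = 0 := by
  have hn' : (0:ℝ) < n := by exact_mod_cast hn
  obtain ⟨L, hL0, hL⟩ := eig_bd S hn ht hc
  have hΛ : (0:ℝ) ≤ n * L := by positivity
  obtain ⟨M, C, σ, hM, hC, hσ, hk⟩ := kern (n := n) hΛ
  have hH : ∀ x k l, |Hess u x k l| ≤ n * L := by
    intro x k l
    obtain ⟨Q, hQ, h⟩ := S.sp x
    rw [h]; exact dg_le hQ (hL x) k l
  have hA : Adm n (n * L) M (1 + L ^ 2)⁻¹ C σ (gr u) (fun i j x => Vol u x * (gMat u x)⁻¹ i j) :=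
    { hv := S.gr_sm
      ha := fun i j => S.smV.mul (S.smG i j)
      symm := fun i j x => by simp only [S.G_symm x i j]
      div := S.divf
      eqn := fun k x => by
        simp_rw [S.pd2_gr, mul_assoc, ← Finset.mul_sum, S.eqf, mul_zero]
      ell := S.ellf hL
      bdd := fun i j x => by
        have := (hk _ (hH x)).2.1 i j
        rwa [S.a_eq] at this
      lip := fun k j x => by rw [S.pd_gr]; exact hH x j k
      ker := fun A hA => by
        obtain ⟨-, -, K, hK, hb⟩ := hk A hA
        refine ⟨aM A, K, hK, fun i j x => ?_⟩
        have := hb _ (hH x) i j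
        rw [S.a_eq] at this
        simp_rw [S.pd_gr, S.H_symm _ _ x]
        refine this.trans (le_of_eq ?_)
        congr 1 }
  have hVM : ∀ x, Vol u x ≤ M := by
    intro x
    have := (hk _ (hH x)).1
    unfold V0 at this; rw [S.V_eq] at this; exact this
  have hV1 := S.one_le_V
  have hgr : ∀ k x, gr u k x ^ 2 ≤ (n * (n * L)) ^ 2 * ‖x‖ ^ 2 := by
    intro k x
    have := mvt' (f := pd k u) ((pd_smooth k S.hu).differentiable (by simp)) hΛ
      (fun x i => by rw [← S.H_apply]; exact hH x i k) x 0
    rw [sub_zero] at this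
    rw [← mul_pow, ← sq_abs]
    exact pow_le_pow_left₀ (abs_nonneg _) this 2
  set δ : ℝ := t / (t + 2) * ((1 + L ^ 2)⁻¹) ^ 3 / n ^ 3 with hδ
  have hδ0 : 0 < δ := by positivity
  have hW : 0 < 1 + n * (n * (n * L)) ^ 2 := by positivity
  have hmon := monot (v := gr u) (a := fun i j x => Vol u x * (gMat u x)⁻¹ i j) (s := ss u) (f := fun y => Real.log (Vol u y))
    (V := Vol u) hA.hv hA.ha hA.symm hA.div S.ss_sm S.smL S.smV.continuous
    (fun x => by
      unfold ss; rw [nsq]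
      linarith [Finset.sum_nonneg (s := Finset.univ) fun k (_ : k ∈ Finset.univ) => sq_nonneg (gr u k x)])
    (fun x => by linarith [hV1 x]) (fun x => Real.log_nonneg (hV1 x)) S.ss1 S.ss2 (B := M * M)
    (fun x => by
      have h1 := Real.log_le_self (x := Vol u x) (by linarith [hV1 x])
      exact mul_le_mul (h1.trans (hVM x)) (hVM x) (by linarith [hV1 x]) hM)
    (κ := Real.sqrt (2 * (1 + n * (n * (n * L)) ^ 2))) (by positivity)
    (fun x => by
      rw [Real.sq_sqrt (by positivity)]
      unfold ss; rw [nsq]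
      have : ∑ k, gr u k x ^ 2 ≤ ∑ k : Fin n, (n * (n * L)) ^ 2 * ‖x‖ ^ 2 := Finset.sum_le_sum fun k _ => hgr k x
      rw [Finset.sum_const, Finset.card_univ, Fintype.card_fin, nsmul_eq_mul] at this
      linarith)
    hδ0
    (fun x => by
      obtain ⟨Q, hQ, h⟩ := S.sp x
      have h1 := ptw2 (h := rot Q (fun k => T3 u k x)) ht (hL x) (hc x)
      rw [← S.lapL_diag x hQ h, S.rot_sum x hQ] at h1
      have h2 := S.D2s_le x
      have h3 : 0 ≤ ∑ k, ∑ i, ∑ j, T3 u k x i j ^ 2 :=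
        Finset.sum_nonneg fun _ _ => Finset.sum_nonneg fun _ _ => Finset.sum_nonneg fun _ _ => sq_nonneg _
      have h4 : δ * D2s (gr u) x ^ 2 ≤ t / (t + 2) * ((1 + L ^ 2)⁻¹) ^ 3 * ∑ k, ∑ i, ∑ j, T3 u k x i j ^ 2 := by
        refine (mul_le_mul_of_nonneg_left h2 hδ0.le).trans (le_of_eq ?_)
        rw [hδ, ← mul_assoc, div_mul_cancel₀ _ (by positivity)]
      have h5 : 0 ≤ t / (t + 2) * ((1 + L ^ 2)⁻¹) ^ 3 * ∑ k, ∑ i, ∑ j, T3 u k x i j ^ 2 := by positivity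
      simp_rw [mul_assoc (Vol u x), ← Finset.mul_sum]
      set Y := ∑ k, ∑ l, (gMat u x)⁻¹ k l * pd k (pd l (fun y => Real.log (Vol u y))) x
      nlinarith [hV1 x])
  have := flat (by positivity) hσ hC hM hΛ hA hmon j k i x
  rwa [S.pd2_gr] at this

lemma main (S : Sol u c lam) (hn : 0 < n) {ε : ℝ} (hε : 0 < ε)
    (hc : ∀ x i j, 0 ≤ 3 + (1 - ε) * lam x i ^ 2 + 2 * lam x i * lam x j) (x : Eu n) :
    2 * gradSq u (fun y => Vol u y ^ (ε / n : ℝ)) x / (Vol u x ^ (ε / n : ℝ)) ≤ lapg u (fun y => Vol u y ^ (ε / n : ℝ)) x := by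
  rcases le_or_gt ε 1 with h | h
  · exact S.case1 hn hε h hc x
  · exact S.case2 (by positivity) (S.flatT hn (t := ε - 1) (by linarith) fun x i j => by
      have := hc x i j; linarith) x

end Sol
end SL
end Part18

/-- The Jacobi inequality in the form `Δ_g b ≥ 2 |∇_g b|²_g / b` for
`b = V^{ε/n}` (Lemma 2.1, inequality (2.2)). -/
theorem stmt_2 {n : ℕ} (hn : 2 ≤ n) (u : EuclideanSpace ℝ (Fin n) → ℝ) (c : ℝ)
    (hu : ContDiff ℝ (⊤ : ℕ∞) u)
    (hsym : ∀ x, (Hess u x).IsHermitian)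
    (hsol : ∀ x, ∑ i, Real.arctan ((hsym x).eigenvalues i) = c)
    (ε : ℝ) (hε : 0 < ε)
    (hcond : ∀ x, ∀ i j : Fin n,
      0 ≤ 3 + (1 - ε) * ((hsym x).eigenvalues i) ^ 2 +
        2 * (hsym x).eigenvalues i * (hsym x).eigenvalues j) :
    ∀ x : EuclideanSpace ℝ (Fin n),
      2 * gradSq u (fun y => Vol u y ^ (ε / n : ℝ)) x /
          (Vol u x ^ (ε / n : ℝ)) ≤
        lapg u (fun y => Vol u y ^ (ε / n : ℝ)) x := by
  intro x
  have S : SL.Sol u c (fun x => (hsym x).eigenvalues) := ⟨hu, fun x => SL.spec (hsym x), hsol⟩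
  exact S.main (by omega) hε hcond x
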